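/- (Equality case in the ACF monotonicity formula.) Let u₊ and u₋ be continuous, locally Lipschitz functions on B₁ ⊂ ℝⁿ (n ≥ 2) such that u₊ ≥ 0, u₋ ≥ 0, u₊·u₋ = 0 in B₁, and each u_± is subharmonic in B₁ (in the distributional sense). Set Φ(r) = r^{-4} · (∫_{B_r} |∇u₊(x)|²/|x|^{n−2} dx) · (∫_{B_r} |∇u₋(x)|²/|x|^{n−2} dx). If Φ(r₁) = Φ(r₂) for some 0 < r₁ < r₂ < 1, then either (i) u₊ ≡ 0 in B_{r₂} or u₋ ≡ 0 in B_{r₂}, or (ii) there exist a unit vector e ∈ ℝⁿ and constants k₊ > 0, k₋ > 0 such that u₊(x) = k₊ (x·e)⁺ and u₋(x) = k₋ (x·e)⁻ for all x ∈ B_{r₂}. -/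

import Mathlib

/- Setting: the double obstacle problem
   Δu = f·χ_{Ω(u)∩{u<ψ}} + Δψ·χ_{Ω(u)∩{u=ψ}},  u ≤ ψ,
   following "Regularity of the free boundary for the double obstacle problem". -/

open Set Metric MeasureTheory Filter
open scoped RealInnerProductSpace NNReal

noncomputable section

/-- Euclidean space `ℝⁿ`. -/
abbrev E (n : ℕ) := EuclideanSpace ℝ (Fin n)

variable {n : ℕ}

/-- Pointwise Laplacian, via iterated `fderiv` along the coordinate directions
(defined a.e. for `C^{1,1}` functions, junk value elsewhere). -/
def lap (u : E n → ℝ) (x : E n) : ℝ :=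
  ∑ i : Fin n, fderiv ℝ (fun y => fderiv ℝ u y (EuclideanSpace.single i 1)) x
    (EuclideanSpace.single i 1)

/-- `Λ(v) = {x ∈ D : v(x) = 0, ∇v(x) = 0}`. -/
def Lam (D : Set (E n)) (v : E n → ℝ) : Set (E n) :=
  {x ∈ D | v x = 0 ∧ gradient v x = 0}

/-- `Ω(v) = D \ Λ(v)`. -/
def Om (D : Set (E n)) (v : E n → ℝ) : Set (E n) := D \ Lam D v

/-- `Γ(v) = ∂Λ(v) ∩ D`. -/
def Gam (D : Set (E n)) (v : E n → ℝ) : Set (E n) := frontier (Lam D v) ∩ D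

/-- `Λ^ψ(u) = {x ∈ D : u(x) = ψ(x)}`. -/
def LamPsi (D : Set (E n)) (u ψ : E n → ℝ) : Set (E n) := {x ∈ D | u x = ψ x}

/-- `Γ^ψ(u) = ∂Λ^ψ(u) ∩ D`. -/
def GamPsi (D : Set (E n)) (u ψ : E n → ℝ) : Set (E n) := frontier (LamPsi D u ψ) ∩ D

/-- The unit ball `B₁`. -/
def B1 (n : ℕ) : Set (E n) := ball 0 1

/-- The class `P₁(M)`: `f ∈ C^{0,1}(B₁)`, `ψ ∈ C^{1,1}(B₁) ∩ C^{2,1}(closure Ω(ψ))`,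
`u ∈ C^{1,1}(B₁)` with `‖D²u‖_{L^∞(B₁)} ≤ M`, `u ≤ ψ` in `B₁`,
`Δu = f·χ_{Ω(u)∩{u<ψ}} + Δψ·χ_{Ω(u)∩{u=ψ}}` a.e. in `B₁`, and `0 ∈ Γ^d(u)`. -/
structure P1 (n : ℕ) (M : ℝ) (u ψ f : E n → ℝ) : Prop where
  f_lip : ∃ K : ℝ≥0, LipschitzOnWith K f (B1 n)
  psi_c1 : ContDiffOn ℝ 1 ψ (B1 n)
  psi_c11 : ∃ K : ℝ≥0, LipschitzOnWith K (fderiv ℝ ψ) (B1 n)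
  psi_c2 : ContDiffOn ℝ 2 ψ (Om (B1 n) ψ)
  psi_c21 : ∃ K : ℝ≥0, LipschitzOnWith K (fderiv ℝ (fderiv ℝ ψ)) (closure (Om (B1 n) ψ))
  u_c1 : ContDiffOn ℝ 1 u (B1 n)
  u_c11 : LipschitzOnWith (Real.toNNReal M) (fderiv ℝ u) (B1 n)
  u_le : ∀ x ∈ B1 n, u x ≤ ψ x
  u_eq : ∀ᵐ x : E n, x ∈ B1 n →
    lap u x = (Om (B1 n) u ∩ {y | u y < ψ y}).indicator f x
      + (Om (B1 n) u ∩ {y | u y = ψ y}).indicator (lap ψ) x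
  zero_mem : (0 : E n) ∈ Gam (B1 n) u ∩ GamPsi (B1 n) u ψ

/-- Minimal diameter: least distance between two parallel hyperplanes whose
enclosed slab contains `A`. -/
def MD (A : Set (E n)) : ℝ :=
  sInf {d : ℝ | 0 ≤ d ∧ ∃ (e : E n) (b : ℝ), ‖e‖ = 1 ∧
    ∀ x ∈ A, b ≤ ⟪x, e⟫ ∧ ⟪x, e⟫ ≤ b + d}

/-- Thickness `δ_r(v) = MD(Λ(v) ∩ B_r)/r` (centered at the origin). -/
def thick (D : Set (E n)) (v : E n → ℝ) (r : ℝ) : ℝ := MD (Lam D v ∩ ball (0 : E n) r) / r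

/-- `v` is subharmonic on `D` in the distributional sense:
`∫_D v Δφ ≥ 0` for every nonnegative smooth `φ` compactly supported in `D`. -/
def SubharmonicOn (D : Set (E n)) (v : E n → ℝ) : Prop :=
  ∀ φ : E n → ℝ, ContDiff ℝ (⊤ : ℕ∞) φ → HasCompactSupport φ → tsupport φ ⊆ D →
    (∀ x, 0 ≤ φ x) → 0 ≤ ∫ x in D, v x * lap φ x

/-- The Alt–Caffarelli–Friedman functional
`Φ(r) = r⁻⁴ (∫_{B_r} |∇u₊|²/|x|^{n-2}) (∫_{B_r} |∇u₋|²/|x|^{n-2})`. -/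
def ACF (n : ℕ) (up um : E n → ℝ) (r : ℝ) : ℝ :=
  1 / r ^ 4 * (∫ x in ball (0 : E n) r, ‖gradient up x‖ ^ 2 / ‖x‖ ^ (n - 2))
    * (∫ x in ball (0 : E n) r, ‖gradient um x‖ ^ 2 / ‖x‖ ^ (n - 2))

section kant
variable {X : Type*} [MetricSpace X] [CompactSpace X] [Nonempty X]

/-- the c-transform -/
def ctr (c : X → X → ℝ) (a : X → ℝ) (y : X) : ℝ := ⨅ x, (c x y - a x)

lemma ctr_bdd (c : X → X → ℝ) (a : X → ℝ) (L : ℝ≥0) (h1 : ∀ y, LipschitzWith L (fun x => c x y))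
    (ha : Continuous a) (y : X) : BddBelow (range fun x => c x y - a x) :=
  (isCompact_range ((h1 y).continuous.sub ha)).bddBelow

lemma ctr_lip (c : X → X → ℝ) (a : X → ℝ) (L : ℝ≥0) (h1 : ∀ y, LipschitzWith L (fun x => c x y))
    (h2 : ∀ x, LipschitzWith L (c x)) (ha : Continuous a) : LipschitzWith L (ctr c a) := by
  refine LipschitzWith.of_le_add_mul L fun y y' => ?_
  rw [← sub_le_iff_le_add]
  refine le_ciInf fun x => ?_
  have := ciInf_le (ctr_bdd c a L h1 ha y) x
  have h3 := (h2 x).dist_le_mul y y'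
  rw [Real.dist_eq] at h3
  have := le_abs_self (c x y - c x y')
  simp only [ctr]
  linarith

lemma ctr_le (c : X → X → ℝ) (a : X → ℝ) (L : ℝ≥0) (h1 : ∀ y, LipschitzWith L (fun x => c x y))
    (ha : Continuous a) (x y : X) : a x + ctr c a y ≤ c x y := by
  have := ciInf_le (ctr_bdd c a L h1 ha y) x
  simp only [ctr]
  linarith

lemma ctr_mono_dist (c : X → X → ℝ) (a b : X → ℝ) (L : ℝ≥0)
    (h1 : ∀ y, LipschitzWith L (fun x => c x y))
    (ha : Continuous a) (s : ℝ) (hab : ∀ x, b x ≤ a x + s) (y : X) :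
    ctr c a y ≤ ctr c b y + s := by
  rw [← sub_le_iff_le_add]
  refine le_ciInf fun x => ?_
  have := ctr_le c a L h1 ha x y
  have := hab x
  linarith

variable [MeasurableSpace X] [BorelSpace X]

theorem kant_dual (c : X → X → ℝ) (L : ℝ≥0) (h1 : ∀ y, LipschitzWith L (fun x => c x y))
    (h2 : ∀ x, LipschitzWith L (c x)) (μ ν : Measure X) [IsProbabilityMeasure μ]
    [IsProbabilityMeasure ν] :
    ∃ φ ψ : X → ℝ, LipschitzWith L φ ∧ LipschitzWith L ψ ∧ (∀ x y, φ x + ψ y ≤ c x y) ∧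
      ∀ a b : X → ℝ, Continuous a → Continuous b → (∀ x y, a x + b y ≤ c x y) →
        ∫ x, a x ∂μ + ∫ x, b x ∂ν ≤ ∫ x, φ x ∂μ + ∫ x, ψ x ∂ν := by
  classical
  let x0 : X := Classical.arbitrary X
  have hintg : ∀ (m : Measure X) [IsProbabilityMeasure m] (f : X → ℝ), Continuous f →
      Integrable f m := fun m _ f hf => hf.integrable_of_hasCompactSupport
        (HasCompactSupport.of_compactSpace f)
  let D := diam (univ : Set X)
  let A : Set (BoundedContinuousFunction X ℝ) := {f | LipschitzWith L f ∧ f x0 = 0}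
  have hAc : IsClosed A := by
    have : A = (⋂ x, ⋂ y, {f : BoundedContinuousFunction X ℝ | dist (f x) (f y) ≤ L * dist x y})
        ∩ {f | f x0 = 0} := by
      ext f
      simp [A, lipschitzWith_iff_dist_le_mul]
    rw [this]
    refine IsClosed.inter (isClosed_iInter fun x => isClosed_iInter fun y => ?_) ?_
    · exact isClosed_le (by fun_prop) continuous_const
    · exact isClosed_eq (by fun_prop) continuous_const
  have hAcomp : IsCompact A := by
    refine BoundedContinuousFunction.arzela_ascoli₂ (Icc (-(L * D)) (L * D)) isCompact_Icc A hAc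
      ?_ ?_
    · rintro f x ⟨hf, hf0⟩
      have h := hf.dist_le_mul x x0
      rw [hf0, Real.dist_eq, sub_zero] at h
      have hd : dist x x0 ≤ D := dist_le_diam_of_mem isBounded_of_compactSpace (mem_univ _) (mem_univ _)
      have : (L : ℝ) * dist x x0 ≤ L * D := mul_le_mul_of_nonneg_left hd L.2
      exact abs_le.1 (h.trans this)
    · exact (LipschitzWith.uniformEquicontinuous _ L (fun f => f.2.1)).equicontinuous
  let F : BoundedContinuousFunction X ℝ → ℝ := fun f => ∫ x, f x ∂μ + ∫ x, ctr c f x ∂ν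
  have hF : Continuous F := by
    refine Continuous.add ?_ ?_
    · refine (LipschitzWith.of_le_add_mul 1 fun f g => ?_ : LipschitzWith 1
          (fun f : BoundedContinuousFunction X ℝ => ∫ x, f x ∂μ)).continuous
      have : ∫ x, f x ∂μ ≤ ∫ x, (g x + dist f g) ∂μ := by
        refine integral_mono (hintg μ _ f.continuous) (hintg μ _ (by fun_prop)) fun x => ?_
        have := f.dist_coe_le_dist (g := g) x
        rw [Real.dist_eq] at this
        have := le_abs_self (f x - g x)
        simp only; linarith
      rw [integral_add (hintg μ _ g.continuous) (integrable_const _)] at this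
      simpa using this
    · refine (LipschitzWith.of_le_add_mul 1 fun f g => ?_ : LipschitzWith 1
          (fun f : BoundedContinuousFunction X ℝ => ∫ x, ctr c f x ∂ν)).continuous
      have : ∫ x, ctr c f x ∂ν ≤ ∫ x, (ctr c g x + dist f g) ∂ν := by
        refine integral_mono (hintg ν _ (ctr_lip c f L h1 h2 f.continuous).continuous)
          (hintg ν _ ((ctr_lip c g L h1 h2 g.continuous).continuous.add continuous_const))
          fun x => ?_
        refine ctr_mono_dist c f g L h1 f.continuous _ (fun x => ?_) x
        have := f.dist_coe_le_dist (g := g) x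
        rw [Real.dist_eq, abs_sub_comm] at this
        have := le_abs_self (g x - f x)
        linarith
      rw [integral_add (hintg ν _ (ctr_lip c g L h1 h2 g.continuous).continuous)
        (integrable_const _)] at this
      simpa using this
  have hne : A.Nonempty := ⟨0, by
    refine ⟨?_, rfl⟩
    exact LipschitzWith.const' 0⟩
  obtain ⟨φ, hφA, hmax⟩ := hAcomp.exists_isMaxOn hne hF.continuousOn
  refine ⟨φ, ctr c φ, hφA.1, ctr_lip c φ L h1 h2 φ.continuous, fun x y =>
    ctr_le c φ L h1 φ.continuous x y, fun a b ha hb hab => ?_⟩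
  -- double transform
  have hac := ctr_lip c a L h1 h2 ha
  let c' : X → X → ℝ := fun x y => c y x
  have h1' : ∀ y, LipschitzWith L (fun x => c' x y) := h2
  have h2' : ∀ x, LipschitzWith L (c' x) := h1
  let g := ctr c' (ctr c a)
  have hg : LipschitzWith L g := ctr_lip c' _ L h1' h2' hac.continuous
  have hag : ∀ x, a x ≤ g x := fun x => le_ciInf fun y => by
    have := ctr_le c a L h1 ha x y
    simp only [c']; linarith
  have hgc : ∀ y, b y ≤ ctr c g y := fun y => le_ciInf fun x => by
    have := ctr_le c' (ctr c a) L h1' hac.continuous y x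
    have h3 : b y ≤ ctr c a y := le_ciInf fun x => by linarith [hab x y]
    simp only [c', g] at *; linarith
  let g1 : BoundedContinuousFunction X ℝ := BoundedContinuousFunction.mkOfCompact
    ⟨fun x => g x - g x0, hg.continuous.sub continuous_const⟩
  have hg1 : g1 ∈ A := by
    refine ⟨?_, by simp [g1]⟩
    refine LipschitzWith.of_dist_le_mul fun x y => ?_
    simpa [g1] using hg.dist_le_mul x y
  have hm := hmax hg1
  have e1 : ∫ x, a x ∂μ ≤ ∫ x, g x ∂μ := integral_mono (hintg μ _ ha) (hintg μ _ hg.continuous) hag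
  have e2 : ∫ x, g1 x ∂μ = ∫ x, g x ∂μ - g x0 := by
    simp only [g1, BoundedContinuousFunction.mkOfCompact_apply, ContinuousMap.coe_mk]
    rw [integral_sub (hintg μ _ hg.continuous) (integrable_const _)]
    simp
  have e3 : ∫ x, b x ∂ν + g x0 ≤ ∫ x, ctr c g1 x ∂ν := by
    have : ∫ x, (b x + g x0) ∂ν ≤ ∫ x, ctr c g1 x ∂ν := by
      refine integral_mono (hintg ν _ (hb.add continuous_const))
        (hintg ν _ (ctr_lip c g1 L h1 h2 g1.continuous).continuous) fun y => ?_
      have := ctr_mono_dist c g g1 L h1 hg.continuous (- g x0) (fun x => by simp [g1, sub_eq_add_neg]) y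
      have := hgc y
      simp only; linarith
    rw [integral_add (hintg ν _ hb) (integrable_const _)] at this
    simpa using this
  have hm' : F g1 ≤ F φ := hm
  simp only [F] at hm'
  linarith
end kant

section kant
variable {X : Type*} [MetricSpace X] [CompactSpace X] [Nonempty X]
  [MeasurableSpace X] [BorelSpace X]

open CompactlySupported in
/-- Riesz representation on a compact space, from a linear functional on `C(Y, ℝ)`. -/
lemma riesz_compact {Y : Type*} [TopologicalSpace Y] [T2Space Y] [CompactSpace Y]
    [MeasurableSpace Y] [BorelSpace Y]
    (g : C(Y, ℝ) →ₗ[ℝ] ℝ) (hg : ∀ f : C(Y, ℝ), (∀ y, 0 ≤ f y) → 0 ≤ g f) :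
    ∃ π : Measure Y, IsFiniteMeasure π ∧ ∀ f : C(Y, ℝ), ∫ y, f y ∂π = g f := by
  let Λ0 : C_c(Y, ℝ) →ₗ[ℝ] ℝ :=
    { toFun := fun f => g f.toContinuousMap
      map_add' := fun a b => by
        rw [← map_add]; rfl
      map_smul' := fun a b => by
        simp only [RingHom.id_apply]
        rw [← map_smul]; rfl }
  let Λ : C_c(Y, ℝ) →ₚ[ℝ] ℝ := PositiveLinearMap.mk₀ Λ0 (fun f hf => hg _ (fun y => hf y))
  refine ⟨RealRMK.rieszMeasure Λ, inferInstance, fun f => ?_⟩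
  have := RealRMK.integral_rieszMeasure Λ (CompactlySupportedContinuousMap.continuousMapEquiv f)
  exact this

theorem kant_plan (c : X → X → ℝ) (hc : Continuous fun z : X × X => c z.1 z.2)
    (μ ν : Measure X) [IsProbabilityMeasure μ]
    [IsProbabilityMeasure ν] (φ ψ : X → ℝ) (hφ : Continuous φ) (hψ : Continuous ψ)
    (hle : ∀ x y, φ x + ψ y ≤ c x y)
    (hmax : ∀ a b : X → ℝ, Continuous a → Continuous b → (∀ x y, a x + b y ≤ c x y) →
        ∫ x, a x ∂μ + ∫ x, b x ∂ν ≤ ∫ x, φ x ∂μ + ∫ x, ψ x ∂ν) :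
    ∃ π : Measure (X × X), π.map Prod.fst = μ ∧ π.map Prod.snd = ν ∧
      ∀ᵐ z ∂π, φ z.1 + ψ z.2 = c z.1 z.2 := by
  classical
  have hintg : ∀ (m : Measure X) [IsProbabilityMeasure m] (f : X → ℝ), Continuous f →
      Integrable f m := fun m _ f hf => hf.integrable_of_hasCompactSupport
        (HasCompactSupport.of_compactSpace f)
  have hint2 : ∀ (m : Measure (X × X)) [IsFiniteMeasure m] (f : X × X → ℝ), Continuous f →
      Integrable f m := fun m _ f hf => hf.integrable_of_hasCompactSupport
        (HasCompactSupport.of_compactSpace f)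
  let Z : Set (X × X) := {z | φ z.1 + ψ z.2 = c z.1 z.2}
  let s : PointedCone ℝ C(X × X, ℝ) :=
    { carrier := {f | ∀ z ∈ Z, 0 ≤ f z}
      add_mem' := fun {a b} ha hb z hz => add_nonneg (ha z hz) (hb z hz)
      zero_mem' := fun z hz => le_rfl
      smul_mem' := fun r f hf z hz => mul_nonneg r.2 (hf z hz) }
  have mem_s : ∀ f : C(X × X, ℝ), f ∈ s ↔ ∀ z ∈ Z, 0 ≤ f z := fun f => Iff.rfl
  let T : C(X, ℝ) × C(X, ℝ) →ₗ[ℝ] C(X × X, ℝ) :=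
    { toFun := fun ab => ab.1.comp ContinuousMap.fst + ab.2.comp ContinuousMap.snd
      map_add' := fun a b => by ext z; simp; ring
      map_smul' := fun r a => by ext z; simp }
  let I : C(X × X, ℝ) →ₗ[ℝ] ℝ :=
    { toFun := fun f => ∫ z, f z ∂(μ.prod ν)
      map_add' := fun a b => by
        simp only [ContinuousMap.add_apply]
        exact integral_add (hint2 _ _ a.continuous) (hint2 _ _ b.continuous)
      map_smul' := fun r a => by
        simp only [ContinuousMap.smul_apply, RingHom.id_apply]
        exact integral_smul _ _ }
  have hI : ∀ ab, I (T ab) = ∫ x, ab.1 x ∂μ + ∫ x, ab.2 x ∂ν := by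
    intro ab
    change ∫ z, (ab.1 z.1 + ab.2 z.2) ∂(μ.prod ν) = _
    rw [integral_add (hint2 _ _ (by fun_prop)) (hint2 _ _ (by fun_prop))]
    congr 1
    · rw [integral_fun_fst]; simp
    · rw [integral_fun_snd]; simp
  -- positivity
  have hpos : ∀ ab, T ab ∈ s → 0 ≤ I (T ab) := by
    intro ab hab
    rw [hI]
    by_contra hneg
    push Not at hneg
    set δ : ℝ := -(∫ x, ab.1 x ∂μ + ∫ x, ab.2 x ∂ν) / 2 with hδ
    have hδ0 : 0 < δ := by rw [hδ]; linarith
    -- set where a + b ≤ -δ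
    let W : Set (X × X) := {z | ab.1 z.1 + ab.2 z.2 ≤ -δ}
    have hW : IsCompact W :=
      (isClosed_le (by fun_prop) continuous_const).isCompact
    have hcont : Continuous fun z : X × X => c z.1 z.2 - φ z.1 - ψ z.2 := by fun_prop
    have hslack : ∃ η > 0, ∀ z ∈ W, η ≤ c z.1 z.2 - φ z.1 - ψ z.2 := by
      rcases W.eq_empty_or_nonempty with h | h
      · exact ⟨1, one_pos, by simp [h]⟩
      · obtain ⟨z0, hz0, hm⟩ := hW.exists_isMinOn h hcont.continuousOn
        refine ⟨_, ?_, fun z hz => hm hz⟩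
        have h1 := hle z0.1 z0.2
        rcases h1.lt_or_eq with h2 | h2
        · linarith
        · have h3 : 0 ≤ ab.1 z0.1 + ab.2 z0.2 := hab z0 h2
          have h4 : ab.1 z0.1 + ab.2 z0.2 ≤ -δ := hz0
          linarith
    obtain ⟨η, hη, hslack⟩ := hslack
    obtain ⟨M, hM⟩ : ∃ M, ∀ z : X × X, |ab.1 z.1 + ab.2 z.2| ≤ M := by
      have : IsCompact (range fun z : X × X => |ab.1 z.1 + ab.2 z.2|) :=
        isCompact_range (by fun_prop)
      obtain ⟨M, hM⟩ := this.bddAbove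
      exact ⟨M, fun z => hM ⟨z, rfl⟩⟩
    have hM0 : 0 ≤ M := (abs_nonneg _).trans (hM (Classical.arbitrary X, Classical.arbitrary X))
    let t : ℝ := η / (M + 1)
    have ht : 0 < t := by positivity
    have := hmax (fun x => φ x - t * ab.1 x - t * δ) (fun y => ψ y - t * ab.2 y)
      (by fun_prop) (by fun_prop) (by
        intro x y
        have e1 := hle x y
        by_cases hz : (x, y) ∈ W
        · have e2 := hslack _ hz
          have e3 := hM (x, y)
          simp only at e2 e3
          have e4 := neg_abs_le (ab.1 x + ab.2 y)
          have e5 : t * -(ab.1 x + ab.2 y) ≤ t * (M + 1) := by gcongr; linarith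
          have e6 : t * (M + 1) = η := by simp only [t]; field_simp
          have e7 : 0 < t * δ := by positivity
          nlinarith
        · have e2 : -δ < ab.1 x + ab.2 y := not_le.1 hz
          nlinarith)
    rw [integral_sub (hintg μ _ (by fun_prop)) (integrable_const _),
      integral_sub (hintg μ _ (by fun_prop)) (hintg μ _ (by fun_prop)),
      integral_sub (hintg ν _ (by fun_prop)) (hintg ν _ (by fun_prop)),
      integral_const_mul] at this
    have e8 : ∫ x, t * ab.2 x ∂ν = t * ∫ x, ab.2 x ∂ν := integral_const_mul _ _
    rw [e8] at this
    simp at this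
    have h9 : ∫ x, ab.1 x ∂μ + ∫ x, ab.2 x ∂ν = -2 * δ := by rw [hδ]; ring
    have h10 : t * (∫ x, ab.1 x ∂μ + ∫ x, ab.2 x ∂ν) = t * (-2 * δ) := by rw [h9]
    have h11 : 0 < t * δ := by positivity
    linarith
  let f : C(X × X, ℝ) →ₗ.[ℝ] ℝ := ⟨LinearMap.range T, I.comp (LinearMap.range T).subtype⟩
  obtain ⟨g, hgf, hgs⟩ := riesz_extension s f
    (by
      rintro ⟨_, ab, rfl⟩ hx
      exact hpos ab hx)
    (by
      intro y
      refine ⟨⟨T (⟨fun _ => ‖y‖, continuous_const⟩, 0), _, rfl⟩, fun z hz => ?_⟩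
      have := y.norm_coe_le_norm z
      rw [Real.norm_eq_abs] at this
      have := neg_abs_le (y z)
      simp [T]
      linarith)
  obtain ⟨π, hπ, hπg⟩ := riesz_compact g (fun f hf => hgs f (fun z _ => hf z))
  have hT : ∀ ab, ∫ z, (T ab) z ∂π = ∫ x, ab.1 x ∂μ + ∫ x, ab.2 x ∂ν := fun ab => by
    rw [hπg, ← hI]
    exact hgf ⟨T ab, _, rfl⟩
  refine ⟨π, ?_, ?_, ?_⟩
  · have : IsFiniteMeasure (π.map Prod.fst) := inferInstance
    refine ext_of_forall_integral_eq_of_IsFiniteMeasure fun f => ?_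
    rw [integral_map (by fun_prop) (by fun_prop)]
    have := hT (f.toContinuousMap, 0)
    simpa [T] using this
  · have : IsFiniteMeasure (π.map Prod.snd) := inferInstance
    refine ext_of_forall_integral_eq_of_IsFiniteMeasure fun f => ?_
    rw [integral_map (by fun_prop) (by fun_prop)]
    have := hT (0, f.toContinuousMap)
    simpa [T] using this
  · let G : C(X × X, ℝ) := ⟨fun z => c z.1 z.2 - (φ z.1 + ψ z.2), by fun_prop⟩
    have h1 : 0 ≤ g G := hgs _ fun z hz => by
      have : φ z.1 + ψ z.2 = c z.1 z.2 := hz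
      simp [G, this]
    have h2 : 0 ≤ g (-G) := hgs _ fun z hz => by
      have : φ z.1 + ψ z.2 = c z.1 z.2 := hz
      simp [G, this]
    rw [map_neg] at h2
    have h3 : ∫ z, G z ∂π = 0 := by rw [hπg]; linarith
    rw [integral_eq_zero_iff_of_nonneg (fun z => by simp [G]; exact hle _ _)
      (hint2 _ _ G.continuous)] at h3
    filter_upwards [h3] with z hz
    simp [G] at hz
    linarith
end kant

section kantV
variable {V : Type*} [NormedAddCommGroup V] [InnerProductSpace ℝ V] [FiniteDimensional ℝ V]
  [MeasurableSpace V] [BorelSpace V]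

theorem kant_V (R : ℝ) (hR : 0 ≤ R) (μ ν : Measure V) [IsProbabilityMeasure μ]
    [IsProbabilityMeasure ν] (hμ : μ (closedBall 0 R)ᶜ = 0) (hν : ν (closedBall 0 R)ᶜ = 0)
    (c : V → V → ℝ) (L : ℝ≥0) (h1 : ∀ y, LipschitzWith L (fun x => c x y))
    (h2 : ∀ x, LipschitzWith L (c x)) (hc : Continuous fun z : V × V => c z.1 z.2) :
    ∃ φ ψ : V → ℝ, LipschitzWith L φ ∧ LipschitzWith L ψ ∧
      (∀ x ∈ closedBall (0 : V) R, ∀ y ∈ closedBall (0 : V) R, φ x + ψ y ≤ c x y) ∧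
      ∃ π : Measure (V × V), π.map Prod.fst = μ ∧ π.map Prod.snd = ν ∧
        ∀ᵐ z ∂π, φ z.1 + ψ z.2 = c z.1 z.2 := by
  let X := closedBall (0 : V) R
  have hXm : MeasurableSet X := isClosed_closedBall.measurableSet
  have : Nonempty X := ⟨⟨0, by simp [X, hR]⟩⟩
  have : CompactSpace X := isCompact_iff_compactSpace.1 (isCompact_closedBall _ _)
  have key : ∀ m : Measure V, IsProbabilityMeasure m → m Xᶜ = 0 →
      (m.comap (Subtype.val : X → V)).map Subtype.val = m := by
    intro m _ hm
    rw [(MeasurableEmbedding.subtype_coe hXm).map_comap, Subtype.range_val]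
    exact Measure.restrict_eq_self_of_ae_mem (mem_ae_iff.2 hm)
  let μ' : Measure X := μ.comap Subtype.val
  let ν' : Measure X := ν.comap Subtype.val
  have hμ' : μ'.map Subtype.val = μ := key μ inferInstance hμ
  have hν' : ν'.map Subtype.val = ν := key ν inferInstance hν
  have pr : ∀ m : Measure X, IsProbabilityMeasure (m.map Subtype.val) → IsProbabilityMeasure m := by
    intro m hm
    refine ⟨?_⟩
    have h := hm.measure_univ
    rwa [Measure.map_apply measurable_subtype_coe MeasurableSet.univ, preimage_univ] at h
  have : IsProbabilityMeasure μ' := pr _ (by rw [hμ']; infer_instance)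
  have : IsProbabilityMeasure ν' := pr _ (by rw [hν']; infer_instance)
  obtain ⟨φ, ψ, hφ, hψ, hle, hmax⟩ := kant_dual (fun x y : X => c x y) L
    (fun y => LipschitzWith.of_dist_le_mul fun a b => (h1 y).dist_le_mul a b)
    (fun x => LipschitzWith.of_dist_le_mul fun a b => (h2 x).dist_le_mul a b) μ' ν'
  obtain ⟨π, hπ1, hπ2, hπ⟩ := kant_plan (fun x y : X => c x y) (by fun_prop) μ' ν' φ ψ
    hφ.continuous hψ.continuous hle hmax
  have ext : ∀ f : X → ℝ, LipschitzWith L f → ∃ g : V → ℝ, LipschitzWith L g ∧ ∀ x : X, g x = f x := by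
    intro f hf
    have : LipschitzOnWith L (Function.extend Subtype.val f 0) X := by
      refine LipschitzOnWith.of_dist_le_mul fun x hx y hy => ?_
      have e1 := Subtype.val_injective.extend_apply f 0 (⟨x, hx⟩ : X)
      have e2 := Subtype.val_injective.extend_apply f 0 (⟨y, hy⟩ : X)
      simp only at e1 e2
      rw [e1, e2]
      exact hf.dist_le_mul _ _
    obtain ⟨g, hg, hgf⟩ := this.extend_real
    refine ⟨g, hg, fun x => ?_⟩
    rw [← hgf x.2]
    exact Subtype.val_injective.extend_apply f 0 x
  obtain ⟨φ1, hφ1, eφ⟩ := ext φ hφ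
  obtain ⟨ψ1, hψ1, eψ⟩ := ext ψ hψ
  let j : X × X → V × V := fun z => (z.1, z.2)
  have hj : Measurable j := by fun_prop
  refine ⟨φ1, ψ1, hφ1, hψ1, fun x hx y hy => ?_, π.map j, ?_, ?_, ?_⟩
  · have := hle ⟨x, hx⟩ ⟨y, hy⟩
    rw [← eφ, ← eψ] at this
    exact this
  · rw [Measure.map_map measurable_fst hj, ← hμ', ← hπ1,
      Measure.map_map measurable_subtype_coe measurable_fst]
    rfl
  · rw [Measure.map_map measurable_snd hj, ← hν', ← hπ2,
      Measure.map_map measurable_subtype_coe measurable_snd]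
    rfl
  · rw [ae_map_iff hj.aemeasurable]
    · filter_upwards [hπ] with z hz
      simp only [j, eφ, eψ]
      exact hz
    · exact (isClosed_eq ((hφ1.continuous.comp continuous_fst).add
        (hψ1.continuous.comp continuous_snd)) hc).measurableSet
end kantV

section kern
/-- the regularised logarithmic kernel -/
def kk (ε s : ℝ) : ℝ := (1 / 2) * Real.log (s ^ 2 + ε ^ 2)

theorem kk_second (ε d s : ℝ) (hε : 0 < ε) :
    kk ε (d + s) + kk ε (d - s) - 2 * kk ε d ≤
      s ^ 2 * ((ε ^ 2 - d ^ 2) / (d ^ 2 + ε ^ 2) ^ 2) + s ^ 4 / (2 * (d ^ 2 + ε ^ 2) ^ 2) := by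
  have hD : 0 < d ^ 2 + ε ^ 2 := by positivity
  have h1 : 0 < (d + s) ^ 2 + ε ^ 2 := by positivity
  have h2 : 0 < (d - s) ^ 2 + ε ^ 2 := by positivity
  have key : kk ε (d + s) + kk ε (d - s) - 2 * kk ε d =
      (1 / 2) * Real.log (((d + s) ^ 2 + ε ^ 2) * ((d - s) ^ 2 + ε ^ 2) / (d ^ 2 + ε ^ 2) ^ 2) := by
    rw [Real.log_div (by positivity) (by positivity), Real.log_mul h1.ne' h2.ne', Real.log_pow]
    unfold kk; push_cast; ring
  rw [key]
  have h3 := Real.log_le_sub_one_of_pos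
    (x := ((d + s) ^ 2 + ε ^ 2) * ((d - s) ^ 2 + ε ^ 2) / (d ^ 2 + ε ^ 2) ^ 2) (by positivity)
  refine (mul_le_mul_of_nonneg_left h3 (by norm_num)).trans (le_of_eq ?_)
  field_simp
  ring

theorem kk_even (ε s : ℝ) : kk ε (-s) = kk ε s := by simp [kk]

theorem kk_abs (ε s : ℝ) : kk ε |s| = kk ε s := by simp [kk]

theorem kk_deriv (ε s : ℝ) (hε : 0 < ε) :
    HasDerivAt (kk ε) (s / (s ^ 2 + ε ^ 2)) s := by
  have hD : 0 < s ^ 2 + ε ^ 2 := by positivity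
  have h := ((((hasDerivAt_id s).pow 2).add_const (ε ^ 2)).log hD.ne').const_mul (1 / 2 : ℝ)
  refine h.congr_deriv ?_
  simp
  field_simp

theorem kk_lip (ε : ℝ) (hε : 0 < ε) : LipschitzWith (Real.toNNReal (1 / ε)) (kk ε) := by
  refine lipschitzWith_of_nnnorm_deriv_le (fun s => (kk_deriv ε s hε).differentiableAt) fun s => ?_
  rw [(kk_deriv ε s hε).deriv, ← NNReal.coe_le_coe, Real.coe_toNNReal _ (by positivity)]
  simp only [coe_nnnorm, Real.norm_eq_abs]
  have hD : 0 < s ^ 2 + ε ^ 2 := by positivity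
  rw [abs_div, abs_of_pos hD, div_le_div_iff₀ hD hε]
  nlinarith [sq_nonneg (|s| - ε), sq_abs s, abs_nonneg s]

variable {V : Type*} [NormedAddCommGroup V] [InnerProductSpace ℝ V]

theorem cost_lip1 (ε : ℝ) (hε : 0 < ε) (y : V) :
    LipschitzWith (Real.toNNReal (1 / ε)) (fun x : V => kk ε ‖x - y‖) := by
  have h := (kk_lip ε hε).comp (f := kk ε) (g := fun x : V => dist x y) (LipschitzWith.dist_left y)
  simpa [Function.comp_def, dist_eq_norm] using h

theorem cost_lip2 (ε : ℝ) (hε : 0 < ε) (x : V) :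
    LipschitzWith (Real.toNNReal (1 / ε)) (fun y : V => kk ε ‖x - y‖) := by
  have h := cost_lip1 ε hε x
  simpa [norm_sub_rev] using h

theorem cost_fderiv [CompleteSpace V] (ε : ℝ) (hε : 0 < ε) (x y : V) :
    HasGradientAt (fun x : V => kk ε ‖x - y‖) ((1 / (‖x - y‖ ^ 2 + ε ^ 2)) • (x - y)) x := by
  have hD : 0 < ‖x - y‖ ^ 2 + ε ^ 2 := by positivity
  have h := (((((hasFDerivAt_id x).sub_const y).norm_sq).add_const (ε ^ 2)).log hD.ne').const_mul (1 / 2 : ℝ)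
  rw [hasGradientAt_iff_hasFDerivAt]
  refine h.congr_fderiv ?_
  ext v
  simp
  ring

theorem grad_of_le [CompleteSpace V] {f g : V → ℝ} {x v : V} (hf : DifferentiableAt ℝ f x)
    (hg : HasGradientAt g v x) (hle : ∀ᶠ z in nhds x, f z - f x ≤ g z - g x) : gradient f x = v := by
  have hmin : IsLocalMin (fun z => g z - f z) x := by
    filter_upwards [hle] with z hz; linarith
  have h := hmin.hasFDerivAt_eq_zero (hg.hasFDerivAt.sub hf.hasGradientAt.hasFDerivAt)
  have h2 := sub_eq_zero.1 h
  exact ((InnerProductSpace.toDual ℝ V).injective h2).symm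

variable [FiniteDimensional ℝ V] [MeasurableSpace V] [BorelSpace V]

/-- second moment constant of the unit ball -/
theorem ball_moment [Nontrivial V] : ∃ m : ℝ, 0 < m ∧
    ∀ a b : V, ∫ z in ball (0 : V) 1, ⟪a, z⟫ * ⟪b, z⟫ = m * ⟪a, b⟫ := by
  obtain ⟨e0, he0⟩ := exists_ne (0 : V)
  let e : V := (‖e0‖⁻¹) • e0
  have he : ‖e‖ = 1 := by
    simp [e, norm_smul, he0]
  have hintg : ∀ a b : V, IntegrableOn (fun z => ⟪a, z⟫ * ⟪b, z⟫) (ball (0 : V) 1) := by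
    intro a b
    have hc : Continuous (fun z : V => ⟪a, z⟫ * ⟪b, z⟫) := by fun_prop
    exact (hc.continuousOn.integrableOn_compact (isCompact_closedBall (0 : V) 1)).mono_set
      ball_subset_closedBall
  let Q : V → ℝ := fun a => ∫ z in ball (0 : V) 1, ⟪a, z⟫ * ⟪a, z⟫
  have hQe : ∀ a : V, ‖a‖ = 1 → Q a = Q e := by
    intro a ha
    let T := (Submodule.span ℝ {a - e})ᗮ.reflection
    have hT : T a = e := Submodule.reflection_sub (by rw [ha, he])
    have hmp : MeasurePreserving T (volume : Measure V) volume := T.measurePreserving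
    have h := hmp.setIntegral_preimage_emb T.toHomeomorph.measurableEmbedding
      (fun z => ⟪e, z⟫ * ⟪e, z⟫) (ball 0 1)
    have hpre : T ⁻¹' (ball (0 : V) 1) = ball 0 1 := by
      ext z; simp
    rw [hpre] at h
    show _ = ∫ z in ball (0 : V) 1, ⟪e, z⟫ * ⟪e, z⟫
    rw [← h]
    show (∫ z in ball (0 : V) 1, ⟪a, z⟫ * ⟪a, z⟫) = _
    congr 1; ext z
    rw [← hT, T.inner_map_map]
  have hQ : ∀ a : V, Q a = Q e * ‖a‖ ^ 2 := by
    intro a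
    by_cases ha : a = 0
    · simp [ha, Q]
    have h1 := hQe (‖a‖⁻¹ • a) (by simp [norm_smul, ha])
    have h2 : Q (‖a‖⁻¹ • a) = ‖a‖⁻¹ ^ 2 * Q a := by
      simp only [Q]
      rw [← integral_const_mul]
      congr 1; ext z; simp only [inner_smul_left]; simp; ring
    rw [h2] at h1
    have : ‖a‖ ≠ 0 := by simpa using ha
    rw [← h1]; field_simp
  refine ⟨Q e, ?_, fun a b => ?_⟩
  · simp only [Q]
    rw [setIntegral_pos_iff_support_of_nonneg_ae (Eventually.of_forall fun z => mul_self_nonneg _) (hintg e e)]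
    have hsub : ball ((1 / 2 : ℝ) • e) (1 / 2) ⊆ (Function.support fun z : V => ⟪e, z⟫ * ⟪e, z⟫) ∩ ball 0 1 := by
      intro z hz
      rw [mem_ball, dist_eq_norm] at hz
      constructor
      · have h1 : ⟪e, z - (1 / 2 : ℝ) • e⟫ = ⟪e, z⟫ - 1 / 2 := by
          rw [inner_sub_right, inner_smul_right, real_inner_self_eq_norm_sq, he]; ring
        have h2 := abs_real_inner_le_norm e (z - (1 / 2 : ℝ) • e)
        rw [h1, he, one_mul] at h2
        have h3 := (abs_lt.1 (h2.trans_lt hz)).1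
        have : 0 < ⟪e, z⟫ := by linarith
        exact (mul_pos this this).ne'
      · rw [mem_ball_zero_iff]
        calc ‖z‖ = ‖(z - (1 / 2 : ℝ) • e) + (1 / 2 : ℝ) • e‖ := by simp
          _ ≤ ‖z - (1 / 2 : ℝ) • e‖ + ‖(1 / 2 : ℝ) • e‖ := norm_add_le _ _
          _ < 1 / 2 + 1 / 2 := by
            have : ‖(1 / 2 : ℝ) • e‖ = 1 / 2 := by rw [norm_smul, he]; norm_num
            linarith
          _ = 1 := by norm_num
    exact (measure_ball_pos volume _ (by norm_num)).trans_le (measure_mono hsub)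
  · have h1 : Q (a + b) - Q (a - b) = 4 * ∫ z in ball (0 : V) 1, ⟪a, z⟫ * ⟪b, z⟫ := by
      simp only [Q]
      rw [← integral_sub (hintg _ _) (hintg _ _), ← integral_const_mul]
      congr 1; ext z; simp only [inner_add_left, inner_sub_left]; ring
    rw [hQ (a + b), hQ (a - b)] at h1
    have h2 := norm_add_sq_real a b
    have h3 := norm_sub_sq_real a b
    rw [h2, h3] at h1
    linarith
end kern

section avg
variable {V : Type*} [NormedAddCommGroup V] [InnerProductSpace ℝ V] [FiniteDimensional ℝ V]
  [MeasurableSpace V] [BorelSpace V]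

theorem cont_int_ball {f : V → ℝ} (hf : Continuous f) : IntegrableOn f (ball (0 : V) 1) :=
  (hf.continuousOn.integrableOn_compact (isCompact_closedBall (0 : V) 1)).mono_set
      ball_subset_closedBall

theorem int_ball_isom (T : V ≃ₗᵢ[ℝ] V) (f : V → ℝ) :
    ∫ z in ball (0 : V) 1, f (T z) = ∫ z in ball (0 : V) 1, f z := by
  have hmp : MeasurePreserving T (volume : Measure V) volume := T.measurePreserving
  have h := hmp.setIntegral_preimage_emb T.toHomeomorph.measurableEmbedding f (ball 0 1)
  have hpre : T ⁻¹' (ball (0 : V) 1) = ball 0 1 := by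
    ext z; simp
  rw [hpre] at h
  exact h

theorem int_ball_neg (f : V → ℝ) :
    ∫ z in ball (0 : V) 1, f (-z) = ∫ z in ball (0 : V) 1, f z :=
  int_ball_isom (LinearIsometryEquiv.neg ℝ) f

theorem avg_ineq (m : ℝ) (hm : ∀ a b : V, ∫ z in ball (0 : V) 1, ⟪a, z⟫ * ⟪b, z⟫ = m * ⟪a, b⟫)
    (ε R : ℝ) (hε : 0 < ε) (φ ψ : V → ℝ) (hφ : Continuous φ) (hψ : Continuous ψ)
    (hle : ∀ x ∈ closedBall (0 : V) R, ∀ y ∈ closedBall (0 : V) R, φ x + ψ y ≤ kk ε ‖x - y‖)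
    (x y : V) (hx : ‖x‖ ≤ R - 1) (hy : ‖y‖ ≤ R - 1) (hxy : x ≠ y)
    (hcon : φ x + ψ y = kk ε ‖x - y‖) (h : ℝ) (h0 : 0 < h) (h1 : h ≤ 1) :
    (∫ z in ball (0 : V) 1, (φ (x + h • z) - φ x)) + (∫ z in ball (0 : V) 1, (ψ (y + h • z) - ψ y))
      ≤ h ^ 2 * (2 * m * ((ε ^ 2 - ‖x - y‖ ^ 2) / (‖x - y‖ ^ 2 + ε ^ 2) ^ 2))
        + h ^ 4 * (4 / ε ^ 4 * (volume (ball (0 : V) 1)).toReal) := by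
  set d := ‖x - y‖ with hd
  have hdpos : 0 < d := by rw [hd, norm_pos_iff, sub_ne_zero]; exact hxy
  let e : V := d⁻¹ • (x - y)
  have he : ‖e‖ = 1 := by
    simp only [e, norm_smul, norm_inv, Real.norm_eq_abs, abs_of_pos hdpos, ← hd]
    field_simp
  have hxe : x - y = d • e := by simp only [e, smul_smul]; rw [mul_inv_cancel₀ hdpos.ne', one_smul]
  clear_value e
  let T : V ≃ₗᵢ[ℝ] V := (Submodule.span ℝ {e})ᗮ.reflection
  have hT : ∀ z, T z = z - (2 * ⟪e, z⟫) • e := by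
    intro z
    simp only [T]
    rw [Submodule.reflection_orthogonal_apply, Submodule.reflection_singleton_apply]
    simp only [he]
    simp
    module
  let G : V → ℝ := fun z => kk ε (d + 2 * h * ⟪e, z⟫) - kk ε d
  have hkc : Continuous (kk ε) := (kk_lip ε hε).continuous
  have hGc : Continuous G := by fun_prop
  have hTc : Continuous T := T.continuous
  have hb1 : ∀ z ∈ ball (0 : V) 1, (φ (x + h • z) - φ x) + (ψ (y + h • T z) - ψ y) ≤ G z := by
    intro z hz
    have hz1 : ‖z‖ ≤ 1 := (mem_ball_zero_iff.1 hz).le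
    have hh : ∀ w : V, ‖w‖ ≤ 1 → ‖h • w‖ ≤ 1 := by
      intro w hw
      rw [norm_smul, Real.norm_eq_abs, abs_of_pos h0]
      nlinarith [norm_nonneg w]
    have hA := hle (x + h • z) (by
      rw [mem_closedBall_zero_iff]
      have := norm_add_le x (h • z); have := hh z hz1; linarith) (y + h • T z) (by
      rw [mem_closedBall_zero_iff]
      have := norm_add_le y (h • T z); have := hh (T z) (by rw [T.norm_map]; exact hz1); linarith)
    have hB : x + h • z - (y + h • T z) = (d + 2 * h * ⟪e, z⟫) • e := by
      rw [hT, add_sub_add_comm, hxe]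
      module
    rw [hB, norm_smul, he, mul_one, Real.norm_eq_abs, kk_abs] at hA
    simp only [G]; linarith
  have i1 : IntegrableOn (fun z => φ (x + h • z) - φ x) (ball (0 : V) 1) := cont_int_ball (by fun_prop)
  have i2 : IntegrableOn (fun z => ψ (y + h • T z) - ψ y) (ball (0 : V) 1) := cont_int_ball (by fun_prop)
  have i3 : IntegrableOn G (ball (0 : V) 1) := cont_int_ball hGc
  have hs1 : (∫ z in ball (0 : V) 1, (φ (x + h • z) - φ x)) +
      (∫ z in ball (0 : V) 1, (ψ (y + h • z) - ψ y)) ≤ ∫ z in ball (0 : V) 1, G z := by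
    rw [← int_ball_isom T (fun z => ψ (y + h • z) - ψ y), ← integral_add i1 i2]
    exact setIntegral_mono_on (i1.add i2) i3 measurableSet_ball hb1
  refine hs1.trans ?_
  have hs2 : 2 * ∫ z in ball (0 : V) 1, G z = ∫ z in ball (0 : V) 1, (G z + G (-z)) := by
    rw [integral_add i3 (cont_int_ball (by fun_prop)), int_ball_neg]; ring
  set κ := (ε ^ 2 - d ^ 2) / (d ^ 2 + ε ^ 2) ^ 2 with hκ
  have hb2 : ∀ z ∈ ball (0 : V) 1, G z + G (-z) ≤ 4 * h ^ 2 * κ * (⟪e, z⟫ * ⟪e, z⟫) + 8 * h ^ 4 / ε ^ 4 := by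
    intro z hz
    have hz1 : ‖z‖ ≤ 1 := (mem_ball_zero_iff.1 hz).le
    have h3 := kk_second ε d (2 * h * ⟪e, z⟫) hε
    have h4 : G z + G (-z) = kk ε (d + 2 * h * ⟪e, z⟫) + kk ε (d - 2 * h * ⟪e, z⟫) - 2 * kk ε d := by
      simp only [G, inner_neg_right]; ring_nf
    rw [h4]
    refine h3.trans ?_
    rw [← hκ]
    have h5 : |⟪e, z⟫| ≤ 1 := by
      refine (abs_real_inner_le_norm e z).trans ?_
      rw [he, one_mul]; exact hz1
    have h6 : ⟪e, z⟫ ^ 4 ≤ 1 := by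
      have := pow_le_one₀ (n := 4) (abs_nonneg _) h5
      rwa [Even.pow_abs (by decide)] at this
    have h7 : (2 * h * ⟪e, z⟫) ^ 4 / (2 * (d ^ 2 + ε ^ 2) ^ 2) ≤ 8 * h ^ 4 / ε ^ 4 := by
      rw [div_le_div_iff₀ (by positivity) (by positivity)]
      have h8 : ε ^ 4 ≤ (d ^ 2 + ε ^ 2) ^ 2 := by nlinarith [sq_nonneg d, sq_nonneg ε, mul_nonneg (sq_nonneg d) (sq_nonneg ε), sq_nonneg (d^2)]
      calc (2 * h * ⟪e, z⟫) ^ 4 * ε ^ 4 = 16 * h ^ 4 * ⟪e, z⟫ ^ 4 * ε ^ 4 := by ring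
        _ ≤ 16 * h ^ 4 * 1 * (d ^ 2 + ε ^ 2) ^ 2 := by gcongr
        _ = _ := by ring
    refine add_le_add (le_of_eq ?_) h7
    ring
  have hs3 : ∫ z in ball (0 : V) 1, (G z + G (-z)) ≤ 4 * h ^ 2 * κ * m + 8 * h ^ 4 / ε ^ 4 * (volume (ball (0 : V) 1)).toReal := by
    refine (setIntegral_mono_on (cont_int_ball (by fun_prop)) (cont_int_ball (by fun_prop)) measurableSet_ball hb2).trans (le_of_eq ?_)
    rw [integral_add (cont_int_ball (by fun_prop)) (cont_int_ball (by fun_prop)), integral_const_mul, hm,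
      real_inner_self_eq_norm_sq, he]
    simp [Measure.real]
    ring
  have : ∫ z in ball (0 : V) 1, G z ≤ (4 * h ^ 2 * κ * m + 8 * h ^ 4 / ε ^ 4 * (volume (ball (0 : V) 1)).toReal) / 2 := by linarith
  refine this.trans (le_of_eq ?_)
  ring
end avg

section lim
variable {V : Type*} [NormedAddCommGroup V] [InnerProductSpace ℝ V] [FiniteDimensional ℝ V]
  [MeasurableSpace V] [BorelSpace V]

theorem grad_inner {f : V → ℝ} {x : V} (v : V) : ⟪gradient f x, v⟫ = fderiv ℝ f x v := by
  simp [gradient]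

theorem grad_norm_le {f : V → ℝ} {K : ℝ≥0} (hf : LipschitzWith K f) (x : V) : ‖gradient f x‖ ≤ K := by
  have : ‖gradient f x‖ = ‖fderiv ℝ f x‖ := by simp [gradient]
  rw [this]; exact norm_fderiv_le_of_lipschitz ℝ hf

theorem grad_meas (f : V → ℝ) : Measurable (gradient f) :=
  ((InnerProductSpace.toDual ℝ V).symm.continuous.measurable).comp (measurable_fderiv ℝ f)

theorem lip_diff_quot {f : V → ℝ} {x : V} (hf : DifferentiableAt ℝ f x) (z : V)
    (h : ℕ → ℝ) (h0 : ∀ n, 0 < h n) (hl : Tendsto h atTop (nhds 0)) :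
    Tendsto (fun n => (f (x + h n • z) - f x) / h n) atTop (nhds ⟪gradient f x, z⟫) := by
  rw [grad_inner]
  have h1 := hf.hasFDerivAt.hasLineDerivAt z
  have h2 := (hasDerivAt_iff_tendsto_slope_zero.1 h1)
  have h3 : Tendsto h atTop (nhdsWithin 0 {0}ᶜ) :=
    tendsto_nhdsWithin_iff.2 ⟨hl, Eventually.of_forall fun n => (h0 n).ne'⟩
  have h4 := h2.comp h3
  refine h4.congr fun n => ?_
  simp [div_eq_inv_mul]

theorem ibp_limit (m : ℝ) (hm : ∀ a b : V, ∫ z in ball (0 : V) 1, ⟪a, z⟫ * ⟪b, z⟫ = m * ⟪a, b⟫)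
    (φ ρ : V → ℝ) (L K : ℝ≥0) (hφ : LipschitzWith L φ) (hρ : LipschitzWith K ρ)
    (hs : HasCompactSupport ρ) (h : ℕ → ℝ) (h0 : ∀ n, 0 < h n) (h1 : ∀ n, h n ≤ 1)
    (hl : Tendsto h atTop (nhds 0)) :
    Tendsto (fun n => (∫ x, ρ x * ∫ z in ball (0 : V) 1, (φ (x + h n • z) - φ x)) / h n ^ 2) atTop
      (nhds (-(m / 2) * ∫ x, ⟪gradient φ x, gradient ρ x⟫)) := by
  have hφc := hφ.continuous
  have hρc := hρ.continuous
  have hρi : Integrable ρ := hρc.integrable_of_hasCompactSupport hs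
  obtain ⟨M, hM⟩ : ∃ M : ℝ, ∀ x, M < ‖x‖ → ρ x = 0 := by
    obtain ⟨M, hM⟩ := hs.isCompact.isBounded.exists_norm_le
    refine ⟨M, fun x hx => ?_⟩
    by_contra hne
    exact absurd (hM x (subset_tsupport _ hne)) (not_le.2 hx)
  -- the symmetrised integrand
  let F : ℕ → V → V → ℝ := fun n z x => (φ (x + h n • z) - φ x) * (ρ x - ρ (x + h n • z))
  have hsym : ∀ n, (∫ x, ρ x * ∫ z in ball (0 : V) 1, (φ (x + h n • z) - φ x)) =
      (1 / 2) * ∫ z in ball (0 : V) 1, ∫ x, F n z x := by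
    intro n
    have hlip : ∀ x z, |φ (x + h n • z) - φ x| ≤ L * (h n * ‖z‖) := by
      intro x z
      have := hφ.dist_le_mul (x + h n • z) x
      simpa [Real.dist_eq, dist_eq_norm, norm_smul, abs_of_pos (h0 n)] using this
    let J : V → ℝ := fun z => ∫ x, ρ x * (φ (x + h n • z) - φ x)
    have hintg : Integrable (fun w : V × V => ρ w.1 * (φ (w.1 + h n • w.2) - φ w.1))
        ((volume : Measure V).prod (volume.restrict (ball (0 : V) 1))) := by
      have hb : Integrable (fun w : V × V => ρ w.1 * (L * (h n * ‖w.2‖)))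
          ((volume : Measure V).prod (volume.restrict (ball (0 : V) 1))) :=
        Integrable.mul_prod hρi (cont_int_ball (f := fun z : V => (L : ℝ) * (h n * ‖z‖)) (by fun_prop))
      refine hb.mono (by fun_prop) (Eventually.of_forall fun w => ?_)
      rw [norm_mul, norm_mul]
      gcongr
      rw [Real.norm_eq_abs, Real.norm_eq_abs, abs_of_nonneg (a := L * (h n * ‖w.2‖)) (by have := (h0 n).le; positivity)]
      exact hlip _ _
    have e1 : (∫ x, ρ x * ∫ z in ball (0 : V) 1, (φ (x + h n • z) - φ x)) =
        ∫ z in ball (0 : V) 1, J z := by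
      simp_rw [← integral_const_mul]
      exact integral_integral_swap hintg
    have iJ : Integrable J (volume.restrict (ball (0 : V) 1)) := hintg.integral_prod_right
    have iJn : Integrable (fun z => J (-z)) (volume.restrict (ball (0 : V) 1)) := by
      have hmp : MeasurePreserving (LinearIsometryEquiv.neg ℝ : V ≃ₗᵢ[ℝ] V) (volume : Measure V) volume :=
        (LinearIsometryEquiv.neg ℝ : V ≃ₗᵢ[ℝ] V).measurePreserving
      have := (hmp.integrableOn_comp_preimage
        (LinearIsometryEquiv.neg ℝ : V ≃ₗᵢ[ℝ] V).toHomeomorph.measurableEmbedding (f := J) (s := ball 0 1)).2 iJ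
      have hpre : (LinearIsometryEquiv.neg ℝ : V ≃ₗᵢ[ℝ] V) ⁻¹' (ball (0 : V) 1) = ball 0 1 := by
        ext z; simp
      rw [hpre] at this
      exact this
    rw [e1]
    have e2 : ∫ z in ball (0 : V) 1, J z = (1 / 2) * ∫ z in ball (0 : V) 1, (J z + J (-z)) := by
      rw [integral_add iJ iJn, int_ball_neg]; ring
    rw [e2]
    congr 2
    ext z
    have hi2 : Integrable (fun x => ρ x * (φ (x + h n • z) - φ x)) :=
      (by fun_prop : Continuous fun x => ρ x * (φ (x + h n • z) - φ x)).integrable_of_hasCompactSupport hs.mul_right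
    have hi3 : Integrable (fun x => ρ x * (φ (x + h n • (-z)) - φ x)) :=
      (by fun_prop : Continuous fun x => ρ x * (φ (x + h n • (-z)) - φ x)).integrable_of_hasCompactSupport hs.mul_right
    have e3 : J (-z) = ∫ x, ρ (x + h n • z) * (φ x - φ (x + h n • z)) := by
      simp only [J]
      rw [← integral_add_right_eq_self _ (h n • z)]
      congr 1; ext x; simp
    have hi4 : Integrable (fun x => ρ (x + h n • z) * (φ x - φ (x + h n • z))) := by
      have := hi3.comp_add_right (h n • z)
      refine this.congr (Eventually.of_forall fun x => ?_)
      simp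
    rw [e3]
    simp only [J, F]
    rw [← integral_add hi2 hi4]
    congr 1; ext x; ring
  -- pointwise limit in z
  let C : ℝ := L * K * (volume (closedBall (0 : V) (M + 1))).toReal
  have hbd : ∀ n, ∀ z ∈ ball (0 : V) 1, ∀ x, ‖F n z x / h n ^ 2‖ ≤ (closedBall (0 : V) (M + 1)).indicator (fun _ => (L * K : ℝ)) x := by
    intro n z hz x
    have hz1 : ‖z‖ ≤ 1 := (mem_ball_zero_iff.1 hz).le
    have hhz : ‖h n • z‖ ≤ h n := by
      rw [norm_smul, Real.norm_eq_abs, abs_of_pos (h0 n)]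
      nlinarith [norm_nonneg z, h0 n]
    by_cases hx : x ∈ closedBall (0 : V) (M + 1)
    · rw [indicator_of_mem hx]
      have a1 := hφ.dist_le_mul (x + h n • z) x
      have a2 := hρ.dist_le_mul x (x + h n • z)
      rw [Real.dist_eq, dist_eq_norm, add_sub_cancel_left] at a1
      rw [Real.dist_eq, dist_eq_norm, sub_add_cancel_left, norm_neg] at a2
      have a3 : |φ (x + h n • z) - φ x| ≤ L * h n := a1.trans (by gcongr)
      have a4 : |ρ x - ρ (x + h n • z)| ≤ K * h n := a2.trans (by gcongr)
      rw [norm_div, Real.norm_eq_abs, Real.norm_eq_abs, abs_of_pos (pow_pos (h0 n) 2),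
        div_le_iff₀ (pow_pos (h0 n) 2)]
      simp only [F]
      rw [abs_mul]
      calc _ ≤ (L * h n) * (K * h n) := by
            have := (h0 n).le
            gcongr
        _ = _ := by ring
    · rw [indicator_of_notMem hx]
      rw [mem_closedBall_zero_iff, not_le] at hx
      have b1 : ρ x = 0 := hM x (by linarith)
      have b2 : ρ (x + h n • z) = 0 := hM _ (by
        have := norm_sub_norm_le x (-(h n • z))
        rw [norm_neg, sub_neg_eq_add] at this
        have := h1 n
        linarith)
      simp [F, b1, b2]
  have hind : Integrable ((closedBall (0 : V) (M + 1)).indicator (fun _ => (L * K : ℝ))) :=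
    (integrable_indicator_iff isClosed_closedBall.measurableSet).2
      (integrableOn_const (isCompact_closedBall (0 : V) (M + 1)).measure_lt_top.ne)
  have hlz : ∀ z ∈ ball (0 : V) 1, Tendsto (fun n => ∫ x, F n z x / h n ^ 2) atTop
      (nhds (∫ x, -(⟪gradient φ x, z⟫ * ⟪gradient ρ x, z⟫))) := by
    intro z hz
    refine tendsto_integral_of_dominated_convergence _ (fun n => ?_) hind
      (fun n => Eventually.of_forall (hbd n z hz)) ?_
    · exact (by fun_prop : Continuous fun x => F n z x / h n ^ 2).aestronglyMeasurable
    · filter_upwards [hφ.ae_differentiableAt, hρ.ae_differentiableAt] with x hx1 hx2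
      have t1 := lip_diff_quot hx1 z h h0 hl
      have t2 := (lip_diff_quot hx2 z h h0 hl).neg
      have t3 := t1.mul t2
      have e4 : ⟪gradient φ x, z⟫ * -⟪gradient ρ x, z⟫ = -(⟪gradient φ x, z⟫ * ⟪gradient ρ x, z⟫) := by ring
      rw [e4] at t3
      refine t3.congr fun n => ?_
      have := (h0 n).ne'
      simp only [F]
      field_simp
      ring
  have hlim : Tendsto (fun n => ∫ z in ball (0 : V) 1, ∫ x, F n z x / h n ^ 2) atTop
      (nhds (∫ z in ball (0 : V) 1, ∫ x, -(⟪gradient φ x, z⟫ * ⟪gradient ρ x, z⟫))) := by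
    refine tendsto_integral_of_dominated_convergence (fun _ => ∫ x, (closedBall (0 : V) (M + 1)).indicator (fun _ => (L * K : ℝ)) x) (fun n => ?_) ?_ (fun n => ?_) ?_
    · have hc : Continuous (fun w : V × V => F n w.1 w.2 / h n ^ 2) := by fun_prop
      exact (hc.stronglyMeasurable.integral_prod_right (ν := volume)).aestronglyMeasurable
    · exact integrableOn_const measure_ball_lt_top.ne
    · filter_upwards [ae_restrict_mem measurableSet_ball] with z hz
      exact norm_integral_le_of_norm_le hind (Eventually.of_forall (hbd n z hz))
    · filter_upwards [ae_restrict_mem measurableSet_ball] with z hz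
      exact hlz z hz
  have hfin : (1 / 2) * (∫ z in ball (0 : V) 1, ∫ x, -(⟪gradient φ x, z⟫ * ⟪gradient ρ x, z⟫)) =
      -(m / 2) * ∫ x, ⟪gradient φ x, gradient ρ x⟫ := by
    have hgz : ∀ x, x ∉ tsupport ρ → gradient ρ x = 0 := by
      intro x hx
      have : fderiv ℝ ρ x = 0 := by
        have := support_fderiv_subset ℝ (f := ρ)
        by_contra hne
        exact hx (this hne)
      simp [gradient, this]
    have hI : Integrable (fun w : V × V => -(⟪gradient φ w.2, w.1⟫ * ⟪gradient ρ w.2, w.1⟫))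
        ((volume.restrict (ball (0 : V) 1)).prod (volume : Measure V)) := by
      have hb : Integrable (fun w : V × V => (‖w.1‖ ^ 2) * (closedBall (0 : V) (M + 1)).indicator (fun _ => (L * K : ℝ)) w.2)
          ((volume.restrict (ball (0 : V) 1)).prod (volume : Measure V)) :=
        Integrable.mul_prod (cont_int_ball (f := fun z : V => ‖z‖ ^ 2) (by fun_prop)) hind
      refine hb.mono ?_ (Eventually.of_forall fun w => ?_)
      · have m1 : Measurable fun w : V × V => gradient φ w.2 := (grad_meas φ).comp measurable_snd
        have m2 : Measurable fun w : V × V => gradient ρ w.2 := (grad_meas ρ).comp measurable_snd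
        exact ((m1.inner measurable_fst).mul (m2.inner measurable_fst)).neg.aestronglyMeasurable
      · by_cases hx : w.2 ∈ closedBall (0 : V) (M + 1)
        · rw [indicator_of_mem hx, norm_neg, norm_mul, norm_mul]
          have c1 := norm_inner_le_norm (𝕜 := ℝ) (gradient φ w.2) w.1
          have c2 := norm_inner_le_norm (𝕜 := ℝ) (gradient ρ w.2) w.1
          have c3 := grad_norm_le hφ w.2
          have c4 := grad_norm_le hρ w.2
          calc _ ≤ (L * ‖w.1‖) * (K * ‖w.1‖) := by
                refine mul_le_mul (c1.trans (by gcongr)) (c2.trans (by gcongr)) (norm_nonneg _) (by positivity)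
            _ = _ := by simp; ring
        · have : gradient ρ w.2 = 0 := hgz _ (fun hmem => hx (by
            have hcl : tsupport ρ ⊆ closedBall (0 : V) (M + 1) := by
              refine closure_minimal (fun x hx => ?_) isClosed_closedBall
              rw [mem_closedBall_zero_iff]
              by_contra hlt
              exact hx (hM x (by linarith))
            exact hcl hmem))
          simp [this]
          positivity
    rw [integral_integral_swap hI]
    have : ∀ x, ∫ z in ball (0 : V) 1, -(⟪gradient φ x, z⟫ * ⟪gradient ρ x, z⟫) = -m * ⟪gradient φ x, gradient ρ x⟫ := by
      intro x; rw [integral_neg, hm]; ring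
    simp_rw [this]
    rw [integral_const_mul]; ring
  rw [← hfin]
  refine (hlim.const_mul (1 / 2)).congr fun n => ?_
  rw [hsym]
  simp_rw [integral_div]
  ring
end lim

section ot
variable {V : Type*} [NormedAddCommGroup V] [InnerProductSpace ℝ V] [FiniteDimensional ℝ V]
  [MeasurableSpace V] [BorelSpace V]

theorem cpt_bdd {q : V → ℝ} (hq : Continuous q) (hs : HasCompactSupport q) :
    ∃ M : ℝ, 0 ≤ M ∧ ∀ x, |q x| ≤ M := by
  obtain ⟨C, hC⟩ := hs.exists_bound_of_continuous hq
  exact ⟨C, (norm_nonneg _).trans (hC 0), hC⟩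

theorem cpt_rad {q : V → ℝ} (hs : HasCompactSupport q) :
    ∃ M : ℝ, 0 ≤ M ∧ ∀ x, M < ‖x‖ → q x = 0 := by
  obtain ⟨M, hM⟩ := hs.isCompact.isBounded.exists_norm_le
  refine ⟨max M 0, le_max_right _ _, fun x hx => ?_⟩
  by_contra hne
  exact absurd (hM x (subset_tsupport _ hne)) (not_le.2 ((le_max_left _ _).trans_lt hx))

theorem sq_lip {q : V → ℝ} {K : ℝ≥0} (hq : LipschitzWith K q) (hs : HasCompactSupport q) :
    ∃ K' : ℝ≥0, LipschitzWith K' (fun x => q x ^ 2) := by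
  obtain ⟨M, hM0, hM⟩ := cpt_bdd hq.continuous hs
  refine ⟨K * (2 * Real.toNNReal M), LipschitzWith.of_dist_le_mul fun x y => ?_⟩
  have h1 := hq.dist_le_mul x y
  rw [Real.dist_eq] at h1 ⊢
  have h2 : |q x + q y| ≤ 2 * M := (abs_add_le _ _).trans (by linarith [hM x, hM y])
  have h3 : q x ^ 2 - q y ^ 2 = (q x - q y) * (q x + q y) := by ring
  rw [h3, abs_mul]
  push_cast
  rw [Real.coe_toNNReal _ hM0]
  calc _ ≤ (K * dist x y) * (2 * M) := by gcongr
    _ = _ := by ring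

/-- density measure -/
def dm (q : V → ℝ) : Measure V := volume.withDensity (fun x => ENNReal.ofReal (q x ^ 2))

theorem dm_int {q : V → ℝ} (hq : Continuous q) (f : V → ℝ) :
    ∫ x, f x ∂(dm q) = ∫ x, q x ^ 2 * f x := by
  unfold dm
  rw [integral_withDensity_eq_integral_toReal_smul (by fun_prop) (Eventually.of_forall fun x => ENNReal.ofReal_lt_top)]
  congr 1; ext x; rw [ENNReal.toReal_ofReal (sq_nonneg _), smul_eq_mul]

theorem dm_integrable {q : V → ℝ} (hq : Continuous q) (f : V → ℝ) 
    (h : Integrable (fun x => q x ^ 2 * f x)) : Integrable f (dm q) := by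
  unfold dm
  rw [integrable_withDensity_iff_integrable_smul' (by fun_prop) (Eventually.of_forall fun x => ENNReal.ofReal_lt_top)]
  refine h.congr (Eventually.of_forall fun x => ?_)
  simp only [ENNReal.toReal_ofReal (sq_nonneg _), smul_eq_mul]

theorem dm_prob {q : V → ℝ} (hq : Continuous q) (hs : HasCompactSupport q) (h1 : ∫ x, q x ^ 2 = 1) :
    IsProbabilityMeasure (dm q) := by
  refine ⟨?_⟩
  unfold dm
  rw [withDensity_apply _ MeasurableSet.univ, Measure.restrict_univ, ← ofReal_integral_eq_lintegral_ofReal, h1]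
  · simp
  · have : HasCompactSupport (fun x => q x ^ 2) := hs.comp_left (g := fun t : ℝ => t ^ 2) (by simp)
    exact (hq.pow 2).integrable_of_hasCompactSupport this
  · exact Eventually.of_forall fun x => sq_nonneg _

theorem dm_ac (q : V → ℝ) : dm q ≪ volume := withDensity_absolutelyContinuous _ _

theorem dm_pos {q : V → ℝ} (hq : Continuous q) (h0 : ∀ x, 0 ≤ q x) : ∀ᵐ x ∂(dm q), 0 < q x := by
  unfold dm
  rw [ae_withDensity_iff (by fun_prop)]
  refine Eventually.of_forall fun x hx => ?_
  have : q x ≠ 0 := by rintro h; simp [h] at hx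
  exact lt_of_le_of_ne (h0 x) (Ne.symm this)

/-- logarithmic gradient -/
def lg (q : V → ℝ) (x : V) : V := (q x)⁻¹ • gradient q x

theorem grad_sq {q : V → ℝ} {x : V} (h : DifferentiableAt ℝ q x) :
    gradient (fun x => q x ^ 2) x = (2 * q x) • gradient q x := by
  refine HasGradientAt.gradient ?_
  rw [hasGradientAt_iff_hasFDerivAt]
  refine (h.hasGradientAt.hasFDerivAt.pow 2).congr_fderiv ?_
  ext v; simp

theorem grad_supp {ρ : V → ℝ} {x : V} (hx : x ∉ tsupport ρ) : gradient ρ x = 0 := by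
  have : fderiv ℝ ρ x = 0 := by
    by_contra hne
    exact hx (support_fderiv_subset ℝ (f := ρ) hne)
  simp [gradient, this]

theorem grad_zero_of_min {q : V → ℝ} (h0 : ∀ x, 0 ≤ q x) {x : V} (hx : q x = 0) : gradient q x = 0 := by
  have : IsLocalMin q x := Eventually.of_forall fun y => by rw [hx]; exact h0 y
  simp [gradient, this.fderiv_eq_zero]

theorem bdd_cpt_int {f : V → ℝ} {q : V → ℝ} (hs : HasCompactSupport q) (hf : AEStronglyMeasurable f volume) (C : ℝ)
    (hb : ∀ x, |f x| ≤ C) (h0 : ∀ x, x ∉ tsupport q → f x = 0) : Integrable f := by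
  have hi : Integrable ((tsupport q).indicator (fun _ => C)) :=
    (integrable_indicator_iff (isClosed_tsupport q).measurableSet).2
      (integrableOn_const hs.isCompact.measure_lt_top.ne)
  refine hi.mono' hf (Eventually.of_forall fun x => ?_)
  by_cases hx : x ∈ tsupport q
  · rw [indicator_of_mem hx]; exact hb x
  · rw [indicator_of_notMem hx, h0 x hx]; simp

theorem q_grad_int {q φ : V → ℝ} {K L : ℝ≥0} (hq : LipschitzWith K q) (hs : HasCompactSupport q)
    (h0 : ∀ x, 0 ≤ q x) (hφ : LipschitzWith L φ) :
    Integrable (fun x => 2 * ⟪gradient φ x, lg q x⟫) (dm q) ∧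
    ∫ x, 2 * ⟪gradient φ x, lg q x⟫ ∂(dm q) = ∫ x, ⟪gradient φ x, gradient (fun x => q x ^ 2) x⟫ := by
  have hmg := grad_meas q
  have hmφ := grad_meas φ
  have key : ∀ x, q x ^ 2 * (2 * ⟪gradient φ x, lg q x⟫) = 2 * q x * ⟪gradient φ x, gradient q x⟫ := by
    intro x
    unfold lg
    rw [inner_smul_right]
    by_cases hx : q x = 0
    · simp [hx]
    · field_simp
  obtain ⟨M, hM0, hM⟩ := cpt_bdd hq.continuous hs
  constructor
  · refine dm_integrable hq.continuous _ ?_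
    simp_rw [key]
    refine bdd_cpt_int hs ?_ (2 * M * (L * K)) (fun x => ?_) (fun x hx => ?_)
    · exact (((hq.continuous.measurable.const_mul 2)).mul (hmφ.inner hmg)).aestronglyMeasurable
    · rw [abs_mul, abs_mul, abs_two]
      have := abs_real_inner_le_norm (gradient φ x) (gradient q x)
      have h3 := grad_norm_le hφ x
      have h4 := grad_norm_le hq x
      have h5 := hM x
      calc _ ≤ 2 * |q x| * (‖gradient φ x‖ * ‖gradient q x‖) := by gcongr
        _ ≤ _ := by gcongr
    · rw [grad_supp hx]; simp
  · rw [dm_int hq.continuous]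
    refine integral_congr_ae ?_
    filter_upwards [hq.ae_differentiableAt] with x hx
    rw [key, grad_sq hx, inner_smul_right]

theorem q_en_int {q : V → ℝ} {K : ℝ≥0} (hq : LipschitzWith K q) (hs : HasCompactSupport q)
    (h0 : ∀ x, 0 ≤ q x) :
    Integrable (fun x => ‖lg q x + (1 / 2 : ℝ) • x‖ ^ 2) (dm q) ∧
    ∫ x, ‖lg q x + (1 / 2 : ℝ) • x‖ ^ 2 ∂(dm q) = ∫ x, ‖gradient q x + (q x / 2) • x‖ ^ 2 := by
  have hmg := grad_meas q
  have key : ∀ x, q x ^ 2 * ‖lg q x + (1 / 2 : ℝ) • x‖ ^ 2 = ‖gradient q x + (q x / 2) • x‖ ^ 2 := by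
    intro x
    by_cases hx : q x = 0
    · simp [hx, grad_zero_of_min h0 hx]
    · rw [← sq_abs (q x), ← Real.norm_eq_abs, ← mul_pow, ← norm_smul, smul_add, lg, smul_smul, mul_inv_cancel₀ hx, one_smul, smul_smul]
      ring_nf
  obtain ⟨M, hM0, hM⟩ := cpt_bdd hq.continuous hs
  obtain ⟨R, hR0, hR⟩ := cpt_rad hs
  have hc := hq.continuous
  constructor
  · refine dm_integrable hq.continuous _ ?_
    simp_rw [key]
    refine bdd_cpt_int hs ?_ ((K + M * R) ^ 2) (fun x => ?_) (fun x hx => ?_)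
    · exact ((hmg.add (by fun_prop : Measurable fun x => (q x / 2) • x)).norm.pow_const 2).aestronglyMeasurable
    · rw [abs_of_nonneg (sq_nonneg _)]
      gcongr
      refine (norm_add_le _ _).trans (add_le_add (grad_norm_le hq x) ?_)
      rw [norm_smul, norm_div, Real.norm_eq_abs]
      by_cases hx : R < ‖x‖
      · rw [hR x hx]; simp; positivity
      · have h5 : |q x| / ‖(2 : ℝ)‖ ≤ M := by
          have := hM x; have := abs_nonneg (q x); simp; linarith
        gcongr
        exact not_lt.1 hx
    · rw [grad_supp hx, image_eq_zero_of_notMem_tsupport hx]; simp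
  · rw [dm_int hq.continuous]
    simp_rw [key]
end ot

section ot
variable {V : Type*} [NormedAddCommGroup V] [InnerProductSpace ℝ V] [FiniteDimensional ℝ V]
  [MeasurableSpace V] [BorelSpace V]

theorem ballae [Nontrivial V] (x : V) (r : ℝ) : (ball x r : Set V) =ᵐ[volume] closedBall x r := by
  refine ae_eq_set.2 ⟨by rw [diff_eq_empty.2 ball_subset_closedBall]; simp, ?_⟩
  rw [closedBall_diff_ball]
  exact Measure.addHaar_sphere _ _ _

theorem ot_pt (x y A B gx gy : V) (ε t : ℝ) (hε : 0 < ε) (ht : 0 < t)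
    (hg1 : gx = (1 / (‖x - y‖ ^ 2 + ε ^ 2)) • (x - y))
    (hg2 : gy = (1 / (‖x - y‖ ^ 2 + ε ^ 2)) • (y - x)) :
    2 * ⟪gx, A⟫ + 2 * ⟪gy, B⟫ ≤ 4 * ‖x - y‖ ^ 2 / (‖x - y‖ ^ 2 + ε ^ 2) ^ 2
      + (1 / 4) * (1 + t) * ‖A + (1 / 2 : ℝ) • x‖ ^ 2 + (1 / 4) * (1 + 1 / t) * ‖B + (1 / 2 : ℝ) • y‖ ^ 2
      - ‖x - y‖ ^ 2 / (‖x - y‖ ^ 2 + ε ^ 2) := by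
  set D := ‖x - y‖ ^ 2 + ε ^ 2 with hD
  have hDp : 0 < D := by positivity
  set a := A + (1 / 2 : ℝ) • x with ha
  set b := B + (1 / 2 : ℝ) • y with hb
  have hA : A = a - (1 / 2 : ℝ) • x := by rw [ha]; simp
  have hB : B = b - (1 / 2 : ℝ) • y := by rw [hb]; simp
  have e1 : 2 * ⟪gx, A⟫ + 2 * ⟪gy, B⟫ = 2 * ⟪(1 / D) • (x - y), a - b⟫ - ‖x - y‖ ^ 2 / D := by
    have : y - x = -(x - y) := by simp
    rw [hg1, hg2, this, hA, hB, ← real_inner_self_eq_norm_sq]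
    simp only [inner_smul_left, inner_neg_left, inner_sub_left, inner_sub_right, inner_smul_right, smul_neg]
    simp
    field_simp
    rw [real_inner_comm x y]; ring
  have e2 : 2 * ⟪(1 / D) • (x - y), a - b⟫ ≤ 4 * ‖x - y‖ ^ 2 / D ^ 2 + (1 / 4) * ‖a - b‖ ^ 2 := by
    have h1 := real_inner_le_norm ((1 / D) • (x - y)) (a - b)
    have h2 : ‖(1 / D) • (x - y)‖ = ‖x - y‖ / D := by
      rw [norm_smul, Real.norm_eq_abs, abs_of_pos (by positivity)]; ring
    rw [h2] at h1
    have h3 : 4 * ‖x - y‖ ^ 2 / D ^ 2 = 4 * (‖x - y‖ / D) ^ 2 := by rw [div_pow]; ring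
    rw [h3]
    nlinarith [sq_nonneg (2 * (‖x - y‖ / D) - (1 / 2) * ‖a - b‖)]
  have e3 : ‖a - b‖ ^ 2 ≤ (1 + t) * ‖a‖ ^ 2 + (1 + 1 / t) * ‖b‖ ^ 2 := by
    have h1 := norm_sub_le a b
    have h2 : ‖a - b‖ ^ 2 ≤ (‖a‖ + ‖b‖) ^ 2 := by gcongr
    refine h2.trans ?_
    have h3 : (1 + t) * ‖a‖ ^ 2 + (1 + 1 / t) * ‖b‖ ^ 2 - (‖a‖ + ‖b‖) ^ 2 = (t * ‖a‖ - ‖b‖) ^ 2 / t := by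
      field_simp; ring
    have h4 : 0 ≤ (t * ‖a‖ - ‖b‖) ^ 2 / t := by positivity
    linarith
  rw [e1]; linarith

theorem ot_eps [Nontrivial V] (q p : V → ℝ) (K : ℝ≥0) (hK : 0 < K) (hq : LipschitzWith K q)
    (hp : LipschitzWith K p) (hqs : HasCompactSupport q) (hps : HasCompactSupport p)
    (hq0 : ∀ x, 0 ≤ q x) (hp0 : ∀ x, 0 ≤ p x) (hqp : ∀ x, q x * p x = 0)
    (hq1 : ∫ x, q x ^ 2 = 1) (hp1 : ∫ x, p x ^ 2 = 1) (t : ℝ) (ht : 0 < t) (ε : ℝ) (hε : 0 < ε) :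
    4 ≤ (1 + t) * (∫ x, ‖gradient q x + (q x / 2) • x‖ ^ 2) +
      (1 + 1 / t) * (∫ x, ‖gradient p x + (p x / 2) • x‖ ^ 2) +
      4 * ∫ x, q x ^ 2 * (ε ^ 2 / ((q x / K) ^ 2 + ε ^ 2) + 4 * ε ^ 2 / ((q x / K) ^ 2 + ε ^ 2) ^ 2) := by
  have hK' : (0 : ℝ) < K := hK
  obtain ⟨m, hm0, hm⟩ := ball_moment (V := V)
  obtain ⟨M1, hM10, hM1⟩ := cpt_rad hqs
  obtain ⟨M2, hM20, hM2⟩ := cpt_rad hps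
  set R := max M1 M2 + 1 with hR
  have hR1 : M1 ≤ R - 1 := by rw [hR]; simp
  have hR2 : M2 ≤ R - 1 := by rw [hR]; simp
  have hR0 : 0 ≤ R := by linarith
  have := dm_prob hq.continuous hqs hq1
  have := dm_prob hp.continuous hps hp1
  have hqc := hq.continuous
  have hpc := hp.continuous
  have hμr : ∀ᵐ x ∂(dm q), ‖x‖ ≤ R - 1 := by
    filter_upwards [dm_pos hqc hq0] with x hx
    by_contra hlt
    exact hx.ne' (hM1 x (by linarith))
  have hνr : ∀ᵐ x ∂(dm p), ‖x‖ ≤ R - 1 := by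
    filter_upwards [dm_pos hpc hp0] with x hx
    by_contra hlt
    exact hx.ne' (hM2 x (by linarith))
  obtain ⟨φ, ψ, hφ, hψ, hle, π, hπ1, hπ2, hcon⟩ := kant_V R hR0 (dm q) (dm p)
    (by
      change ∀ᵐ x ∂(dm q), x ∈ closedBall (0 : V) R
      filter_upwards [hμr] with x hx
      rw [mem_closedBall_zero_iff]; linarith)
    (by
      change ∀ᵐ x ∂(dm p), x ∈ closedBall (0 : V) R
      filter_upwards [hνr] with x hx
      rw [mem_closedBall_zero_iff]; linarith)
    (fun x y => kk ε ‖x - y‖) (Real.toNNReal (1 / ε)) (cost_lip1 ε hε) (cost_lip2 ε hε)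
    ((kk_lip ε hε).continuous.comp (by fun_prop))
  have hπp : IsProbabilityMeasure π := by
    refine ⟨?_⟩
    have h : (π.map Prod.fst) univ = 1 := by rw [hπ1]; exact measure_univ
    rwa [Measure.map_apply measurable_fst MeasurableSet.univ, preimage_univ] at h
  have push1 : ∀ {P : V → Prop}, (∀ᵐ x ∂(dm q), P x) → ∀ᵐ z ∂π, P z.1 := by
    intro P h
    rw [← hπ1] at h
    exact ae_of_ae_map measurable_fst.aemeasurable h
  have push2 : ∀ {P : V → Prop}, (∀ᵐ x ∂(dm p), P x) → ∀ᵐ z ∂π, P z.2 := by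
    intro P h
    rw [← hπ2] at h
    exact ae_of_ae_map measurable_snd.aemeasurable h
  have int1 : ∀ f : V → ℝ, Integrable f (dm q) → Integrable (fun z : V × V => f z.1) π ∧
      ∫ z, f z.1 ∂π = ∫ x, f x ∂(dm q) := by
    intro f hf
    rw [← hπ1] at hf ⊢
    exact ⟨hf.comp_measurable measurable_fst, (integral_map measurable_fst.aemeasurable hf.1).symm⟩
  have int2 : ∀ f : V → ℝ, Integrable f (dm p) → Integrable (fun z : V × V => f z.2) π ∧
      ∫ z, f z.2 ∂π = ∫ x, f x ∂(dm p) := by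
    intro f hf
    rw [← hπ2] at hf ⊢
    exact ⟨hf.comp_measurable measurable_snd, (integral_map measurable_snd.aemeasurable hf.1).symm⟩
  -- basic a.e. facts
  have hdist : ∀ᵐ z ∂π, q z.1 / K ≤ ‖z.1 - z.2‖ ∧ z.1 ≠ z.2 := by
    filter_upwards [push1 (dm_pos hqc hq0), push2 (dm_pos hpc hp0)] with z h1 h2
    have h3 : q z.2 = 0 := by
      rcases mul_eq_zero.1 (hqp z.2) with h | h
      · exact h
      · exact absurd h h2.ne'
    constructor
    · rw [div_le_iff₀ hK']
      have h4 := hq.dist_le_mul z.1 z.2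
      rw [Real.dist_eq, h3, sub_zero, abs_of_pos h1, dist_eq_norm] at h4
      linarith
    · intro h; rw [h, h3] at h1; exact lt_irrefl _ h1
  let κ : V × V → ℝ := fun z => (ε ^ 2 - ‖z.1 - z.2‖ ^ 2) / (‖z.1 - z.2‖ ^ 2 + ε ^ 2) ^ 2
  have hDpos : ∀ z : V × V, 0 < ‖z.1 - z.2‖ ^ 2 + ε ^ 2 := fun z => by positivity
  have ibd : ∀ f : V × V → ℝ, Continuous f → Integrable f π := by
    intro f hf
    have hcpt : IsCompact (closedBall (0 : V) R ×ˢ closedBall (0 : V) R) :=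
      (isCompact_closedBall _ _).prod (isCompact_closedBall _ _)
    obtain ⟨C, hC⟩ := hcpt.exists_bound_of_continuousOn hf.continuousOn
    refine Integrable.of_bound hf.aestronglyMeasurable C ?_
    filter_upwards [push1 hμr, push2 hνr] with z h1 h2
    exact hC z ⟨by rw [mem_closedBall_zero_iff]; linarith, by rw [mem_closedBall_zero_iff]; linarith⟩
  have hκc : Continuous κ := by
    refine Continuous.div (by fun_prop) (by fun_prop) fun z => ?_
    have := hDpos z; positivity
  -- step 1
  have step1 : 4 * ∫ z, -κ z ∂π ≤ (∫ x, ⟪gradient φ x, gradient (fun x => q x ^ 2) x⟫) +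
      ∫ x, ⟪gradient ψ x, gradient (fun x => p x ^ 2) x⟫ := by
    let h : ℕ → ℝ := fun n => 1 / ((n : ℝ) + 1)
    have h0 : ∀ n, 0 < h n := fun n => by simp only [h]; positivity
    have h1 : ∀ n, h n ≤ 1 := fun n => by
      simp only [h]; rw [div_le_one (by positivity)]; linarith [Nat.cast_nonneg (α := ℝ) n]
    have hl : Tendsto h atTop (nhds 0) := tendsto_one_div_add_atTop_nhds_zero_nat
    obtain ⟨K1, hK1⟩ := sq_lip hq hqs
    obtain ⟨K2, hK2⟩ := sq_lip hp hps
    have hqs2 : HasCompactSupport (fun x => q x ^ 2) := hqs.comp_left (g := fun t : ℝ => t ^ 2) (by simp)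
    have hps2 : HasCompactSupport (fun x => p x ^ 2) := hps.comp_left (g := fun t : ℝ => t ^ 2) (by simp)
    have l1 := ibp_limit m hm φ _ _ K1 hφ hK1 hqs2 h h0 h1 hl
    have l2 := ibp_limit m hm ψ _ _ K2 hψ hK2 hps2 h h0 h1 hl
    have l3 := l1.add l2
    set C := 4 / ε ^ 4 * (volume (ball (0 : V) 1)).toReal with hC
    have l4 : Tendsto (fun n => 2 * m * (∫ z, κ z ∂π) + h n ^ 2 * C) atTop
        (nhds (2 * m * (∫ z, κ z ∂π) + 0 ^ 2 * C)) :=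
      ((hl.pow 2).mul_const C).const_add _
    have hintg : ∀ (f : V → ℝ) (n : ℕ), Continuous f → Continuous fun x => ∫ z in ball (0 : V) 1, (f (x + h n • z) - f x) := by
      intro f n hf
      have h5 : ∀ x, ∫ z in ball (0 : V) 1, (f (x + h n • z) - f x) = ∫ z in closedBall (0 : V) 1, (f (x + h n • z) - f x) := by
        intro x
        exact setIntegral_congr_set (ballae 0 1)
      simp_rw [h5]
      exact continuous_parametric_integral_of_continuous (by fun_prop) (isCompact_closedBall 0 1)
    have l5 := le_of_tendsto_of_tendsto' l3 l4 (fun n => by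
      have g1 := hintg φ n hφ.continuous
      have g2 := hintg ψ n hψ.continuous
      have j1 := int1 _ (dm_integrable hqc _ ((by fun_prop : Continuous fun x => q x ^ 2 *
        ∫ z in ball (0 : V) 1, (φ (x + h n • z) - φ x)).integrable_of_hasCompactSupport hqs2.mul_right))
      have j2 := int2 _ (dm_integrable hpc _ ((by fun_prop : Continuous fun x => p x ^ 2 *
        ∫ z in ball (0 : V) 1, (ψ (x + h n • z) - ψ x)).integrable_of_hasCompactSupport hps2.mul_right))
      rw [dm_int hqc] at j1
      rw [dm_int hpc] at j2
      rw [← j1.2, ← j2.2, ← add_div, ← integral_add j1.1 j2.1, div_le_iff₀ (pow_pos (h0 n) 2)]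
      have i5 : Integrable (fun z => h n ^ 2 * (2 * m * κ z) + h n ^ 4 * C) π := ibd _ (by fun_prop)
      calc _ ≤ ∫ z, (h n ^ 2 * (2 * m * κ z) + h n ^ 4 * C) ∂π := by
            refine integral_mono_ae (j1.1.add j2.1) i5 ?_
            filter_upwards [hcon, hdist, push1 hμr, push2 hνr] with z w1 w2 w3 w4
            exact avg_ineq m hm ε R hε φ ψ hφ.continuous hψ.continuous hle z.1 z.2 w3 w4 w2.2 w1 (h n) (h0 n) (h1 n)
        _ = _ := by
            rw [integral_add (ibd _ (by fun_prop)) (ibd _ (by fun_prop)), integral_const_mul, integral_const_mul]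
            simp
            ring)
    rw [integral_neg]
    have l6 : m * (-4 * (∫ z, κ z ∂π)) ≤ m * ((∫ x, ⟪gradient φ x, gradient (fun x => q x ^ 2) x⟫) +
      ∫ x, ⟪gradient ψ x, gradient (fun x => p x ^ 2) x⟫) := by nlinarith [l5]
    have := le_of_mul_le_mul_left l6 hm0
    linarith
  -- step 2
  have A1 := q_grad_int hq hqs hq0 hφ
  have A2 := q_grad_int hp hps hp0 hψ
  have B1 := q_en_int hq hqs hq0
  have B2 := q_en_int hp hps hp0
  rw [← A1.2, ← A2.2] at step1
  have a1 := int1 _ A1.1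
  have a2 := int2 _ A2.1
  have b1 := int1 _ B1.1
  have b2 := int2 _ B2.1
  rw [← a1.2, ← a2.2, ← integral_add a1.1 a2.1] at step1
  have hnear : ∀ x : V, ‖x‖ ≤ R - 1 → ∀ᶠ w in nhds x, w ∈ closedBall (0 : V) R := by
    intro x hx
    have : ball (0 : V) R ∈ nhds x := isOpen_ball.mem_nhds (by rw [mem_ball_zero_iff]; linarith)
    filter_upwards [this] with w hw using ball_subset_closedBall hw
  have hgr : ∀ᵐ z ∂π, gradient φ z.1 = (1 / (‖z.1 - z.2‖ ^ 2 + ε ^ 2)) • (z.1 - z.2) ∧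
      gradient ψ z.2 = (1 / (‖z.1 - z.2‖ ^ 2 + ε ^ 2)) • (z.2 - z.1) := by
    filter_upwards [hcon, push1 hμr, push2 hνr, push1 ((dm_ac q).ae_le hφ.ae_differentiableAt),
      push2 ((dm_ac p).ae_le hψ.ae_differentiableAt)] with z w1 w2 w3 w4 w5
    constructor
    · refine grad_of_le w4 (cost_fderiv ε hε z.1 z.2) ?_
      filter_upwards [hnear _ w2] with x hx
      have := hle x hx z.2 (by rw [mem_closedBall_zero_iff]; linarith)
      linarith
    · have := cost_fderiv ε hε z.2 z.1
      rw [norm_sub_rev z.2 z.1] at this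
      refine grad_of_le w5 this ?_
      filter_upwards [hnear _ w3] with y hy
      have := hle z.1 (by rw [mem_closedBall_zero_iff]; linarith) y hy
      rw [norm_sub_rev y, norm_sub_rev z.2]
      linarith
  -- error term
  let er : V → ℝ := fun x => ε ^ 2 / ((q x / K) ^ 2 + ε ^ 2) + 4 * ε ^ 2 / ((q x / K) ^ 2 + ε ^ 2) ^ 2
  have herc : Continuous er := by
    have : ∀ x, 0 < (q x / K) ^ 2 + ε ^ 2 := fun x => by positivity
    exact (continuous_const.div (by fun_prop) fun x => (this x).ne').add
      (continuous_const.div (by fun_prop) fun x => (pow_pos (this x) 2).ne')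
  have hqs2 : HasCompactSupport (fun x => q x ^ 2) := hqs.comp_left (g := fun t : ℝ => t ^ 2) (by simp)
  have e1 := int1 er (dm_integrable hqc _ ((by fun_prop : Continuous fun x => q x ^ 2 * er x).integrable_of_hasCompactSupport hqs2.mul_right))
  rw [dm_int hqc] at e1
  have hpt : ∀ᵐ z ∂π, 2 * ⟪gradient φ z.1, lg q z.1⟫ + 2 * ⟪gradient ψ z.2, lg p z.2⟫ ≤
      4 * (-κ z) + ((1 / 4) * (1 + t) * ‖lg q z.1 + (1 / 2 : ℝ) • z.1‖ ^ 2 +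
      ((1 / 4) * (1 + 1 / t) * ‖lg p z.2 + (1 / 2 : ℝ) • z.2‖ ^ 2 + (er z.1 - 1))) := by
    filter_upwards [hdist, hgr] with z hz hz2
    have hD := hDpos z
    have hx0 : 0 ≤ q z.1 / K := div_nonneg (hq0 _) hK'.le
    have hDD : (q z.1 / K) ^ 2 + ε ^ 2 ≤ ‖z.1 - z.2‖ ^ 2 + ε ^ 2 := by
      gcongr; exact hz.1
    have hD' : 0 < (q z.1 / K) ^ 2 + ε ^ 2 := by positivity
    have f1 : ε ^ 2 / (‖z.1 - z.2‖ ^ 2 + ε ^ 2) ≤ ε ^ 2 / ((q z.1 / K) ^ 2 + ε ^ 2) := by gcongr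
    have f2 : 4 * ε ^ 2 / (‖z.1 - z.2‖ ^ 2 + ε ^ 2) ^ 2 ≤ 4 * ε ^ 2 / ((q z.1 / K) ^ 2 + ε ^ 2) ^ 2 := by gcongr
    have f3 : ‖z.1 - z.2‖ ^ 2 / (‖z.1 - z.2‖ ^ 2 + ε ^ 2) + ε ^ 2 / (‖z.1 - z.2‖ ^ 2 + ε ^ 2) = 1 := by
      field_simp
    have f4 : 4 * ‖z.1 - z.2‖ ^ 2 / (‖z.1 - z.2‖ ^ 2 + ε ^ 2) ^ 2 =
        4 * (-κ z) + 4 * ε ^ 2 / (‖z.1 - z.2‖ ^ 2 + ε ^ 2) ^ 2 := by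
      simp only [κ]; field_simp; ring
    have f5 := ot_pt z.1 z.2 (lg q z.1) (lg p z.2) _ _ ε t hε ht hz2.1 hz2.2
    rw [f4] at f5
    have f6 : er z.1 = ε ^ 2 / ((q z.1 / K) ^ 2 + ε ^ 2) + 4 * ε ^ 2 / ((q z.1 / K) ^ 2 + ε ^ 2) ^ 2 := rfl
    linarith
  have k1 : Integrable (fun z => 4 * (-κ z)) π := ibd _ (by fun_prop)
  have k2 := b1.1.const_mul ((1 / 4) * (1 + t))
  have k3 := b2.1.const_mul ((1 / 4) * (1 + 1 / t))
  have k4 : Integrable (fun z : V × V => er z.1 - 1) π := e1.1.sub (integrable_const 1)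
  have step2 := integral_mono_ae (a1.1.add a2.1) (k1.add (k2.add (k3.add k4))) hpt
  have step3 := step1.trans step2
  rw [integral_add' k1 (k2.add (k3.add k4)), integral_add' k2 (k3.add k4), integral_add' k3 k4, integral_const_mul,
    integral_const_mul, integral_const_mul, b1.2, b2.2, B1.2, B2.2,
    integral_sub e1.1 (integrable_const 1), e1.2] at step3
  simp only [integral_const, probReal_univ, smul_eq_mul, mul_one] at step3
  simp only [er] at step3
  linarith

theorem ot_main [Nontrivial V] (q p : V → ℝ) (K : ℝ≥0) (hK : 0 < K) (hq : LipschitzWith K q)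
    (hp : LipschitzWith K p) (hqs : HasCompactSupport q) (hps : HasCompactSupport p)
    (hq0 : ∀ x, 0 ≤ q x) (hp0 : ∀ x, 0 ≤ p x) (hqp : ∀ x, q x * p x = 0)
    (hq1 : ∫ x, q x ^ 2 = 1) (hp1 : ∫ x, p x ^ 2 = 1) (t : ℝ) (ht : 0 < t) :
    4 ≤ (1 + t) * (∫ x, ‖gradient q x + (q x / 2) • x‖ ^ 2) +
      (1 + 1 / t) * (∫ x, ‖gradient p x + (p x / 2) • x‖ ^ 2) := by
  have hK' : (0 : ℝ) < K := hK
  have hqc := hq.continuous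
  let h : ℕ → ℝ := fun n => 1 / ((n : ℝ) + 1)
  have h0 : ∀ n, 0 < h n := fun n => by simp only [h]; positivity
  have hl : Tendsto h atTop (nhds 0) := tendsto_one_div_add_atTop_nhds_zero_nat
  obtain ⟨M, hM0, hM⟩ := cpt_bdd hqc hqs
  have lim : Tendsto (fun n => ∫ x, q x ^ 2 * (h n ^ 2 / ((q x / K) ^ 2 + h n ^ 2) + 4 * h n ^ 2 / ((q x / K) ^ 2 + h n ^ 2) ^ 2))
      atTop (nhds (∫ x : V, (0 : ℝ))) := by
    have hi : Integrable ((tsupport q).indicator (fun _ : V => M ^ 2 + (K : ℝ) ^ 2)) :=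
      (integrable_indicator_iff (isClosed_tsupport q).measurableSet).2
        (integrableOn_const hqs.isCompact.measure_lt_top.ne)
    refine tendsto_integral_of_dominated_convergence _ (fun n => ?_) hi (fun n => Eventually.of_forall fun x => ?_) (Eventually.of_forall fun x => ?_)
    · have : ∀ x, 0 < (q x / K) ^ 2 + h n ^ 2 := fun x => by have := h0 n; positivity
      exact ((hqc.pow 2).mul ((continuous_const.div (by fun_prop) fun x => (this x).ne').add
        (continuous_const.div (by fun_prop) fun x => (pow_pos (this x) 2).ne'))).aestronglyMeasurable
    · have hn := h0 n
      by_cases hx : x ∈ tsupport q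
      · rw [indicator_of_mem hx, Real.norm_eq_abs, abs_of_nonneg (by positivity), mul_add]
        have hD : 0 < (q x / K) ^ 2 + h n ^ 2 := by positivity
        refine add_le_add ?_ ?_
        · have h1 : h n ^ 2 / ((q x / K) ^ 2 + h n ^ 2) ≤ 1 := by
            rw [div_le_one hD]; nlinarith [sq_nonneg (q x / K)]
          have h2 : q x ^ 2 ≤ M ^ 2 := sq_le_sq' (abs_le.1 (hM x)).1 (abs_le.1 (hM x)).2
          nlinarith [sq_nonneg (q x)]
        · rw [← mul_div_assoc, div_le_iff₀ (by positivity)]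
          have h3 : q x = K * (q x / K) := by field_simp
          set d := q x / K
          rw [h3]
          have h4 : 4 * d ^ 2 * h n ^ 2 ≤ (d ^ 2 + h n ^ 2) ^ 2 := by nlinarith [sq_nonneg (d ^ 2 - h n ^ 2)]
          calc (K * d) ^ 2 * (4 * h n ^ 2) = K ^ 2 * (4 * d ^ 2 * h n ^ 2) := by ring
            _ ≤ _ := by gcongr
      · rw [indicator_of_notMem hx, image_eq_zero_of_notMem_tsupport hx]; simp
    · by_cases hx : q x = 0
      · simp [hx]
      · have t1 : Tendsto (fun n => q x ^ 2 * (h n ^ 2 / ((q x / K) ^ 2 + h n ^ 2) + 4 * h n ^ 2 / ((q x / K) ^ 2 + h n ^ 2) ^ 2)) atTop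
            (nhds (q x ^ 2 * (0 ^ 2 / ((q x / K) ^ 2 + 0 ^ 2) + 4 * 0 ^ 2 / ((q x / K) ^ 2 + 0 ^ 2) ^ 2))) := by
          have hne : q x / K ≠ 0 := div_ne_zero hx hK'.ne'
          have hne2 : (q x / K) ^ 2 + 0 ^ 2 ≠ 0 := by simpa using ⟨hx, hK.ne'⟩
          exact (((hl.pow 2).div ((hl.pow 2).const_add _) hne2).add
            (((hl.pow 2).const_mul 4).div (((hl.pow 2).const_add _).pow 2) (pow_ne_zero 2 hne2))).const_mul _
        simpa using t1
  have lim2 := (lim.const_mul 4).const_add ((1 + t) * (∫ x, ‖gradient q x + (q x / 2) • x‖ ^ 2) +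
      (1 + 1 / t) * (∫ x, ‖gradient p x + (p x / 2) • x‖ ^ 2))
  have := ge_of_tendsto' lim2 (fun n => ot_eps q p K hK hq hp hqs hps hq0 hp0 hqp hq1 hp1 t ht (h n) (h0 n))
  simpa using this
end ot

section polar
variable {V : Type*} [NormedAddCommGroup V] [InnerProductSpace ℝ V] [FiniteDimensional ℝ V] [MeasurableSpace V] [BorelSpace V]

/-- the radial measure `ρ^(N-1) dρ` on `(0,∞)` -/
def radM (k : ℕ) : Measure ℝ := (volume.restrict (Ioi (0:ℝ))).withDensity (fun ρ => ENNReal.ofReal (ρ ^ k))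

theorem radM_map (k : ℕ) : (Measure.volumeIoiPow k).map (Subtype.val) = radM k := by
  have he : MeasurableEmbedding (Subtype.val : Ioi (0:ℝ) → ℝ) := MeasurableEmbedding.subtype_coe measurableSet_Ioi
  unfold radM
  rw [← map_comap_subtype_coe measurableSet_Ioi]
  ext s hs
  rw [Measure.map_apply measurable_subtype_coe hs, Measure.volumeIoiPow,
    withDensity_apply _ (measurable_subtype_coe hs), withDensity_apply _ hs,
    he.restrict_map, he.lintegral_map]

theorem radM_ae (k : ℕ) {p : ℝ → Prop} : (∀ᵐ ρ ∂(radM k), p ρ) ↔ ∀ᵐ ρ ∂(volume.restrict (Ioi (0:ℝ))), p ρ := by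
  unfold radM
  rw [ae_withDensity_iff (by fun_prop)]
  constructor
  · intro h
    filter_upwards [h, ae_restrict_mem measurableSet_Ioi] with x hx hx0
    apply hx
    simp only [ne_eq, ENNReal.ofReal_eq_zero, not_le]
    exact pow_pos hx0 _
  · intro h
    filter_upwards [h] with x hx _ using hx

instance (k : ℕ) : SFinite (radM k) := by unfold radM; infer_instance

theorem radM_int (k : ℕ) (f : ℝ → ℝ) : ∫ ρ, f ρ ∂(radM k) = ∫ ρ in Ioi (0:ℝ), ρ ^ k * f ρ := by
  unfold radM
  rw [integral_withDensity_eq_integral_toReal_smul (by fun_prop) (by simp)]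
  refine setIntegral_congr_fun measurableSet_Ioi (fun x hx => ?_)
  simp only [smul_eq_mul]
  rw [ENNReal.toReal_ofReal (pow_nonneg (le_of_lt hx) _)]

theorem radM_integrable (k : ℕ) (f : ℝ → ℝ) : Integrable f (radM k) ↔ IntegrableOn (fun ρ => ρ ^ k * f ρ) (Ioi 0) := by
  unfold radM
  rw [integrable_withDensity_iff_integrable_smul₀' (by fun_prop) (by simp)]
  refine integrableOn_congr_fun (fun x hx => ?_) measurableSet_Ioi
  simp only [smul_eq_mul]
  rw [ENNReal.toReal_ofReal (pow_nonneg (le_of_lt hx) _)]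

/-- surface measure on the unit sphere -/
abbrev sgm (V : Type*) [NormedAddCommGroup V] [InnerProductSpace ℝ V] [FiniteDimensional ℝ V] [MeasurableSpace V] [BorelSpace V] :
    Measure (sphere (0:V) 1) := (volume : Measure V).toSphere

/-- polar coordinates -/
theorem pol [Nontrivial V] : MeasurePreserving (fun p : sphere (0:V) 1 × ℝ => p.2 • (p.1 : V))
    ((sgm V).prod (radM (Module.finrank ℝ V - 1))) volume := by
  have h1 := ((volume : Measure V).measurePreserving_homeomorphUnitSphereProd).symm
    ((homeomorphUnitSphereProd V).toMeasurableEquiv)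
  have h2 : MeasurePreserving (Subtype.val : ({0}ᶜ : Set V) → V) (Measure.comap Subtype.val (volume : Measure V)) volume := by
    refine ⟨measurable_subtype_coe, ?_⟩
    rw [map_comap_subtype_coe (measurableSet_singleton _).compl, restrict_compl_singleton]
  have h3 := h2.comp h1
  have h4 : MeasurePreserving (Prod.map id Subtype.val : sphere (0:V) 1 × Ioi (0:ℝ) → sphere (0:V) 1 × ℝ)
    ((sgm V).prod (Measure.volumeIoiPow (Module.finrank ℝ V - 1)))
    ((sgm V).prod (radM (Module.finrank ℝ V - 1))) :=
    (MeasurePreserving.id _).prod ⟨measurable_subtype_coe, radM_map _⟩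
  refine ⟨by fun_prop, ?_⟩
  rw [← h4.map_eq, Measure.map_map (by fun_prop) h4.measurable, ]
  exact h3.map_eq

theorem pol_ae [Nontrivial V] {P : V → Prop} (h : ∀ᵐ x, P x) :
    ∀ᵐ ρ ∂(volume.restrict (Ioi (0:ℝ))), ∀ᵐ θ : sphere (0:V) 1 ∂sgm V, P (ρ • (θ : V)) := by
  have h1 := (pol (V := V)).quasiMeasurePreserving.ae h
  have h2 := (Measure.measurePreserving_swap (μ := radM (Module.finrank ℝ V - 1)) (ν := sgm V)).quasiMeasurePreserving.ae h1
  have h3 := Measure.ae_ae_of_ae_prod h2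
  rw [radM_ae] at h3
  exact h3

theorem pol_integrable_prod [Nontrivial V] {f : V → ℝ} (hf : Integrable f) :
    Integrable (fun p : ℝ × sphere (0:V) 1 => f (p.1 • (p.2 : V)))
      ((radM (Module.finrank ℝ V - 1)).prod (sgm V)) :=
  ((pol (V := V)).integrable_comp_of_integrable hf).swap

theorem pol_int [Nontrivial V] {f : V → ℝ} (hf : Integrable f) :
    ∫ x, f x = ∫ ρ in Ioi (0:ℝ), ρ ^ (Module.finrank ℝ V - 1) * ∫ θ, f (ρ • (θ : V)) ∂sgm V := by
  rw [← radM_int, integral_integral (f := fun (ρ : ℝ) (θ : sphere (0:V) 1) => f (ρ • (θ : V))) (pol_integrable_prod hf)]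
  conv_lhs => rw [← (pol (V := V)).map_eq]
  rw [integral_map (pol (V := V)).measurable.aemeasurable]
  · rw [← integral_prod_swap]; rfl
  · rw [(pol (V := V)).map_eq]; exact hf.1

theorem pol_integrable [Nontrivial V] {f : V → ℝ} (hf : Integrable f) :
    IntegrableOn (fun ρ => ρ ^ (Module.finrank ℝ V - 1) * ∫ θ, f (ρ • (θ : V)) ∂sgm V) (Ioi (0:ℝ)) := by
  rw [← radM_integrable]
  exact (pol_integrable_prod hf).integral_prod_left

theorem ray_norm (θ : sphere (0:V) 1) {ρ : ℝ} (hρ : 0 < ρ) : ‖ρ • (θ : V)‖ = ρ ∧ ‖ρ • (θ : V)‖⁻¹ • (ρ • (θ : V)) = θ := by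
  have h : ‖(θ : V)‖ = 1 := by simpa using θ.2
  have h1 : ‖ρ • (θ : V)‖ = ρ := by rw [norm_smul, h, mul_one, Real.norm_of_nonneg hρ.le]
  refine ⟨h1, ?_⟩
  rw [h1, smul_smul, inv_mul_cancel₀ hρ.ne', one_smul]

theorem pol_ae_ray [Nontrivial V] {P : V → Prop} (h : ∀ᵐ θ : sphere (0:V) 1 ∂sgm V, P θ) :
    ∀ᵐ x : V, P (‖x‖⁻¹ • x) := by
  have h0 : (sgm V) {θ | ¬ P θ} = 0 := h
  obtain ⟨t, ht, htm, ht0⟩ := exists_measurable_superset_of_null h0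
  set s : Set V := Subtype.val '' t
  have hs : MeasurableSet s := (MeasurableEmbedding.subtype_coe isClosed_sphere.measurableSet).measurableSet_image.2 htm
  have hm : Measurable (fun x : V => ‖x‖⁻¹ • x) := by fun_prop
  have key : volume ((fun x : V => ‖x‖⁻¹ • x) ⁻¹' s) = 0 := by
    rw [← (pol (V := V)).map_eq, Measure.map_apply (pol (V := V)).measurable (hm hs)]
    have : ∀ᵐ p ∂((sgm V).prod (radM (Module.finrank ℝ V - 1))), p ∈ ((t ×ˢ univ)ᶜ ∩ (univ ×ˢ Ioi (0:ℝ)) : Set (sphere (0:V) 1 × ℝ)) := by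
      apply Filter.inter_mem (f := ae _)
      · have := Measure.prod_prod (μ := sgm V) (ν := radM (Module.finrank ℝ V - 1)) t univ
        rw [ht0, zero_mul] at this
        exact compl_mem_ae_iff.2 this
      · have h2 : ∀ᵐ ρ ∂(radM (Module.finrank ℝ V - 1)), ρ ∈ Ioi (0:ℝ) := (radM_ae _).2 (ae_restrict_mem measurableSet_Ioi)
        have h3 : (radM (Module.finrank ℝ V - 1)) (Ioi (0:ℝ))ᶜ = 0 := h2
        have := Measure.prod_prod (μ := sgm V) (ν := radM (Module.finrank ℝ V - 1)) univ (Ioi (0:ℝ))ᶜ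
        rw [h3, mul_zero] at this
        filter_upwards [compl_mem_ae_iff.2 this] with p hp
        simpa using hp
    refine measure_mono_null ?_ (ae_iff.1 this)
    rintro ⟨θ, ρ⟩ hp ⟨h1, h2⟩
    simp only [mem_prod, mem_univ, true_and, mem_Ioi] at h2
    simp only [mem_preimage, (ray_norm θ h2).2] at hp
    obtain ⟨a, ha, hb⟩ := hp
    apply h1
    simp only [mem_prod, mem_univ, and_true]
    rwa [← Subtype.ext hb]
  rw [ae_iff]
  refine measure_mono_null (t := ((fun x : V => ‖x‖⁻¹ • x) ⁻¹' s) ∪ {0}) ?_ (by rw [measure_union_null_iff]; exact ⟨key, measure_singleton 0⟩)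
  intro x hx
  by_cases hx0 : x = 0
  · right; exact hx0
  left
  refine ⟨⟨‖x‖⁻¹ • x, ?_⟩, ht ?_, rfl⟩
  · simp [norm_smul, hx0]
  · exact hx

theorem pol_prod [Nontrivial V] (F : ℝ → ℝ) (G : V → ℝ) (hF : Measurable F) (hG : Measurable G) :
    ∫ x : V, F ‖x‖ * G (‖x‖⁻¹ • x) = (∫ ρ in Ioi (0:ℝ), ρ ^ (Module.finrank ℝ V - 1) * F ρ) * ∫ θ, G θ ∂sgm V := by
  have hm : Measurable (fun x : V => F ‖x‖ * G (‖x‖⁻¹ • x)) := by fun_prop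
  rw [← radM_int]
  conv_lhs => rw [← (pol (V := V)).map_eq]
  rw [integral_map (pol (V := V)).measurable.aemeasurable hm.aestronglyMeasurable, mul_comm,
    ← integral_prod_mul (μ := sgm V) (ν := radM (Module.finrank ℝ V - 1)) (fun θ => G θ) F]
  refine integral_congr_ae ?_
  have h2 : ∀ᵐ ρ ∂(radM (Module.finrank ℝ V - 1)), ρ ∈ Ioi (0:ℝ) := (radM_ae _).2 (ae_restrict_mem measurableSet_Ioi)
  have h3 := (Measure.quasiMeasurePreserving_snd (μ := sgm V) (ν := radM (Module.finrank ℝ V - 1))).ae h2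
  filter_upwards [h3] with p hp
  rw [(ray_norm p.1 hp).1, ]
  have := (ray_norm p.1 hp).2
  rw [(ray_norm p.1 hp).1] at this
  rw [this, mul_comm]
end polar

section radial

theorem st_deriv_bdd : ∃ C : ℝ, 0 ≤ C ∧ ∀ x, |deriv Real.smoothTransition x| ≤ C := by
  have hc : Continuous (deriv Real.smoothTransition) :=
    (Real.smoothTransition.contDiff (n := 1)).continuous_deriv le_rfl
  have hs : HasCompactSupport (deriv Real.smoothTransition) := by
    refine HasCompactSupport.intro (isCompact_Icc (a := (0:ℝ)) (b := 1)) (fun x hx => ?_)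
    simp only [mem_Icc, not_and_or, not_le] at hx
    rcases hx with h | h
    · have : Real.smoothTransition =ᶠ[nhds x] fun _ => 0 := by
        filter_upwards [Iio_mem_nhds h] with y hy using Real.smoothTransition.zero_of_nonpos (le_of_lt hy)
      rw [this.deriv_eq]; simp
    · have : Real.smoothTransition =ᶠ[nhds x] fun _ => 1 := by
        filter_upwards [Ioi_mem_nhds h] with y hy using Real.smoothTransition.one_of_one_le (le_of_lt hy)
      rw [this.deriv_eq]; simp
  obtain ⟨C, hC⟩ := hc.bounded_above_of_compact_support hs
  exact ⟨C, (norm_nonneg _).trans (hC 0), hC⟩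

theorem st_deriv_zero {x : ℝ} (hx : x < 0 ∨ 1 < x) : deriv Real.smoothTransition x = 0 := by
  rcases hx with h | h
  · have : Real.smoothTransition =ᶠ[nhds x] fun _ => 0 := by
      filter_upwards [Iio_mem_nhds h] with y hy using Real.smoothTransition.zero_of_nonpos (le_of_lt hy)
    rw [this.deriv_eq]; simp
  · have : Real.smoothTransition =ᶠ[nhds x] fun _ => 1 := by
      filter_upwards [Ioi_mem_nhds h] with y hy using Real.smoothTransition.one_of_one_le (le_of_lt hy)
    rw [this.deriv_eq]; simp

/-- radial cutoff -/
def rcut (j : ℕ) (ρ : ℝ) : ℝ := Real.smoothTransition (j * ρ - 1) * Real.smoothTransition (j + 1 - ρ)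

def rcut' (j : ℕ) (ρ : ℝ) : ℝ := (deriv Real.smoothTransition (j * ρ - 1) * j) * Real.smoothTransition (j + 1 - ρ)
  - Real.smoothTransition (j * ρ - 1) * deriv Real.smoothTransition (j + 1 - ρ)

theorem rcut_deriv (j : ℕ) (ρ : ℝ) : HasDerivAt (rcut j) (rcut' j ρ) ρ := by
  have hd : ∀ x, HasDerivAt Real.smoothTransition (deriv Real.smoothTransition x) x := fun x =>
    ((Real.smoothTransition.contDiff (n := 1)).differentiable (by simp) x).hasDerivAt
  have h1 : HasDerivAt (fun ρ : ℝ => (j:ℝ) * ρ - 1) j ρ := by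
    simpa using ((hasDerivAt_id ρ).const_mul (j:ℝ)).sub_const 1
  have h2 : HasDerivAt (fun ρ : ℝ => (j:ℝ) + 1 - ρ) (-1) ρ := by
    simpa using (hasDerivAt_id ρ).const_sub ((j:ℝ)+1)
  have h3 := ((hd _).comp ρ h1).mul ((hd _).comp ρ h2)
  refine HasDerivAt.congr_deriv h3 ?_
  simp only [rcut', Function.comp]; ring

theorem rcut_nonneg (j : ℕ) (ρ : ℝ) : 0 ≤ rcut j ρ :=
  mul_nonneg (Real.smoothTransition.nonneg _) (Real.smoothTransition.nonneg _)

theorem rcut_cd (j : ℕ) : ContDiff ℝ 1 (rcut j) := by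
  unfold rcut
  exact (Real.smoothTransition.contDiff.comp (by fun_prop)).mul (Real.smoothTransition.contDiff.comp (by fun_prop))

theorem rcut_zero {j : ℕ} (hj : 0 < j) {ρ : ℝ} (h : ρ ≤ 1 / j ∨ (j:ℝ) + 1 ≤ ρ) : rcut j ρ = 0 := by
  have hj' : (0:ℝ) < j := by exact_mod_cast hj
  unfold rcut
  rcases h with h | h
  · rw [Real.smoothTransition.zero_of_nonpos, zero_mul]
    rw [le_div_iff₀ hj'] at h; linarith
  · rw [Real.smoothTransition.zero_of_nonpos (x := (j:ℝ) + 1 - ρ), mul_zero]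
    linarith

theorem rcut_one {j : ℕ} (hj : 2 ≤ j) {ρ : ℝ} (h : 1 ≤ ρ) (h2 : ρ ≤ 2) : rcut j ρ = 1 := by
  have hj' : (2:ℝ) ≤ j := by exact_mod_cast hj
  unfold rcut
  rw [Real.smoothTransition.one_of_one_le, Real.smoothTransition.one_of_one_le, one_mul]
  · linarith
  · nlinarith

theorem rcut'_bound : ∃ C : ℝ, 0 ≤ C ∧ ∀ (j : ℕ) (ρ : ℝ), 0 < ρ → |rcut' j ρ| ≤ C * (2 / ρ + 1) := by
  obtain ⟨C, hC0, hC⟩ := st_deriv_bdd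
  refine ⟨C, hC0, fun j ρ hρ => ?_⟩
  unfold rcut'
  have h1 : |deriv Real.smoothTransition (j * ρ - 1) * j| ≤ C * (2 / ρ) := by
    by_cases h : (1:ℝ) < j * ρ - 1
    · rw [st_deriv_zero (Or.inr h)]; simp; positivity
    · rw [abs_mul]
      refine mul_le_mul (hC _) ?_ (abs_nonneg _) hC0
      rw [abs_of_nonneg (Nat.cast_nonneg j), le_div_iff₀ hρ]
      linarith
  have a1 : ∀ x, |Real.smoothTransition x| ≤ 1 := fun x => by
    rw [abs_of_nonneg (Real.smoothTransition.nonneg x)]; exact Real.smoothTransition.le_one x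
  calc _ ≤ |(deriv Real.smoothTransition (j * ρ - 1) * j) * Real.smoothTransition (j + 1 - ρ)| + |Real.smoothTransition (j * ρ - 1) * deriv Real.smoothTransition (j + 1 - ρ)| := abs_sub _ _
    _ ≤ C * (2 / ρ) * 1 + 1 * C := by
        rw [abs_mul _ (Real.smoothTransition (j + 1 - ρ)), abs_mul (Real.smoothTransition (j * ρ - 1))]
        gcongr
        · exact a1 _
        · exact a1 _
        · exact hC _
    _ = _ := by ring

theorem rcut'_lim {ρ : ℝ} (hρ : 0 < ρ) : Tendsto (fun j => rcut' j ρ) atTop (nhds 0) := by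
  apply tendsto_const_nhds.congr'
  obtain ⟨m, hm⟩ := exists_nat_gt (2 / ρ)
  obtain ⟨m', hm'⟩ := exists_nat_gt ρ
  filter_upwards [eventually_ge_atTop m, eventually_ge_atTop m'] with j h1 h2
  have h1' : (m:ℝ) ≤ j := by exact_mod_cast h1
  have h2' : (m':ℝ) ≤ j := by exact_mod_cast h2
  have : 2 < (j:ℝ) * ρ := by
    rw [div_lt_iff₀ hρ] at hm
    nlinarith
  unfold rcut'
  rw [st_deriv_zero (Or.inr (by linarith)), st_deriv_zero (x := (j:ℝ) + 1 - ρ) (Or.inr (by linarith))]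
  simp

theorem rcut'_cont (j : ℕ) : Continuous (rcut' j) := by
  have h := (rcut_cd j).continuous_deriv le_rfl
  convert h using 1
  ext ρ
  exact ((rcut_deriv j ρ).deriv).symm

/-- the error term tends to zero -/
theorem err_lim (k : ℕ) (α : ℝ) (hα : 0 < α) :
    Tendsto (fun j => ∫ ρ in Ioi (0:ℝ), ρ ^ (k+1) * (ρ ^ α * Real.exp (-ρ^2/4) * rcut' j ρ) ^ 2) atTop (nhds 0) := by
  obtain ⟨C, hC0, hC⟩ := rcut'_bound
  have key : Tendsto (fun j => ∫ ρ in Ioi (0:ℝ), ρ ^ (k+1) * (ρ ^ α * Real.exp (-ρ^2/4) * rcut' j ρ) ^ 2) atTop (nhds (∫ ρ in Ioi (0:ℝ), (0:ℝ))) := by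
    apply tendsto_integral_of_dominated_convergence
      (fun ρ => C^2 * (8 * (ρ ^ (2*α + k - 1) * Real.exp (-(1/2) * ρ^2)) + 2 * (ρ ^ (2*α+k+1) * Real.exp (-(1/2) * ρ^2))))
    · intro j
      have := rcut'_cont j
      exact (by fun_prop : Measurable _).aestronglyMeasurable
    · have hk : (0:ℝ) ≤ k := Nat.cast_nonneg k
      have i1 : IntegrableOn (fun ρ : ℝ => ρ ^ (2*α + k - 1) * Real.exp (-(1/2) * ρ^2)) (Ioi 0) :=
        integrableOn_rpow_mul_exp_neg_mul_sq (by norm_num) (by linarith)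
      have i2 : IntegrableOn (fun ρ : ℝ => ρ ^ (2*α + k + 1) * Real.exp (-(1/2) * ρ^2)) (Ioi 0) :=
        integrableOn_rpow_mul_exp_neg_mul_sq (by norm_num) (by linarith)
      exact ((i1.const_mul 8).add (i2.const_mul 2)).const_mul _
    · intro j
      filter_upwards [ae_restrict_mem measurableSet_Ioi] with ρ hρ
      have hρ' : (0:ℝ) < ρ := hρ
      have e1 : Real.exp (-ρ^2/4)^2 = Real.exp (-(1/2) * ρ^2) := by
        rw [← Real.exp_nat_mul]; congr 1; push_cast; ring
      have e2 : (ρ ^ α)^2 = ρ ^ (2*α) := by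
        rw [← Real.rpow_natCast, ← Real.rpow_mul hρ'.le]; congr 1; push_cast; ring
      have e3 : ρ ^ (2*α + k + 1) = ρ ^ (2*α) * ρ ^ (k+1) := by
        rw [add_assoc, Real.rpow_add hρ', ← Real.rpow_natCast ρ (k+1)]; push_cast; rfl
      have e4 : ρ ^ (2*α + k - 1) * ρ^2 = ρ ^ (2*α) * ρ ^ (k+1) := by
        rw [← e3, ← Real.rpow_natCast ρ 2, ← Real.rpow_add hρ']; congr 1; push_cast; ring
      have e5 : ρ ^ (2*α + k - 1) = ρ ^ (2*α) * ρ ^ (k+1) / ρ^2 := by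
        rw [← e4]; field_simp
      rw [Real.norm_of_nonneg (by positivity), mul_pow, mul_pow, e1, e2, e3, e5]
      have h2 : rcut' j ρ ^ 2 ≤ C^2 * (8 / ρ^2 + 2) := by
        have h3 := hC j ρ hρ'
        have h4 : rcut' j ρ ^ 2 ≤ (C * (2 / ρ + 1))^2 := by
          rw [← sq_abs]; gcongr
        refine h4.trans ?_
        rw [mul_pow]; gcongr
        have : 8 / ρ^2 = 2 * (2/ρ)^2 := by ring
        rw [this]
        nlinarith [sq_nonneg (2/ρ - 1)]
      calc ρ ^ (k + 1) * (ρ ^ (2 * α) * Real.exp (-(1 / 2) * ρ ^ 2) * rcut' j ρ ^ 2)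
          ≤ ρ ^ (k + 1) * (ρ ^ (2 * α) * Real.exp (-(1 / 2) * ρ ^ 2) * (C^2 * (8 / ρ^2 + 2))) := by gcongr
        _ = _ := by ring
    · filter_upwards [ae_restrict_mem measurableSet_Ioi] with ρ hρ
      have := ((rcut'_lim (ρ := ρ) hρ).const_mul (ρ ^ α * Real.exp (-ρ^2/4))).pow 2 |>.const_mul (ρ ^ (k+1))
      simpa using this
  simpa using key

theorem radial_test (k : ℕ) (α ε : ℝ) (hα : 0 < α) (hε : 0 < ε) :
    ∃ χ : ℝ → ℝ, ContDiff ℝ 1 χ ∧ HasCompactSupport χ ∧ (∃ δ > 0, ∀ ρ ≤ δ, χ ρ = 0) ∧ (∀ ρ, 0 ≤ χ ρ) ∧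
      0 < ∫ ρ in Ioi (0:ℝ), ρ ^ (k+1) * χ ρ ^ 2 ∧
      (∫ ρ in Ioi (0:ℝ), ρ ^ (k+1) * (deriv χ ρ + ρ / 2 * χ ρ)^2) + α * (α + k) * (∫ ρ in Ioi (0:ℝ), ρ ^ (k+1) * (χ ρ / ρ)^2)
        ≤ (α + ε) * ∫ ρ in Ioi (0:ℝ), ρ ^ (k+1) * χ ρ ^ 2 := by
  set c : ℝ := ∫ ρ in Ioc (1:ℝ) 2, Real.exp (-1)^2 with hc
  have hcpos : 0 < c := by rw [hc]; simp; positivity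
  have hev := (err_lim k α hα).eventually (gt_mem_nhds (mul_pos hε hcpos))
  obtain ⟨j, hj, hj2⟩ := (hev.and (eventually_ge_atTop 2)).exists
  have hj0 : 0 < j := by omega
  have hjr : (0:ℝ) < 1 / j := by positivity
  set ω : ℝ → ℝ := fun ρ => ρ ^ α * Real.exp (-ρ^2/4) * rcut' j ρ with hω
  set χ : ℝ → ℝ := fun ρ => ρ ^ α * Real.exp (-ρ^2/4) * rcut j ρ with hχ
  have hz : ∀ ρ ≤ 1 / (j:ℝ), χ ρ = 0 := fun ρ hρ => by
    simp only [hχ]; rw [rcut_zero hj0 (Or.inl hρ), mul_zero]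
  have hcd : ContDiff ℝ 1 χ := by
    rw [contDiff_iff_contDiffAt]
    intro ρ
    by_cases hρ : ρ < 1 / j
    · have : χ =ᶠ[nhds ρ] fun _ => 0 := by
        filter_upwards [Iio_mem_nhds hρ] with y hy using hz y (le_of_lt hy)
      exact contDiffAt_const.congr_of_eventuallyEq this
    · have : 0 < ρ := lt_of_lt_of_le hjr (not_lt.1 hρ)
      refine ContDiffAt.mul (ContDiffAt.mul (Real.contDiffAt_rpow_const_of_ne this.ne') ?_) (rcut_cd j).contDiffAt
      fun_prop
  have hder : ∀ ρ, 0 < ρ → deriv χ ρ = χ ρ * (α / ρ - ρ / 2) + ω ρ := by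
    intro ρ hρ
    have h1 : HasDerivAt (fun ρ : ℝ => ρ ^ α) (α * ρ ^ (α - 1)) ρ := Real.hasDerivAt_rpow_const (Or.inl hρ.ne')
    have h2 : HasDerivAt (fun ρ : ℝ => Real.exp (-ρ^2/4)) (Real.exp (-ρ^2/4) * (-ρ/2)) ρ := by
      have : HasDerivAt (fun ρ : ℝ => -ρ^2/4) (-ρ/2) ρ := by
        have := ((hasDerivAt_pow 2 ρ).neg).div_const 4
        refine this.congr_deriv ?_; push_cast; ring
      exact this.exp
    have h3 := (h1.mul h2).mul (rcut_deriv j ρ)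
    have h4 := h3.deriv
    rw [hχ]
    refine h4.trans ?_
    simp only [hω, Pi.mul_apply]
    rw [Real.rpow_sub_one hρ.ne']
    field_simp
    ring
  have hcs : HasCompactSupport χ := by
    refine HasCompactSupport.intro (isCompact_Icc (a := (0:ℝ)) (b := j + 1)) (fun x hx => ?_)
    simp only [mem_Icc, not_and_or, not_le] at hx
    rcases hx with h | h
    · exact hz x (by linarith)
    · simp only [hχ]; rw [rcut_zero hj0 (Or.inr h.le), mul_zero]
  have hχc : Continuous χ := hcd.continuous
  have hχ'c : Continuous (deriv χ) := hcd.continuous_deriv le_rfl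
  -- integrability
  have hcsm : ∀ F : ℝ → ℝ, Continuous F → (∀ x, χ x = 0 → deriv χ x = 0 → F x = 0) → Integrable F := by
    intro F hF h0
    refine hF.integrable_of_hasCompactSupport ?_
    refine HasCompactSupport.intro (isCompact_Icc (a := (0:ℝ)) (b := j + 1)) (fun x hx => ?_)
    have hx2 : χ =ᶠ[nhds x] fun _ => 0 := by
      simp only [mem_Icc, not_and_or, not_le] at hx
      rcases hx with h | h
      · filter_upwards [Iio_mem_nhds h] with y hy using hz y ((le_of_lt hy).trans hjr.le)
      · filter_upwards [Ioi_mem_nhds h] with y hy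
        simp only [hχ]; rw [rcut_zero hj0 (Or.inr (le_of_lt hy)), mul_zero]
    apply h0 x hx2.self_of_nhds
    rw [hx2.deriv_eq]; simp
  have i1 : IntegrableOn (fun ρ : ℝ => ρ ^ (k+1) * χ ρ ^ 2) (Ioi 0) :=
    (hcsm _ (by fun_prop) (fun x h _ => by simp [h])).integrableOn
  have i2 : IntegrableOn (fun ρ : ℝ => ρ ^ (k+1) * (deriv χ ρ + ρ / 2 * χ ρ) ^ 2) (Ioi 0) :=
    (hcsm _ (by fun_prop) (fun x h h' => by simp [h, h'])).integrableOn
  have i3 : IntegrableOn (fun ρ : ℝ => ρ ^ (k+1) * (χ ρ / ρ) ^ 2) (Ioi 0) := by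
    have : (fun ρ : ℝ => ρ ^ (k+1) * (χ ρ / ρ) ^ 2) = fun ρ : ℝ => ρ ^ (k+1) * (χ ρ / max ρ (1/j)) ^ 2 := by
      ext ρ
      by_cases h : ρ ≤ 1 / j
      · rw [hz ρ h]; simp
      · rw [max_eq_left (not_le.1 h).le]
    rw [this]
    refine (hcsm _ ?_ (fun x h h' => by simp [h])).integrableOn
    have : ∀ x, max x (1 / (j:ℝ)) ≠ 0 := fun x => (lt_of_lt_of_le hjr (le_max_right _ _)).ne'
    fun_prop (disch := assumption)
  have hYd : ∀ ρ, HasDerivAt (fun ρ : ℝ => ρ ^ k * χ ρ ^ 2) ((k * ρ ^ (k-1)) * χ ρ ^ 2 + ρ ^ k * (2 * χ ρ * deriv χ ρ)) ρ := by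
    intro ρ
    have h2 : HasDerivAt χ (deriv χ ρ) ρ := (hcd.differentiable (by simp) ρ).hasDerivAt
    have := (hasDerivAt_pow k ρ).mul (h2.pow 2)
    refine this.congr_deriv ?_
    simp only [Pi.pow_apply]; push_cast; ring
  have i4 : Integrable (fun ρ : ℝ => (k * ρ ^ (k-1)) * χ ρ ^ 2 + ρ ^ k * (2 * χ ρ * deriv χ ρ)) :=
    hcsm _ (by fun_prop) (fun x h h' => by simp [h, h'])
  have i5 : Integrable (fun ρ : ℝ => ρ ^ k * χ ρ ^ 2) := hcsm _ (by fun_prop) (fun x h h' => by simp [h])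
  have hY0 : ∫ ρ in Ioi (0:ℝ), ((k * ρ ^ (k-1)) * χ ρ ^ 2 + ρ ^ k * (2 * χ ρ * deriv χ ρ)) = 0 := by
    refine Eq.trans ?_ (integral_eq_zero_of_hasDerivAt_of_integrable hYd i4 i5)
    apply setIntegral_eq_integral_of_forall_compl_eq_zero
    intro x hx
    have hx' : x ≤ 0 := not_lt.1 hx
    rw [hz x (by linarith)]; simp
  refine ⟨χ, hcd, hcs, ⟨1 / j, hjr, hz⟩, ?_, ?_, ?_⟩
  · intro ρ
    by_cases h : ρ ≤ 1 / j
    · exact (hz ρ h).ge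
    · have : 0 < ρ := lt_trans hjr (not_le.1 h)
      have := rcut_nonneg j ρ
      simp only [hχ]; positivity
  all_goals
    have hlow : c ≤ ∫ ρ in Ioi (0:ℝ), ρ ^ (k+1) * χ ρ ^ 2 := by
      calc c ≤ ∫ ρ in Ioc (1:ℝ) 2, ρ ^ (k+1) * χ ρ ^ 2 := by
            rw [hc]
            apply setIntegral_mono_on (by simp) (i1.mono_set (fun x hx => lt_trans zero_lt_one hx.1)) measurableSet_Ioc
            intro ρ hρ
            have h1 : 1 ≤ ρ := hρ.1.le
            have h3 : 1 ≤ ρ ^ α := Real.one_le_rpow h1 hα.le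
            have h4 : Real.exp (-1) ≤ Real.exp (-ρ^2/4) := by
              apply Real.exp_le_exp.2; nlinarith [hρ.2]
            have h5 : Real.exp (-1) ≤ χ ρ := by
              simp only [hχ]; rw [rcut_one hj2 h1 hρ.2, mul_one]
              nlinarith [Real.exp_pos (-ρ^2/4)]
            have h6 : 1 ≤ ρ ^ (k+1) := one_le_pow₀ h1
            have h7 : Real.exp (-1)^2 ≤ χ ρ ^ 2 := by gcongr
            nlinarith [sq_nonneg (χ ρ)]
        _ ≤ _ := by
            apply setIntegral_mono_set i1
            · filter_upwards [ae_restrict_mem measurableSet_Ioi] with x hx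
              have : (0:ℝ) < x := hx
              show 0 ≤ _
              positivity
            · exact (Eventually.of_forall fun x (hx : x ∈ Ioc (1:ℝ) 2) => lt_trans zero_lt_one hx.1)
  · linarith
  · have hid : ∀ ρ ∈ Ioi (0:ℝ), ρ ^ (k+1) * (ω ρ)^2 = ρ ^ (k+1) * (deriv χ ρ + ρ / 2 * χ ρ)^2 + α * (α + k) * (ρ ^ (k+1) * (χ ρ / ρ)^2)
        - α * ((k * ρ ^ (k-1)) * χ ρ ^ 2 + ρ ^ k * (2 * χ ρ * deriv χ ρ)) - α * (ρ ^ (k+1) * χ ρ ^ 2) := by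
      intro ρ hρ
      have hρ' : (0:ℝ) < ρ := hρ
      rw [hder ρ hρ']
      rcases k with _ | k
      · simp; field_simp; ring
      · simp only [Nat.add_sub_cancel]; field_simp; push_cast; ring
    have hintg : ∫ ρ in Ioi (0:ℝ), ρ ^ (k+1) * (ω ρ)^2 = (∫ ρ in Ioi (0:ℝ), ρ ^ (k+1) * (deriv χ ρ + ρ / 2 * χ ρ)^2) + α * (α + k) * (∫ ρ in Ioi (0:ℝ), ρ ^ (k+1) * (χ ρ / ρ)^2)
        - α * ∫ ρ in Ioi (0:ℝ), ρ ^ (k+1) * χ ρ ^ 2 := by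
      rw [setIntegral_congr_fun measurableSet_Ioi hid, integral_sub, integral_sub, integral_add, integral_const_mul, integral_const_mul, integral_const_mul, hY0]
      · ring
      · exact i2
      · exact i3.const_mul _
      · exact i2.add (i3.const_mul _)
      · exact i4.integrableOn.const_mul _
      · exact (i2.add (i3.const_mul _)).sub (i4.integrableOn.const_mul _)
      · exact i1.const_mul _
    have : ε * c ≤ ε * ∫ ρ in Ioi (0:ℝ), ρ ^ (k+1) * χ ρ ^ 2 := by gcongr
    simp only [hω] at hintg
    linarith
end radial

section lemS
variable {V : Type*} [NormedAddCommGroup V] [InnerProductSpace ℝ V] [FiniteDimensional ℝ V] [MeasurableSpace V] [BorelSpace V]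

theorem norm_hasFDeriv {x : V} (hx : x ≠ 0) : HasFDerivAt (fun y : V => ‖y‖) (innerSL ℝ (‖x‖⁻¹ • x)) x := by
  have h0 : 0 < ‖x‖ := norm_pos_iff.2 hx
  have h1 : HasFDerivAt (fun y : V => ‖y‖ ^ 2) (2 • (innerSL ℝ x)) x := (hasStrictFDerivAt_norm_sq x).hasFDerivAt
  have h2 := h1.sqrt (by positivity)
  have h3 : (fun y : V => Real.sqrt (‖y‖ ^ 2)) = fun y => ‖y‖ := by
    ext y; exact Real.sqrt_sq (norm_nonneg y)
  rw [h3] at h2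
  refine h2.congr_fderiv ?_
  rw [Real.sqrt_sq h0.le]
  ext y
  simp [inner_smul_left]
  field_simp

theorem grad_homog {v : V → ℝ} {χ : ℝ → ℝ} {c : ℝ} {x : V} (hx : x ≠ 0) (hχ : HasDerivAt χ c ‖x‖)
    (hv : DifferentiableAt ℝ v (‖x‖⁻¹ • x)) :
    HasGradientAt (fun y => χ ‖y‖ * v (‖y‖⁻¹ • y))
      ((c * v (‖x‖⁻¹ • x)) • (‖x‖⁻¹ • x) + (χ ‖x‖ / ‖x‖) • (gradient v (‖x‖⁻¹ • x) - ⟪gradient v (‖x‖⁻¹ • x), ‖x‖⁻¹ • x⟫ • (‖x‖⁻¹ • x))) x := by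
  have h0 : 0 < ‖x‖ := norm_pos_iff.2 hx
  have h1 := norm_hasFDeriv hx
  have h2 : HasFDerivAt (fun y : V => ‖y‖⁻¹) (-(‖x‖ ^ 2)⁻¹ • innerSL ℝ (‖x‖⁻¹ • x)) x :=
    (hasDerivAt_inv h0.ne').comp_hasFDerivAt x h1
  have h3 : HasFDerivAt (fun y : V => ‖y‖⁻¹ • y) (‖x‖⁻¹ • ContinuousLinearMap.id ℝ V + (-(‖x‖ ^ 2)⁻¹ • (innerSL ℝ) (‖x‖⁻¹ • x)).smulRight x) x :=
    h2.smul (hasFDerivAt_id x)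
  have h4 := HasFDerivAt.comp (g := v) (f := fun y : V => ‖y‖⁻¹ • y) x hv.hasFDerivAt h3
  have h5 := hχ.comp_hasFDerivAt x h1
  have h6 := h5.mul h4
  rw [hasGradientAt_iff_hasFDerivAt]
  refine HasFDerivAt.congr_fderiv h6 ?_
  ext y
  simp only [ContinuousLinearMap.add_apply, ContinuousLinearMap.smul_apply, ContinuousLinearMap.comp_apply, ContinuousLinearMap.smulRight_apply, InnerProductSpace.toDual_apply_apply, ← grad_inner, Function.comp, inner_add_left, inner_add_right, inner_sub_left, inner_smul_left, inner_smul_right, innerSL_apply_apply, ContinuousLinearMap.id_apply, smul_eq_mul]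
  simp
  field_simp
  ring

/-- tangential energy density -/
def tang (v : V → ℝ) (θ : V) : ℝ := ‖gradient v θ‖ ^ 2 - ⟪gradient v θ, θ⟫ ^ 2

theorem tang_meas (v : V → ℝ) : Measurable (tang v) := by
  have := grad_meas v
  unfold tang; fun_prop

theorem tang_nonneg (v : V → ℝ) {θ : V} (h : ‖θ‖ = 1) : 0 ≤ tang v θ := by
  have := abs_real_inner_le_norm (gradient v θ) θ
  rw [h, mul_one] at this
  have := sq_le_sq' (by linarith [abs_le.1 this]) (abs_le.1 this).2
  unfold tang; linarith

theorem grad_homog_sq {v : V → ℝ} {a b : ℝ} {ω : V} (h : ‖ω‖ = 1) :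
    ‖(a * v ω) • ω + b • (gradient v ω - ⟪gradient v ω, ω⟫ • ω)‖ ^ 2 = a ^ 2 * v ω ^ 2 + b ^ 2 * tang v ω := by
  have h1 : ⟪ω, ω⟫ = 1 := by rw [real_inner_self_eq_norm_sq, h]; norm_num
  rw [← real_inner_self_eq_norm_sq, tang, ← real_inner_self_eq_norm_sq]
  simp only [inner_add_left, inner_add_right, inner_sub_left, inner_sub_right, inner_smul_left, inner_smul_right, h1, real_inner_comm ω (gradient v ω)]
  simp only [conj_trivial]
  ring

theorem unit_of_ne {x : V} (hx : x ≠ 0) : ‖‖x‖⁻¹ • x‖ = 1 := by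
  simp [norm_smul, hx]

theorem proj_lip {δ : ℝ} (hδ : 0 < δ) (x y : V) :
    ‖(max ‖x‖ δ)⁻¹ • x - (max ‖y‖ δ)⁻¹ • y‖ ≤ 2 / δ * ‖x - y‖ := by
  set a := max ‖x‖ δ with ha
  set b := max ‖y‖ δ with hb
  have a0 : δ ≤ a := le_max_right _ _
  have b0 : δ ≤ b := le_max_right _ _
  have yb : ‖y‖ ≤ b := le_max_left _ _
  have ap : 0 < a := hδ.trans_le a0
  have bp : 0 < b := hδ.trans_le b0
  have hab : |b - a| ≤ ‖x - y‖ := by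
    rw [ha, hb]
    have := abs_max_sub_max_le_abs ‖y‖ ‖x‖ δ
    refine this.trans ?_
    rw [abs_sub_comm]; exact abs_norm_sub_norm_le x y
  have e : a⁻¹ • x - b⁻¹ • y = a⁻¹ • (x - y) + (a⁻¹ - b⁻¹) • y := by
    rw [smul_sub, sub_smul]; abel
  rw [e]
  refine (norm_add_le _ _).trans ?_
  rw [norm_smul, norm_smul, Real.norm_of_nonneg (by positivity), Real.norm_eq_abs]
  have h1 : a⁻¹ - b⁻¹ = (b - a) / (a * b) := by field_simp
  have h2 : |a⁻¹ - b⁻¹| * ‖y‖ ≤ ‖x - y‖ / δ := by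
    rw [h1, abs_div, abs_of_pos (by positivity : 0 < a * b), div_mul_eq_mul_div, div_le_div_iff₀ (by positivity) hδ]
    have : |b - a| * ‖y‖ ≤ ‖x - y‖ * b := by gcongr
    nlinarith [norm_nonneg (x - y), mul_nonneg (norm_nonneg (x-y)) bp.le]
  have h3 : a⁻¹ * ‖x - y‖ ≤ ‖x - y‖ / δ := by
    rw [div_eq_inv_mul]; gcongr
  calc _ ≤ ‖x - y‖ / δ + ‖x - y‖ / δ := add_le_add h3 h2
    _ = _ := by ring

theorem lip_mul_bdd {f g : V → ℝ} {K L : ℝ≥0} {A B : ℝ} (hf : LipschitzWith K f) (hg : LipschitzWith L g)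
    (hA : ∀ x, |f x| ≤ A) (hB : ∀ x, |g x| ≤ B) : ∃ M : ℝ≥0, LipschitzWith M (fun x => f x * g x) := by
  have hA0 : 0 ≤ A := (abs_nonneg _).trans (hA 0)
  have hB0 : 0 ≤ B := (abs_nonneg _).trans (hB 0)
  refine ⟨(K * B + L * A).toNNReal, LipschitzWith.of_dist_le_mul fun x y => ?_⟩
  rw [Real.coe_toNNReal _ (by positivity), Real.dist_eq]
  have h1 := hf.dist_le_mul x y
  have h2 := hg.dist_le_mul x y
  rw [Real.dist_eq] at h1 h2
  have e : f x * g x - f y * g y = (f x - f y) * g x + f y * (g x - g y) := by ring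
  rw [e]
  refine (abs_add_le _ _).trans ?_
  rw [abs_mul, abs_mul]
  calc _ ≤ (K * dist x y) * B + A * (L * dist x y) := by
        gcongr
        · exact hB x
        · exact hA y
    _ = _ := by ring

theorem homog_lip {v : V → ℝ} {K : ℝ≥0} (hv : LipschitzWith K v) {χ : ℝ → ℝ} (hχ : ContDiff ℝ 1 χ) (hs : HasCompactSupport χ)
    {δ : ℝ} (hδ : 0 < δ) (hz : ∀ ρ ≤ δ, χ ρ = 0) :
    ∃ M : ℝ≥0, LipschitzWith M (fun y : V => χ ‖y‖ * v (‖y‖⁻¹ • y)) := by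
  have e : (fun y : V => χ ‖y‖ * v (‖y‖⁻¹ • y)) = fun y => χ ‖y‖ * v ((max ‖y‖ δ)⁻¹ • y) := by
    ext y
    by_cases h : ‖y‖ ≤ δ
    · rw [hz _ h]; simp
    · rw [max_eq_left (not_le.1 h).le]
  rw [e]
  obtain ⟨L, hL⟩ := hχ.lipschitzWith_of_hasCompactSupport hs (by simp)
  obtain ⟨A, hA⟩ := hχ.continuous.bounded_above_of_compact_support hs
  have hP : LipschitzWith (2 / δ).toNNReal (fun y : V => (max ‖y‖ δ)⁻¹ • y) :=
    LipschitzWith.of_dist_le_mul fun x y => by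
      rw [Real.coe_toNNReal _ (by positivity), dist_eq_norm, dist_eq_norm]; exact proj_lip hδ x y
  refine lip_mul_bdd (hL.comp lipschitzWith_one_norm) (hv.comp hP) (A := A) (B := |v 0| + K) (fun x => hA _) (fun x => ?_)
  set z := (max ‖x‖ δ)⁻¹ • x
  have hz1 : ‖z‖ ≤ 1 := by
    have : 0 < max ‖x‖ δ := lt_of_lt_of_le hδ (le_max_right _ _)
    simp only [z]
    rw [norm_smul, Real.norm_of_nonneg (by positivity), inv_mul_le_iff₀ this, mul_one]
    exact le_max_left _ _
  have h1 := hv.dist_le_mul z 0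
  rw [Real.dist_eq, dist_zero_right] at h1
  have h2 : |v z| ≤ |v 0| + |v z - v 0| := by
    have := abs_add_le (v 0) (v z - v 0); simpa using this
  show |v z| ≤ _
  have : (K:ℝ) * ‖z‖ ≤ K * 1 := by gcongr
  linarith

theorem homog_cs {χ : ℝ → ℝ} (hs : HasCompactSupport χ) (v : V → ℝ) :
    HasCompactSupport (fun y : V => χ ‖y‖ * v (‖y‖⁻¹ • y)) := by
  obtain ⟨M, hM⟩ := hs.isCompact.isBounded.subset_closedBall (0:ℝ)
  refine HasCompactSupport.intro (isCompact_closedBall (0:V) M) (fun x hx => ?_)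
  have : χ ‖x‖ = 0 := by
    by_contra h
    have := hM (subset_tsupport _ h)
    simp at this hx
    linarith
  rw [this, zero_mul]

/-- the energy of the radial extension -/
theorem homog_energy [Nontrivial V] {v : V → ℝ} (hvm : Continuous v) (hd : ∀ᵐ θ : sphere (0:V) 1 ∂sgm V, DifferentiableAt ℝ v θ)
    {χ : ℝ → ℝ} (hχ : ContDiff ℝ 1 χ)
    (i1 : Integrable (fun x : V => (deriv χ ‖x‖ + ‖x‖ / 2 * χ ‖x‖) ^ 2 * v (‖x‖⁻¹ • x) ^ 2))
    (i2 : Integrable (fun x : V => (χ ‖x‖ / ‖x‖) ^ 2 * tang v (‖x‖⁻¹ • x))) :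
    ∫ x : V, ‖gradient (fun y => χ ‖y‖ * v (‖y‖⁻¹ • y)) x + ((χ ‖x‖ * v (‖x‖⁻¹ • x)) / 2) • x‖ ^ 2 =
      (∫ ρ in Ioi (0:ℝ), ρ ^ (Module.finrank ℝ V - 1) * (deriv χ ρ + ρ / 2 * χ ρ)^2) * (∫ θ, v θ ^ 2 ∂sgm V)
      + (∫ ρ in Ioi (0:ℝ), ρ ^ (Module.finrank ℝ V - 1) * (χ ρ / ρ)^2) * (∫ θ, tang v θ ∂sgm V) := by
  have hχ' : Continuous (deriv χ) := hχ.continuous_deriv le_rfl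
  have hχc := hχ.continuous
  have htm := tang_meas v
  rw [← pol_prod (fun ρ => (deriv χ ρ + ρ / 2 * χ ρ)^2) (fun x => v x ^ 2) (by fun_prop) (by fun_prop),
    ← pol_prod (fun ρ => (χ ρ / ρ)^2) (tang v) (by fun_prop) htm, ← integral_add i1 i2]
  refine integral_congr_ae ?_
  filter_upwards [pol_ae_ray hd, compl_mem_ae_iff.2 (measure_singleton (0:V))] with x hx hx0
  have hx0' : x ≠ 0 := hx0
  have hn : 0 < ‖x‖ := norm_pos_iff.2 hx0'
  rw [(grad_homog hx0' (hχ.differentiable (by simp) ‖x‖).hasDerivAt hx).gradient, ← grad_homog_sq (unit_of_ne hx0')]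
  congr 2
  rw [add_right_comm]
  congr 1
  rw [smul_smul, smul_smul, ← add_smul]
  congr 1
  field_simp

end lemS

section lemS2
variable {V : Type*} [NormedAddCommGroup V] [InnerProductSpace ℝ V] [FiniteDimensional ℝ V] [MeasurableSpace V] [BorelSpace V]

theorem radial_test' (k : ℕ) (α ε m : ℝ) (hα : 0 < α) (hε : 0 < ε) (hm : 0 < m) :
    ∃ χ : ℝ → ℝ, ContDiff ℝ 1 χ ∧ HasCompactSupport χ ∧ (∃ δ > 0, ∀ ρ ≤ δ, χ ρ = 0) ∧ (∀ ρ, 0 ≤ χ ρ) ∧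
      (∫ ρ in Ioi (0:ℝ), ρ ^ (k+1) * χ ρ ^ 2) = m ∧
      (∫ ρ in Ioi (0:ℝ), ρ ^ (k+1) * (deriv χ ρ + ρ / 2 * χ ρ)^2) + α * (α + k) * (∫ ρ in Ioi (0:ℝ), ρ ^ (k+1) * (χ ρ / ρ)^2)
        ≤ (α + ε) * m := by
  obtain ⟨χ, h1, h2, ⟨δ, hδ, h3⟩, h4, h5, h6⟩ := radial_test k α ε hα hε
  set I := ∫ ρ in Ioi (0:ℝ), ρ ^ (k+1) * χ ρ ^ 2 with hI
  set c := Real.sqrt (m / I) with hc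
  have hc2 : c ^ 2 = m / I := Real.sq_sqrt (by positivity)
  have hdc : ∀ ρ, deriv (fun ρ => c * χ ρ) ρ = c * deriv χ ρ := fun ρ =>
    deriv_const_mul _ (h1.differentiable (by simp) ρ)
  refine ⟨fun ρ => c * χ ρ, contDiff_const.mul h1, h2.mul_left, ⟨δ, hδ, fun ρ hρ => by simp [h3 ρ hρ]⟩,
    fun ρ => mul_nonneg (Real.sqrt_nonneg _) (h4 ρ), ?_, ?_⟩
  · have : (fun ρ : ℝ => ρ ^ (k+1) * (c * χ ρ) ^ 2) = fun ρ => c ^ 2 * (ρ ^ (k+1) * χ ρ ^ 2) := by ext; ring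
    rw [this, integral_const_mul, hc2, ← hI]; field_simp
  · have e1 : (fun ρ : ℝ => ρ ^ (k+1) * (deriv (fun ρ => c * χ ρ) ρ + ρ / 2 * (c * χ ρ)) ^ 2) = fun ρ => c ^ 2 * (ρ ^ (k+1) * (deriv χ ρ + ρ / 2 * χ ρ) ^ 2) := by
      ext; rw [hdc]; ring
    have e2 : (fun ρ : ℝ => ρ ^ (k+1) * (c * χ ρ / ρ) ^ 2) = fun ρ => c ^ 2 * (ρ ^ (k+1) * (χ ρ / ρ) ^ 2) := by ext; ring
    rw [e1, e2, integral_const_mul, integral_const_mul]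
    have := mul_le_mul_of_nonneg_left h6 (sq_nonneg c)
    have e3 : c ^ 2 * ((α + ε) * I) = (α + ε) * m := by rw [hc2]; field_simp
    linarith

theorem bdd_ball_int {F : V → ℝ} (hF : Measurable F) {C M : ℝ} (hC : ∀ x, |F x| ≤ C) (hM : ∀ x, M < ‖x‖ → F x = 0) : Integrable F := by
  have h1 : IntegrableOn F (closedBall 0 M) :=
    Measure.integrableOn_of_bounded (M := C) (measure_closedBall_lt_top).ne hF.aestronglyMeasurable (ae_of_all _ hC)
  exact (integrableOn_iff_integrable_of_support_subset (fun x hx => by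
    by_contra h
    simp at h
    exact hx (hM x h))).1 h1

theorem test_fn [Nontrivial V] {k : ℕ} (hN : Module.finrank ℝ V = k + 2) {v : V → ℝ} {K : ℝ≥0} (hv : LipschitzWith K v)
    (hv0 : ∀ x, 0 ≤ v x) (hd : ∀ᵐ θ : sphere (0:V) 1 ∂sgm V, DifferentiableAt ℝ v θ)
    (hH : 0 < ∫ θ, v θ ^ 2 ∂sgm V) {α ε : ℝ} (hα : 0 < α) (hε : 0 < ε)
    (hT : ∫ θ, tang v θ ∂sgm V ≤ α * (α + k) * ∫ θ, v θ ^ 2 ∂sgm V) :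
    ∃ (q : V → ℝ) (L : ℝ≥0), LipschitzWith L q ∧ HasCompactSupport q ∧ (∀ x, 0 ≤ q x) ∧ (∀ x, v (‖x‖⁻¹ • x) = 0 → q x = 0) ∧
      ∫ x, q x ^ 2 = 1 ∧ ∫ x, ‖gradient q x + (q x / 2) • x‖ ^ 2 ≤ α + ε := by
  set H := ∫ θ, v θ ^ 2 ∂sgm V with hHd
  set T := ∫ θ, tang v θ ∂sgm V with hTd
  obtain ⟨χ, h1, h2, ⟨δ, hδ, h3⟩, h4, h5, h6⟩ := radial_test' k α ε (1 / H) hα hε (by positivity)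
  obtain ⟨L, hL⟩ := homog_lip hv h1 h2 hδ h3
  have hN1 : Module.finrank ℝ V - 1 = k + 1 := by omega
  have hvc := hv.continuous
  have hχ' : Continuous (deriv χ) := h1.continuous_deriv le_rfl
  have hχc := h1.continuous
  have htm := tang_meas v
  obtain ⟨R, hR⟩ := h2.isCompact.isBounded.subset_closedBall (0:ℝ)
  have hχR : ∀ x : V, R < ‖x‖ → χ ‖x‖ = 0 ∧ deriv χ ‖x‖ = 0 := by
    intro x hx
    have hx2 : ‖x‖ ∉ tsupport χ := fun h => by
      have := hR h
      simp at this; linarith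
    refine ⟨image_eq_zero_of_notMem_tsupport hx2, ?_⟩
    have : χ =ᶠ[nhds ‖x‖] fun _ => 0 := notMem_tsupport_iff_eventuallyEq.1 hx2
    rw [this.deriv_eq]; simp
  obtain ⟨A, hA⟩ := h1.continuous.bounded_above_of_compact_support h2
  have hA0 : 0 ≤ A := (norm_nonneg _).trans (hA 0)
  have hg2c : Continuous (fun ρ : ℝ => deriv χ ρ + ρ / 2 * χ ρ) := by fun_prop
  obtain ⟨A', hA'⟩ := hg2c.bounded_above_of_compact_support (h2.deriv.add (h2.mul_left))
  have hA'0 : 0 ≤ A' := (norm_nonneg _).trans (hA' 0)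
  have hun : ∀ x : V, ‖‖x‖⁻¹ • x‖ ≤ 1 := by
    intro x
    by_cases hx : x = 0
    · simp [hx]
    · exact (unit_of_ne hx).le
  have hvb : ∀ x : V, |v (‖x‖⁻¹ • x)| ≤ |v 0| + K := by
    intro x
    have h1 := hv.dist_le_mul (‖x‖⁻¹ • x) 0
    rw [Real.dist_eq, dist_zero_right] at h1
    have h2 : |v (‖x‖⁻¹ • x)| ≤ |v 0| + |v (‖x‖⁻¹ • x) - v 0| := by
      have := abs_add_le (v 0) (v (‖x‖⁻¹ • x) - v 0); simpa using this
    have : (K:ℝ) * ‖‖x‖⁻¹ • x‖ ≤ K * 1 := by gcongr; exact hun x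
    linarith
  have htb : ∀ x : V, |tang v (‖x‖⁻¹ • x)| ≤ 2 * K ^ 2 := by
    intro x
    set ω := ‖x‖⁻¹ • x
    have g1 := grad_norm_le hv ω
    have g2 := abs_real_inner_le_norm (gradient v ω) ω
    have g3 : |⟪gradient v ω, ω⟫| ≤ K := by
      refine g2.trans ?_
      calc _ ≤ (K:ℝ) * 1 := by gcongr; exact hun x
        _ = K := mul_one _
    have g4 : ⟪gradient v ω, ω⟫ ^ 2 ≤ K ^ 2 := by rw [← sq_abs]; gcongr
    have g5 : ‖gradient v ω‖ ^ 2 ≤ K ^ 2 := by gcongr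
    unfold tang
    rw [abs_le]; constructor <;> nlinarith [sq_nonneg ‖gradient v ω‖, sq_nonneg ⟪gradient v ω, ω⟫]
  have i1 : Integrable (fun x : V => (deriv χ ‖x‖ + ‖x‖ / 2 * χ ‖x‖) ^ 2 * v (‖x‖⁻¹ • x) ^ 2) := by
    refine bdd_ball_int (by fun_prop) (C := A' ^ 2 * (|v 0| + K) ^ 2) (M := R) (fun x => ?_) (fun x hx => ?_)
    · rw [abs_mul, abs_pow, abs_pow]
      gcongr
      · exact hA' _
      · exact hvb x
    · simp [(hχR x hx).1, (hχR x hx).2]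
  have i2 : Integrable (fun x : V => (χ ‖x‖ / ‖x‖) ^ 2 * tang v (‖x‖⁻¹ • x)) := by
    refine bdd_ball_int (by fun_prop) (C := (A / δ) ^ 2 * (2 * K ^ 2)) (M := R) (fun x => ?_) (fun x hx => ?_)
    · rw [abs_mul, abs_pow]
      gcongr
      · by_cases hx : ‖x‖ ≤ δ
        · rw [h3 _ hx]; simp; positivity
        · have : δ < ‖x‖ := not_le.1 hx
          rw [abs_div, abs_of_nonneg (norm_nonneg x)]
          gcongr
          exact hA _
      · exact htb x
    · simp [(hχR x hx).1]
  refine ⟨_, L, hL, homog_cs h2 v, fun x => mul_nonneg (h4 _) (hv0 _), fun x hx => by rw [hx, mul_zero], ?_, ?_⟩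
  · have e : (fun x : V => (χ ‖x‖ * v (‖x‖⁻¹ • x)) ^ 2) = fun x => (fun ρ => χ ρ ^ 2) ‖x‖ * (fun z => v z ^ 2) (‖x‖⁻¹ • x) := by
      ext; ring
    rw [e, pol_prod (fun ρ => χ ρ ^ 2) (fun z => v z ^ 2) (by fun_prop) (by fun_prop), hN1, h5]
    field_simp
    rw [hHd]
  · rw [homog_energy hvc hd h1 i1 i2, hN1, ← hHd, ← hTd]
    have hJ : 0 ≤ ∫ ρ in Ioi (0:ℝ), ρ ^ (k+1) * (χ ρ / ρ)^2 := by
      apply setIntegral_nonneg measurableSet_Ioi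
      intro ρ hρ
      have : (0:ℝ) < ρ := hρ
      positivity
    have := mul_le_mul_of_nonneg_left hT hJ
    have h7 := mul_le_mul_of_nonneg_right h6 hH.le
    have : (α + ε) * (1 / H) * H = α + ε := by field_simp
    nlinarith

theorem lemS [Nontrivial V] {k : ℕ} (hN : Module.finrank ℝ V = k + 2) {v w : V → ℝ} {K : ℝ≥0} (hv : LipschitzWith K v) (hw : LipschitzWith K w)
    (hv0 : ∀ x, 0 ≤ v x) (hw0 : ∀ x, 0 ≤ w x) (hvw : ∀ x, v x * w x = 0)
    (hdv : ∀ᵐ θ : sphere (0:V) 1 ∂sgm V, DifferentiableAt ℝ v θ) (hdw : ∀ᵐ θ : sphere (0:V) 1 ∂sgm V, DifferentiableAt ℝ w θ)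
    (hHv : 0 < ∫ θ, v θ ^ 2 ∂sgm V) (hHw : 0 < ∫ θ, w θ ^ 2 ∂sgm V) {α β t : ℝ} (hα : 0 ≤ α) (hβ : 0 ≤ β) (ht : 0 < t)
    (hTv : ∫ θ, tang v θ ∂sgm V ≤ α * (α + k) * ∫ θ, v θ ^ 2 ∂sgm V)
    (hTw : ∫ θ, tang w θ ∂sgm V ≤ β * (β + k) * ∫ θ, w θ ^ 2 ∂sgm V) :
    4 ≤ (1 + t) * α + (1 + 1 / t) * β := by
  have hk : (0:ℝ) ≤ k := Nat.cast_nonneg k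
  have key : ∀ ε > 0, 4 ≤ (1 + t) * α + (1 + 1 / t) * β + ((1 + t) * 2 + (1 + 1/t) * 2) * ε := by
    intro ε hε
    have mono : ∀ a : ℝ, 0 ≤ a → a * (a + k) ≤ (a + ε) * (a + ε + k) := fun a ha => by nlinarith [mul_nonneg ha hε.le, mul_nonneg hk hε.le]
    obtain ⟨q, L, q1, q2, q3, q4, q5, q6⟩ := test_fn hN hv hv0 hdv hHv (α := α + ε) (by linarith) hε
      (hTv.trans (mul_le_mul_of_nonneg_right (mono α hα) hHv.le))
    obtain ⟨p, L', p1, p2, p3, p4, p5, p6⟩ := test_fn hN hw hw0 hdw hHw (α := β + ε) (by linarith) hε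
      (hTw.trans (mul_le_mul_of_nonneg_right (mono β hβ) hHw.le))
    have := ot_main q p (L + L' + 1) (by positivity) (q1.weaken (by rw [add_assoc]; exact le_self_add)) (p1.weaken (by rw [add_comm L, add_assoc]; exact le_self_add)) q2 p2 q3 p3
      (fun x => by
        rcases mul_eq_zero.1 (hvw (‖x‖⁻¹ • x)) with h | h
        · rw [q4 x h, zero_mul]
        · rw [p4 x h, mul_zero]) q5 p5 t ht
    have e1 := mul_le_mul_of_nonneg_left q6 (by positivity : 0 ≤ 1 + t)
    have e2 := mul_le_mul_of_nonneg_left p6 (by positivity : 0 ≤ 1 + 1 / t)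
    linarith
  by_contra hcon
  push_neg at hcon
  set c := (1 + t) * 2 + (1 + 1/t) * 2
  have hc : 0 < c := by positivity
  have := key ((4 - ((1 + t) * α + (1 + 1 / t) * β)) / (2 * c)) (div_pos (by linarith) (by positivity))
  have e : c * ((4 - ((1 + t) * α + (1 + 1 / t) * β)) / (2 * c)) = (4 - ((1 + t) * α + (1 + 1 / t) * β)) / 2 := by field_simp
  linarith
end lemS2

section lemA
variable {V : Type*} [NormedAddCommGroup V] [InnerProductSpace ℝ V] [FiniteDimensional ℝ V] [MeasurableSpace V] [BorelSpace V]

theorem const_of_grad_zero {f : V → ℝ} {K : ℝ≥0} (hf : LipschitzWith K f) {R : ℝ}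
    (h : ∀ᵐ x : V, x ∈ ball (0:V) R → gradient f x = 0) : ∀ x ∈ ball (0:V) R, f x = f 0 := by
  intro v hv
  have hvR : ‖v‖ < R := by simpa using hv
  set S : Set V := {x | x ∈ ball (0:V) R → (DifferentiableAt ℝ f x ∧ gradient f x = 0)} with hS
  have hSm : MeasurableSet S := by
    have : S = (ball (0:V) R)ᶜ ∪ ({x | DifferentiableAt ℝ f x} ∩ {x | gradient f x = 0}) := by
      ext x; simp only [hS, mem_setOf_eq, mem_union, mem_compl_iff, mem_inter_iff]; tauto
    rw [this]
    exact measurableSet_ball.compl.union ((measurableSet_of_differentiableAt ℝ f).inter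
      ((grad_meas f) (measurableSet_singleton (0:V))))
  have hP : ∀ᵐ x : V, x ∈ S := by
    filter_upwards [h, hf.ae_differentiableAt] with x h1 h2 h3 using ⟨h2, h1 h3⟩
  have h1 : ∀ᵐ t : ℝ, ∀ᵐ x : V, x + t • v ∈ S := by
    refine Eventually.of_forall fun t => ?_
    exact (measurePreserving_add_right volume (t • v)).quasiMeasurePreserving.ae hP
  have h2 : ∀ᵐ x : V, ∀ᵐ t : ℝ, x + t • v ∈ S := by
    refine (Measure.ae_ae_comm (p := fun (t : ℝ) (x : V) => x + t • v ∈ S) ?_).1 h1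
    have : Measurable fun z : ℝ × V => z.2 + z.1 • v := by fun_prop
    exact this hSm
  have h3 : ∀ᵐ x : V, x ∈ ball (0:V) (R - ‖v‖) → f (x + v) = f x := by
    filter_upwards [h2] with x hx hxb
    have hxb' : ‖x‖ < R - ‖v‖ := by simpa using hxb
    have hl : LipschitzWith (K * ‖v‖₊) (fun t : ℝ => f (x + t • v)) := by
      refine hf.comp (f := f) (g := fun t : ℝ => x + t • v) ?_
      refine LipschitzWith.of_dist_le_mul fun s t => ?_
      rw [dist_add_left, dist_eq_norm, ← sub_smul, norm_smul, Real.dist_eq, coe_nnnorm, mul_comm, Real.norm_eq_abs]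
    obtain ⟨C, hC⟩ := AbsolutelyContinuousOnInterval.const_of_ae_hasDerivAt_zero (f := fun t : ℝ => f (x + t • v)) (a := 0) (b := 1)
      (hl.lipschitzOnWith).absolutelyContinuousOnInterval (by
        filter_upwards [hx] with t ht ht1
        rw [uIcc_of_le zero_le_one] at ht1
        have hm : x + t • v ∈ ball (0:V) R := by
          rw [mem_ball_zero_iff]
          calc ‖x + t • v‖ ≤ ‖x‖ + |t| * ‖v‖ := (norm_add_le _ _).trans (by rw [norm_smul, Real.norm_eq_abs])
            _ ≤ ‖x‖ + 1 * ‖v‖ := by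
              gcongr; rw [abs_of_nonneg ht1.1]; exact ht1.2
            _ < R := by linarith
        obtain ⟨hd, hg⟩ := ht hm
        have hd2 := hd.hasGradientAt.hasFDerivAt
        rw [hg] at hd2
        have hd3 : HasDerivAt (fun t : ℝ => x + t • v) v t := by
          simpa using ((hasDerivAt_id t).smul_const v).const_add x
        have := hd2.comp_hasDerivAt t hd3
        simpa [Function.comp_def] using this)
    have e0 := hC 0 (by simp)
    have e1 := hC 1 (by simp)
    simp at e0 e1
    rw [e0, e1]
  -- density
  have hd : Dense {x : V | x ∈ ball (0:V) (R - ‖v‖) → f (x + v) = f x} := Measure.dense_of_ae h3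
  have hcl : (0:V) ∈ closure {x : V | f (x + v) = f x} := by
    rw [Metric.mem_closure_iff]
    intro ε hε
    obtain ⟨y, hy, hy2⟩ := hd.exists_dist_lt (0:V) (ε := min ε (R - ‖v‖)) (lt_min hε (by linarith))
    refine ⟨y, hy ?_, hy2.trans_le (min_le_left _ _)⟩
    rw [mem_ball, dist_comm]; exact hy2.trans_le (min_le_right _ _)
  have hcl2 : IsClosed {x : V | f (x + v) = f x} :=
    isClosed_eq (hf.continuous.comp (by fun_prop)) hf.continuous
  have := hcl2.closure_subset hcl
  simpa using this
end lemA

section gauss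
variable {V : Type*} [NormedAddCommGroup V] [InnerProductSpace ℝ V] [FiniteDimensional ℝ V] [MeasurableSpace V] [BorelSpace V]

def gp (x : V) : ℝ := Real.exp (-(‖x‖ ^ 2 / 2))
def gc (V : Type*) [NormedAddCommGroup V] [InnerProductSpace ℝ V] [FiniteDimensional ℝ V] [MeasurableSpace V] [BorelSpace V] : ℝ :=
  (∫ x : V, gp x)⁻¹

abbrev gam (V : Type*) [NormedAddCommGroup V] [InnerProductSpace ℝ V] [FiniteDimensional ℝ V] [MeasurableSpace V] [BorelSpace V] : Measure V :=
  ProbabilityTheory.stdGaussian V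

theorem gp_cont : Continuous (gp : V → ℝ) := by unfold gp; fun_prop
theorem gp_pos (x : V) : 0 < gp x := Real.exp_pos _
theorem gp_le (x : V) : gp x ≤ 1 := Real.exp_le_one_iff.2 (by have := sq_nonneg ‖x‖; linarith)

theorem gp_int_eq : ∫ x : V, gp x = (2 * Real.pi) ^ ((Module.finrank ℝ V : ℝ) / 2) := by
  have h := GaussianFourier.integral_rexp_neg_mul_sq_norm (V := V) (b := 1/2) (by norm_num)
  rw [show Real.pi / (1/2) = 2 * Real.pi by ring] at h
  rw [← h]; congr 1; ext x; unfold gp; congr 1; ring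

theorem gc_pos : 0 < gc V := by
  unfold gc; rw [gp_int_eq]; positivity

theorem gp_cexp (t : V) : ∫ v : V, (gp v : ℂ) * Complex.exp (⟪v, t⟫ * Complex.I) = (∫ x : V, gp x : ℝ) * Complex.exp (-‖t‖^2/2) := by
  have h := GaussianFourier.integral_cexp_neg_mul_sq_norm_add (V := V) (b := (1/2 : ℂ)) (by norm_num) Complex.I t
  rw [gp_int_eq]
  have e1 : (((2 * Real.pi) ^ ((Module.finrank ℝ V : ℝ) / 2) : ℝ) : ℂ) = ((Real.pi : ℂ) / (1/2)) ^ ((Module.finrank ℝ V : ℂ) / 2) := by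
    rw [Complex.ofReal_cpow (by positivity)]
    push_cast
    congr 1; ring
  rw [e1]
  have e2 : Complex.exp (-(‖t‖:ℂ)^2/2) = Complex.exp (Complex.I ^ 2 * (‖t‖:ℂ)^2 / (4 * (1/2))) := by
    congr 1; rw [Complex.I_sq]; ring
  rw [e2, ← h]
  congr 1; ext v
  unfold gp
  push_cast
  rw [← Complex.exp_add]
  congr 1
  rw [real_inner_comm]; ring

theorem gp_integrable : Integrable (gp : V → ℝ) := by
  by_contra h
  have h1 := integral_undef h
  have := gc_pos (V := V)
  unfold gc at this
  rw [h1] at this; simp at this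

theorem gam_eq : gam V = volume.withDensity (fun x => ENNReal.ofReal (gc V * gp x)) := by
  have hm : Measurable (fun x : V => ENNReal.ofReal (gc V * gp x)) := by
    have := gp_cont (V := V)
    fun_prop
  have hfin : IsFiniteMeasure ((volume : Measure V).withDensity (fun x => ENNReal.ofReal (gc V * gp x))) :=
    isFiniteMeasure_withDensity_ofReal ((gp_integrable.const_mul _).2)
  apply Measure.ext_of_charFun
  ext t
  rw [ProbabilityTheory.charFun_stdGaussian, charFun_apply,
    integral_withDensity_eq_integral_toReal_smul hm (Eventually.of_forall fun x => ENNReal.ofReal_lt_top)]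
  have e : (fun x : V => (ENNReal.ofReal (gc V * gp x)).toReal • Complex.exp (⟪x, t⟫ * Complex.I)) =
      fun x : V => (gc V : ℂ) * ((gp x : ℂ) * Complex.exp (⟪x, t⟫ * Complex.I)) := by
    ext x
    rw [ENNReal.toReal_ofReal (mul_pos gc_pos (gp_pos x)).le, Complex.real_smul]
    push_cast; ring
  rw [e, integral_const_mul, gp_cexp, ← mul_assoc, ← Complex.ofReal_mul]
  have : gc V * ∫ x : V, gp x = 1 := by
    unfold gc; exact inv_mul_cancel₀ (by rw [gp_int_eq]; positivity)
  rw [this]; simp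

theorem gam_meas : Measurable (fun x : V => ENNReal.ofReal (gc V * gp x)) := by
    have := gp_cont (V := V)
    fun_prop

theorem gam_int (f : V → ℝ) : ∫ x, f x ∂gam V = gc V * ∫ x, gp x * f x := by
  rw [gam_eq, integral_withDensity_eq_integral_toReal_smul gam_meas (Eventually.of_forall fun x => ENNReal.ofReal_lt_top),
    ← integral_const_mul]
  congr 1; ext x
  rw [ENNReal.toReal_ofReal (mul_pos gc_pos (gp_pos x)).le, smul_eq_mul, mul_assoc]

theorem gam_integrable {f : V → ℝ} (h : Integrable f (gam V)) : Integrable (fun x => gp x * f x) := by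
  rw [gam_eq, integrable_withDensity_iff_integrable_smul' gam_meas (Eventually.of_forall fun x => ENNReal.ofReal_lt_top)] at h
  have := h.const_mul (gc V)⁻¹
  refine this.congr (Eventually.of_forall fun x => ?_)
  have := (gc_pos (V := V)).ne'
  simp only [ENNReal.toReal_ofReal (mul_pos gc_pos (gp_pos x)).le, smul_eq_mul]
  field_simp

theorem gam_ac : gam V ≪ volume := by rw [gam_eq]; exact withDensity_absolutelyContinuous _ _
theorem gam_ac' : (volume : Measure V) ≪ gam V := by
  rw [gam_eq]
  exact withDensity_absolutelyContinuous' gam_meas.aemeasurable (Eventually.of_forall fun x => by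
    simp [mul_pos gc_pos (gp_pos x)])

theorem gam_lin {K : ℝ≥0} {f : V → ℝ} (hf : LipschitzWith K f) : MemLp f 2 (gam V) := by
  have h0 : MemLp (fun x : V => ‖x‖) 2 (gam V) := (ProbabilityTheory.IsGaussian.memLp_id (gam V) 2 (by simp)).norm
  have h01 : MemLp (fun x : V => (K:ℝ) * ‖x‖) 2 (gam V) := h0.const_mul (K : ℝ)
  have h02 : MemLp (fun x : V => |f 0|) 2 (gam V) := memLp_const _
  have h1 : MemLp (fun x : V => |f 0| + K * ‖x‖) 2 (gam V) := h02.add h01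
  refine h1.mono hf.continuous.aestronglyMeasurable (Eventually.of_forall fun x => ?_)
  have := hf.dist_le_mul x 0
  rw [Real.dist_eq, dist_zero_right] at this
  rw [Real.norm_eq_abs, Real.norm_eq_abs, abs_of_nonneg (a := |f 0| + _) (by positivity)]
  have h2 : |f x| ≤ |f x - f 0| + |f 0| := by
    simpa using abs_add_le (f x - f 0) (f 0)
  linarith

theorem gp_fderiv (x : V) : HasGradientAt (gp : V → ℝ) (-(gp x) • x) x := by
  rw [hasGradientAt_iff_hasFDerivAt]
  have h1 : HasFDerivAt (fun y : V => ‖y‖ ^ 2) (2 • (innerSL ℝ x)) x := (hasStrictFDerivAt_norm_sq x).hasFDerivAt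
  have h2 := ((h1.mul_const (1/2 : ℝ)).neg).exp
  have : (gp : V → ℝ) = fun y => Real.exp (-(‖y‖^2 * (1/2))) := by ext y; unfold gp; congr 1; ring
  rw [this]
  refine h2.congr_fderiv ?_
  ext y
  simp [inner_smul_left]

theorem gp_lip : LipschitzWith 1 (gp : V → ℝ) := by
  refine lipschitzWith_of_nnnorm_fderiv_le (𝕜 := ℝ) (fun x => (gp_fderiv x).differentiableAt) fun x => ?_
  rw [(gp_fderiv x).hasFDerivAt.fderiv, ← NNReal.coe_le_coe, coe_nnnorm, LinearIsometryEquiv.norm_map, norm_smul,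
    norm_neg, Real.norm_eq_abs, abs_of_pos (gp_pos x)]
  unfold gp
  have := Real.add_one_le_exp (‖x‖^2/2)
  rw [Real.exp_neg, inv_mul_eq_div, div_le_iff₀ (Real.exp_pos _)]
  simp
  nlinarith [sq_nonneg (‖x‖ - 1)]
end gauss

section gauss2
variable {V : Type*} [NormedAddCommGroup V] [InnerProductSpace ℝ V] [FiniteDimensional ℝ V] [MeasurableSpace V] [BorelSpace V]

def etaj (j : ℝ) (x : V) : ℝ := min 1 (max 0 (j + 1 - ‖x‖))

theorem etaj_lip (j : ℝ) : LipschitzWith 1 (etaj j : V → ℝ) := by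
  unfold etaj
  have h : LipschitzWith 1 (fun x : V => j + 1 - ‖x‖) := by
    refine LipschitzWith.of_dist_le_mul fun x y => ?_
    rw [Real.dist_eq, dist_eq_norm]
    simp only [NNReal.coe_one, one_mul]
    rw [show j + 1 - ‖x‖ - (j + 1 - ‖y‖) = ‖y‖ - ‖x‖ by ring, norm_sub_rev]
    exact abs_norm_sub_norm_le y x
  exact (h.const_max 0).const_min 1

theorem etaj_nonneg (j : ℝ) (x : V) : 0 ≤ etaj j x := le_min zero_le_one (le_max_left _ _)
theorem etaj_le (j : ℝ) (x : V) : etaj j x ≤ 1 := min_le_left _ _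
theorem etaj_one {j : ℝ} {x : V} (h : ‖x‖ ≤ j) : etaj j x = 1 := by
  unfold etaj; rw [max_eq_right (by linarith), min_eq_left (by linarith)]
theorem etaj_zero {j : ℝ} {x : V} (h : j + 1 ≤ ‖x‖) : etaj j x = 0 := by
  unfold etaj; rw [max_eq_left (by linarith), min_eq_right (by linarith)]
theorem etaj_grad {j : ℝ} {x : V} (h : ‖x‖ < j) : gradient (etaj j) x = 0 := by
  have : etaj j =ᶠ[nhds x] fun _ : V => (1:ℝ) := by
    filter_upwards [isOpen_lt continuous_norm continuous_const |>.mem_nhds h] with y hy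
    exact etaj_one (le_of_lt hy)
  unfold gradient
  rw [this.fderiv_eq]; simp

theorem gam_ibp_j {K : ℝ≥0} {φ : V → ℝ} (hφ : LipschitzWith K φ) (a : V) (j : ℝ) :
    ∫ x, ⟪gradient φ x, a⟫ * (gp x * etaj j x) = ∫ x, (gp x * (etaj j x * ⟪x, a⟫ - ⟪gradient (etaj j) x, a⟫)) * φ x := by
  obtain ⟨L, hL⟩ := lip_mul_bdd (A := 1) (B := 1) gp_lip (etaj_lip j) (fun x : V => by rw [abs_of_pos (gp_pos x)]; exact gp_le x)
    (fun x : V => by rw [abs_of_nonneg (etaj_nonneg j x)]; exact etaj_le j x)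
  have hs : HasCompactSupport (fun x : V => gp x * etaj j x) :=
    HasCompactSupport.intro (isCompact_closedBall 0 (j+1)) fun x hx => by
      rw [etaj_zero, mul_zero]; simp at hx; exact hx.le
  have h := LipschitzWith.integral_lineDeriv_mul_eq (μ := volume) hφ hL hs a
  have e1 : ∫ x, ⟪gradient φ x, a⟫ * (gp x * etaj j x) = ∫ x, lineDeriv ℝ φ x a * (gp x * etaj j x) := by
    refine integral_congr_ae ?_
    filter_upwards [hφ.ae_differentiableAt] with x hx
    rw [hx.lineDeriv_eq_fderiv, grad_inner]
  rw [e1, h]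
  refine integral_congr_ae ?_
  filter_upwards [(etaj_lip (V := V) j).ae_differentiableAt] with x hx
  have h1 := (gp_fderiv x).hasFDerivAt.mul hx.hasGradientAt.hasFDerivAt
  have h2 : HasFDerivAt (fun y : V => gp y * etaj j y) _ x := h1
  rw [h2.differentiableAt.lineDeriv_eq_fderiv, h2.fderiv]
  simp [inner_smul_left]
  left; ring

theorem gam_ibp {K : ℝ≥0} {φ : V → ℝ} (hφ : LipschitzWith K φ) (a : V) :
    ∫ x, φ x * ⟪a, x⟫ ∂gam V = ∫ x, ⟪gradient φ x, a⟫ ∂gam V := by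
  rw [gam_int, gam_int]
  congr 1
  have hgm := (grad_meas φ)
  have hgp := gp_cont (V := V)
  have hφc := hφ.continuous
  have t1 : Tendsto (fun j : ℕ => ∫ x, ⟪gradient φ x, a⟫ * (gp x * etaj (j:ℝ) x)) atTop (nhds (∫ x, gp x * ⟪gradient φ x, a⟫)) := by
    refine tendsto_integral_of_dominated_convergence (fun x => K * ‖a‖ * gp x) (fun j => ?_) (gp_integrable.const_mul _) (fun j => ?_) ?_
    · have := (etaj_lip (V := V) j).continuous
      exact ((hgm.inner_const).mul (hgp.mul this).measurable).aestronglyMeasurable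
    · refine Eventually.of_forall fun x => ?_
      rw [norm_mul, Real.norm_eq_abs (gp x * _), abs_of_nonneg (mul_nonneg (gp_pos x).le (etaj_nonneg _ x))]
      have h1 : ‖⟪gradient φ x, a⟫‖ ≤ K * ‖a‖ := (norm_inner_le_norm _ _).trans (by gcongr; exact grad_norm_le hφ x)
      have h2 := mul_le_mul_of_nonneg_left (etaj_le (j:ℝ) x) (gp_pos x).le
      have h3 := mul_nonneg (gp_pos x).le (etaj_nonneg (j:ℝ) x)
      calc _ ≤ (K * ‖a‖) * (gp x * etaj j x) := by gcongr
        _ ≤ (K * ‖a‖) * gp x := by gcongr; linarith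
    · refine Eventually.of_forall fun x => ?_
      refine tendsto_const_nhds.congr' ?_
      filter_upwards [eventually_ge_atTop ⌈‖x‖⌉₊] with j hj
      rw [etaj_one (Nat.ceil_le.1 hj)]; ring
  have t2 : Tendsto (fun j : ℕ => ∫ x, (gp x * (etaj j x * ⟪x, a⟫ - ⟪gradient (etaj (j:ℝ)) x, a⟫)) * φ x) atTop (nhds (∫ x, gp x * (φ x * ⟪a, x⟫))) := by
    have hb : Integrable (fun x : V => gp x * ((‖x‖ * ‖a‖ + ‖a‖) * |φ x|)) := by
      refine gam_integrable ?_
      have m1 : MemLp (fun x : V => ‖x‖ * ‖a‖ + ‖a‖) 2 (gam V) := by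
        refine gam_lin (K := ‖a‖₊) (LipschitzWith.of_dist_le_mul fun x y => ?_)
        rw [Real.dist_eq, dist_eq_norm, show ‖x‖ * ‖a‖ + ‖a‖ - (‖y‖ * ‖a‖ + ‖a‖) = (‖x‖ - ‖y‖) * ‖a‖ by ring, abs_mul, abs_norm, mul_comm]
        simp only [coe_nnnorm]
        gcongr; exact abs_norm_sub_norm_le x y
      exact m1.integrable_mul (gam_lin hφ).norm
    refine tendsto_integral_of_dominated_convergence _ (fun j => ?_) hb (fun j => ?_) ?_
    · have := (etaj_lip (V := V) j).continuous
      have h2 := grad_meas (etaj (V := V) j)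
      have h3 : Measurable fun x : V => ⟪x, a⟫ := by fun_prop
      exact ((hgp.measurable.mul ((this.measurable.mul h3).sub h2.inner_const)).mul hφc.measurable).aestronglyMeasurable
    · refine Eventually.of_forall fun x => ?_
      rw [norm_mul, norm_mul, Real.norm_eq_abs (gp x), abs_of_pos (gp_pos x), mul_assoc, Real.norm_eq_abs (φ x)]
      have hp := (gp_pos x).le
      gcongr
      refine (norm_sub_le _ _).trans ?_
      have h1 : ‖⟪gradient (etaj (j:ℝ)) x, a⟫‖ ≤ ‖a‖ := (norm_inner_le_norm _ _).trans (by
        have := grad_norm_le (etaj_lip (j:ℝ)) x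
        simp at this
        exact mul_le_of_le_one_left (norm_nonneg _) this)
      have h2 : ‖etaj (j:ℝ) x * ⟪x, a⟫‖ ≤ ‖x‖ * ‖a‖ := by
        rw [norm_mul, Real.norm_eq_abs (etaj _ _), abs_of_nonneg (etaj_nonneg _ _)]
        exact (mul_le_of_le_one_left (norm_nonneg _) (etaj_le _ _)).trans (norm_inner_le_norm _ _)
      linarith
    · refine Eventually.of_forall fun x => ?_
      refine tendsto_const_nhds.congr' ?_
      filter_upwards [eventually_gt_atTop ⌈‖x‖⌉₊] with j hj
      have := (Nat.ceil_le.1 le_rfl).trans_lt (Nat.cast_lt (α := ℝ).2 hj)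
      rw [etaj_one this.le, etaj_grad this, inner_zero_left, real_inner_comm]; ring
  refine tendsto_nhds_unique t2 (t1.congr fun j => ?_)
  exact gam_ibp_j hφ a j
end gauss2

section gauss3
variable {V : Type*} [NormedAddCommGroup V] [InnerProductSpace ℝ V] [FiniteDimensional ℝ V] [MeasurableSpace V] [BorelSpace V]

theorem rot_mp (θ : ℝ) : MeasurePreserving (ContinuousLinearMap.rotation (E := V) θ) ((gam V).prod (gam V)) ((gam V).prod (gam V)) := by
  refine ⟨(ContinuousLinearMap.rotation (E := V) θ).continuous.measurable, ?_⟩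
  exact ProbabilityTheory.IsGaussian.map_rotation_eq_self (by simpa using ProbabilityTheory.integral_id_stdGaussian (E := V)) θ

theorem rot_fst (θ : ℝ) : MeasurePreserving (fun z : V × V => Real.cos θ • z.1 + Real.sin θ • z.2) ((gam V).prod (gam V)) (gam V) :=
  measurePreserving_fst.comp (rot_mp θ)

theorem rot_ae (θ : ℝ) {P : V → Prop} (hP : ∀ᵐ x : V, P x) : ∀ᵐ z ∂((gam V).prod (gam V)), P (Real.cos θ • z.1 + Real.sin θ • z.2) :=
  (rot_fst θ).quasiMeasurePreserving.ae (gam_ac.ae_le hP)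

theorem gg_deriv {K : ℝ≥0} {h : V → ℝ} (hh : LipschitzWith K h) (θ : ℝ) :
    HasDerivAt (fun θ : ℝ => ∫ z, h z.1 * h (Real.cos θ • z.1 + Real.sin θ • z.2) ∂((gam V).prod (gam V)))
      (∫ z, h z.1 * ⟪gradient h (Real.cos θ • z.1 + Real.sin θ • z.2), -Real.sin θ • z.1 + Real.cos θ • z.2⟫ ∂((gam V).prod (gam V))) θ := by
  have hc := hh.continuous
  have hgm := grad_meas h
  have m1 : MemLp (fun z : V × V => h z.1) 2 ((gam V).prod (gam V)) := (gam_lin hh).comp_measurePreserving measurePreserving_fst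
  have mn : MemLp (fun z : V => ‖z‖) 2 (gam V) := gam_lin lipschitzWith_one_norm
  have mn1 : MemLp (fun z : V × V => ‖z.1‖) 2 ((gam V).prod (gam V)) := mn.comp_measurePreserving measurePreserving_fst
  have mn2 : MemLp (fun z : V × V => ‖z.2‖) 2 ((gam V).prod (gam V)) := mn.comp_measurePreserving measurePreserving_snd
  have m2 : MemLp (fun z : V × V => ‖z.1‖ + ‖z.2‖) 2 ((gam V).prod (gam V)) := mn1.add mn2
  have hb : Integrable (fun z : V × V => |h z.1| * (‖z.1‖ + ‖z.2‖)) ((gam V).prod (gam V)) := m1.norm.integrable_mul m2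
  refine (hasDerivAt_integral_of_dominated_loc_of_lip (μ := (gam V).prod (gam V)) (s := univ)
    (F := fun θ z => h z.1 * h (Real.cos θ • z.1 + Real.sin θ • z.2))
    (F' := fun z : V × V => h z.1 * ⟪gradient h (Real.cos θ • z.1 + Real.sin θ • z.2), -Real.sin θ • z.1 + Real.cos θ • z.2⟫)
    (bound := fun z => K * (|h z.1| * (‖z.1‖ + ‖z.2‖))) univ_mem ?_ ?_ ?_ ?_ (hb.const_mul _) ?_).2
  · refine Eventually.of_forall fun t => Continuous.aestronglyMeasurable (by fun_prop)
  · exact m1.integrable_mul ((gam_lin hh).comp_measurePreserving (rot_fst θ))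
  · refine Measurable.aestronglyMeasurable ?_
    have e1 : Measurable fun z : V × V => Real.cos θ • z.1 + Real.sin θ • z.2 := by fun_prop
    have e2 : Measurable fun z : V × V => -Real.sin θ • z.1 + Real.cos θ • z.2 := by fun_prop
    exact (hc.measurable.comp measurable_fst).mul ((hgm.comp e1).inner e2)
  · refine Eventually.of_forall fun z => LipschitzOnWith.of_dist_le_mul fun s _ t _ => ?_
    have h1 := hh.dist_le_mul (Real.cos s • z.1 + Real.sin s • z.2) (Real.cos t • z.1 + Real.sin t • z.2)
    have hcs : |Real.cos s - Real.cos t| ≤ |s - t| := by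
      simpa [Real.dist_eq] using Real.lipschitzWith_cos.dist_le_mul s t
    have hsn : |Real.sin s - Real.sin t| ≤ |s - t| := by
      simpa [Real.dist_eq] using Real.lipschitzWith_sin.dist_le_mul s t
    have h2 : dist (Real.cos s • z.1 + Real.sin s • z.2) (Real.cos t • z.1 + Real.sin t • z.2) ≤ (‖z.1‖ + ‖z.2‖) * |s - t| := by
      rw [dist_eq_norm, show Real.cos s • z.1 + Real.sin s • z.2 - (Real.cos t • z.1 + Real.sin t • z.2) = (Real.cos s - Real.cos t) • z.1 + (Real.sin s - Real.sin t) • z.2 by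
        rw [sub_smul, sub_smul]; abel]
      refine (norm_add_le _ _).trans ?_
      rw [norm_smul, norm_smul, Real.norm_eq_abs, Real.norm_eq_abs, add_mul, mul_comm ‖z.1‖, mul_comm ‖z.2‖]
      gcongr
    simp only [Real.dist_eq, Real.coe_nnabs] at h1 ⊢
    rw [← mul_sub, abs_mul, abs_of_nonneg (a := (K:ℝ) * _) (by positivity)]
    calc _ ≤ |h z.1| * (K * ((‖z.1‖ + ‖z.2‖) * |s - t|)) := by
          gcongr; exact h1.trans (by gcongr)
      _ = _ := by ring
  · filter_upwards [rot_ae θ hh.ae_differentiableAt] with z hz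
    have e1 : HasDerivAt (fun t => Real.cos t • z.1 + Real.sin t • z.2) (-Real.sin θ • z.1 + Real.cos θ • z.2) θ :=
      ((Real.hasDerivAt_cos θ).smul_const z.1).add ((Real.hasDerivAt_sin θ).smul_const z.2)
    have e2 := hz.hasGradientAt.hasFDerivAt.comp_hasDerivAt θ e1
    exact (e2.const_mul (h z.1)).congr_deriv (by simp)

theorem gg_deriv2 {K : ℝ≥0} {h : V → ℝ} (hh : LipschitzWith K h) (θ : ℝ) :
    (∫ z, h z.1 * ⟪gradient h (Real.cos θ • z.1 + Real.sin θ • z.2), -Real.sin θ • z.1 + Real.cos θ • z.2⟫ ∂((gam V).prod (gam V)))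
     = - Real.sin θ * ∫ z, ⟪gradient h (Real.cos θ • z.1 - Real.sin θ • z.2), gradient h z.1⟫ ∂((gam V).prod (gam V)) := by
  have hc := hh.continuous
  have hgm := grad_meas h
  set G : V × V → ℝ := fun w => h (Real.cos θ • w.1 - Real.sin θ • w.2) * ⟪gradient h w.1, w.2⟫ with hG
  have hGm : Measurable G := by
    have e1 : Measurable fun z : V × V => Real.cos θ • z.1 - Real.sin θ • z.2 := by fun_prop
    exact (hc.measurable.comp e1).mul ((hgm.comp measurable_fst).inner measurable_snd)
  have hsq := Real.sin_sq_add_cos_sq θ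
  have e1 : (fun z : V × V => h z.1 * ⟪gradient h (Real.cos θ • z.1 + Real.sin θ • z.2), -Real.sin θ • z.1 + Real.cos θ • z.2⟫) =
      fun z => G (ContinuousLinearMap.rotation θ z) := by
    ext z
    simp only [hG, ContinuousLinearMap.rotation_apply]
    congr 2
    have : z.1 = (Real.sin θ ^ 2 + Real.cos θ ^ 2) • z.1 := by rw [hsq, one_smul]
    conv_lhs => rw [this]
    module
  have hL2 : MemLp (fun z : V × V => h (Real.cos θ • z.1 - Real.sin θ • z.2)) 2 ((gam V).prod (gam V)) := by
    have := (gam_lin hh).comp_measurePreserving (rot_fst (-θ))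
    refine this.ae_eq (Eventually.of_forall fun z => ?_)
    simp [sub_eq_add_neg]
  have mn2 : MemLp (fun z : V × V => K * ‖z.2‖) 2 ((gam V).prod (gam V)) := ((gam_lin lipschitzWith_one_norm).comp_measurePreserving measurePreserving_snd).const_mul (K:ℝ)
  have hin : MemLp (fun z : V × V => ⟪gradient h z.1, z.2⟫) 2 ((gam V).prod (gam V)) := by
    refine mn2.mono ((hgm.comp measurable_fst).inner measurable_snd).aestronglyMeasurable (Eventually.of_forall fun z => ?_)
    refine (norm_inner_le_norm _ _).trans ?_
    rw [norm_mul, norm_norm]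
    gcongr
    simpa using grad_norm_le hh z.1
  have hGi : Integrable G ((gam V).prod (gam V)) := hL2.integrable_mul hin
  have hgb : ∀ x, ‖gradient h x‖ ≤ K := grad_norm_le hh
  have hQi : Integrable (fun z : V × V => ⟪gradient h (Real.cos θ • z.1 - Real.sin θ • z.2), gradient h z.1⟫) ((gam V).prod (gam V)) := by
    have e1 : Measurable fun z : V × V => Real.cos θ • z.1 - Real.sin θ • z.2 := by fun_prop
    refine Integrable.of_bound ((hgm.comp e1).inner (hgm.comp measurable_fst)).aestronglyMeasurable (K * K) (Eventually.of_forall fun z => ?_)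
    exact (norm_inner_le_norm _ _).trans (mul_le_mul (hgb _) (hgb _) (norm_nonneg _) (by positivity))
  rw [e1, ← integral_map (rot_mp θ).measurable.aemeasurable hGm.aestronglyMeasurable, (rot_mp θ).map_eq,
    integral_prod _ hGi, integral_prod _ hQi, ← integral_const_mul]
  have hae := Measure.ae_ae_of_ae_prod (rot_ae (V := V) (-θ) hh.ae_differentiableAt)
  refine integral_congr_ae ?_
  filter_upwards [hae] with x hx
  have hl : LipschitzWith (K * ‖Real.sin θ‖₊) (fun y : V => h (Real.cos θ • x - Real.sin θ • y)) := by
    refine hh.comp (f := h) (g := fun y : V => Real.cos θ • x - Real.sin θ • y) (LipschitzWith.of_dist_le_mul fun y y' => ?_)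
    rw [dist_sub_left, dist_eq_norm, ← smul_sub, norm_smul, dist_eq_norm, coe_nnnorm]
  have hi := gam_ibp hl (gradient h x)
  simp only [hG]
  rw [hi, ← integral_const_mul]
  refine integral_congr_ae ?_
  filter_upwards [hx] with y hy
  simp only [Real.cos_neg, Real.sin_neg, neg_smul, ← sub_eq_add_neg] at hy
  have e2 : HasFDerivAt (fun y : V => Real.cos θ • x - Real.sin θ • y) (-(Real.sin θ • ContinuousLinearMap.id ℝ V)) y :=
    ((hasFDerivAt_id y).const_smul (Real.sin θ)).const_sub _
  have e3 := hy.hasGradientAt.hasFDerivAt.comp y e2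
  have e4 : HasGradientAt (fun y : V => h (Real.cos θ • x - Real.sin θ • y)) (-Real.sin θ • gradient h (Real.cos θ • x - Real.sin θ • y)) y := by
    rw [hasGradientAt_iff_hasFDerivAt]
    refine e3.congr_fderiv ?_
    ext v; simp [inner_smul_left, inner_smul_right]
  rw [e4.gradient, inner_smul_left]
  simp
end gauss3

section gauss4
variable {V : Type*} [NormedAddCommGroup V] [InnerProductSpace ℝ V] [FiniteDimensional ℝ V] [MeasurableSpace V] [BorelSpace V]

theorem affine_of_grad_const {K : ℝ≥0} {h : V → ℝ} (hh : LipschitzWith K h) (a : V) (ha : ∀ᵐ x : V, gradient h x = a) (x : V) :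
    h x = h 0 + ⟪a, x⟫ := by
  have hl : LipschitzWith (K + ‖a‖₊) (fun x => h x - ⟪a, x⟫) := by
    refine hh.sub (LipschitzWith.of_dist_le_mul fun x y => ?_)
    rw [Real.dist_eq, ← inner_sub_right, dist_eq_norm, coe_nnnorm]
    exact abs_real_inner_le_norm _ _
  have := const_of_grad_zero hl (R := ‖x‖ + 1) (by
    filter_upwards [ha, hh.ae_differentiableAt] with y h1 h2 _
    have h3 := h2.hasGradientAt.hasFDerivAt
    rw [h1] at h3
    have h4 : HasFDerivAt (fun x : V => ⟪a, x⟫) (innerSL ℝ a) y := (innerSL ℝ a).hasFDerivAt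
    have h5 := h3.sub h4
    refine HasGradientAt.gradient ?_
    rw [hasGradientAt_iff_hasFDerivAt]
    refine h5.congr_fderiv ?_
    ext v; simp) x (by simp)
  simp at this
  linarith

theorem gauss_poincare_eq {K : ℝ≥0} {h : V → ℝ} (hh : LipschitzWith K h) (h0 : ∫ x, h x ∂gam V = 0)
    (hM : ∫ x, ‖gradient h x‖ ^ 2 ∂gam V ≤ ∫ x, h x ^ 2 ∂gam V) : ∃ a : V, ∀ x, h x = h 0 + ⟪a, x⟫ := by
  have hc := hh.continuous
  have hgm := grad_meas h
  have hgb : ∀ x, ‖gradient h x‖ ≤ K := grad_norm_le hh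
  set γ2 := (gam V).prod (gam V) with hγ2
  set M := ∫ x, ‖gradient h x‖ ^ 2 ∂gam V with hMd
  set g : ℝ → ℝ := fun θ => ∫ z, h z.1 * h (Real.cos θ • z.1 + Real.sin θ • z.2) ∂γ2 with hg
  set Q : ℝ → ℝ := fun θ => ∫ z, ⟪gradient h (Real.cos θ • z.1 - Real.sin θ • z.2), gradient h z.1⟫ ∂γ2 with hQ
  have hd : ∀ θ, HasDerivAt g (- Real.sin θ * Q θ) θ := fun θ => by
    rw [hQ]; simp only; rw [hγ2, ← gg_deriv2 hh θ]; exact gg_deriv hh θ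
  -- Q in terms of squares
  have hm1 : ∀ θ : ℝ, Measurable fun z : V × V => gradient h (Real.cos θ • z.1 - Real.sin θ • z.2) := fun θ => by
    have e1 : Measurable fun z : V × V => Real.cos θ • z.1 - Real.sin θ • z.2 := by fun_prop
    exact hgm.comp e1
  have hm2 : Measurable fun z : V × V => gradient h z.1 := hgm.comp measurable_fst
  have hbd : ∀ (F : V × V → V), Measurable F → (∀ z, ‖F z‖ ≤ 2 * K) → Integrable (fun z => ‖F z‖ ^ 2) γ2 := by
    intro F hF hFb
    refine Integrable.of_bound (hF.norm.pow_const 2).aestronglyMeasurable ((2 * K) ^ 2) (Eventually.of_forall fun z => ?_)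
    rw [norm_pow, norm_norm]
    exact pow_le_pow_left₀ (norm_nonneg _) (hFb z) 2
  have i1 : ∀ θ : ℝ, ∫ z, ‖gradient h (Real.cos θ • z.1 - Real.sin θ • z.2)‖ ^ 2 ∂γ2 = M := by
    intro θ
    have := (rot_fst (V := V) (-θ))
    have h2 : ∫ z, ‖gradient h (Real.cos (-θ) • z.1 + Real.sin (-θ) • z.2)‖ ^ 2 ∂γ2 = M := by
      rw [hMd, ← this.map_eq, integral_map this.measurable.aemeasurable]
      exact (hgm.norm.pow_const 2).aestronglyMeasurable
    rw [← h2]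
    congr 1; ext z; simp [sub_eq_add_neg]
  have i2 : ∫ z, ‖gradient h z.1‖ ^ 2 ∂γ2 = M := by
    have := measurePreserving_fst (μ := gam V) (ν := gam V)
    rw [hMd]
    conv_rhs => rw [← this.map_eq]
    rw [integral_map this.measurable.aemeasurable]
    exact (hgm.norm.pow_const 2).aestronglyMeasurable
  have j1 : ∀ θ : ℝ, Integrable (fun z => ‖gradient h (Real.cos θ • z.1 - Real.sin θ • z.2)‖ ^ 2) γ2 := fun θ =>
    hbd _ (hm1 θ) fun z => (hgb _).trans (by linarith [K.coe_nonneg])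
  have j2 : Integrable (fun z : V × V => ‖gradient h z.1‖ ^ 2) γ2 := 
    hbd _ hm2 fun z => (hgb _).trans (by linarith [K.coe_nonneg])
  have j3 : ∀ θ : ℝ, Integrable (fun z => ‖gradient h (Real.cos θ • z.1 - Real.sin θ • z.2) - gradient h z.1‖ ^ 2) γ2 := fun θ =>
    hbd _ ((hm1 θ).sub hm2) fun z => (norm_sub_le _ _).trans (by linarith [hgb z.1, hgb (Real.cos θ • z.1 - Real.sin θ • z.2)])
  have hQe : ∀ θ, Q θ = M - (1/2) * ∫ z, ‖gradient h (Real.cos θ • z.1 - Real.sin θ • z.2) - gradient h z.1‖ ^ 2 ∂γ2 := by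
    intro θ
    have : Q θ = ∫ z, (1/2) * (‖gradient h (Real.cos θ • z.1 - Real.sin θ • z.2)‖ ^ 2 + ‖gradient h z.1‖ ^ 2 - ‖gradient h (Real.cos θ • z.1 - Real.sin θ • z.2) - gradient h z.1‖ ^ 2) ∂γ2 := by
      refine integral_congr_ae (Eventually.of_forall fun z => ?_)
      simp only
      rw [norm_sub_sq_real]; ring
    have e1 := integral_sub ((j1 θ).add j2) (j3 θ)
    have e2 := integral_add (j1 θ) j2
    simp only [Pi.add_apply] at e1
    rw [this, integral_const_mul, e1, e2, i1, i2]; ring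
  -- monotone
  set G : ℝ → ℝ := fun θ => g θ - M * Real.cos θ with hG
  have hGd : ∀ θ, HasDerivAt G (- Real.sin θ * Q θ + M * Real.sin θ) θ := fun θ => by
    refine ((hd θ).sub ((Real.hasDerivAt_cos θ).const_mul M)).congr_deriv ?_
    ring
  have hpi := Real.pi_pos
  have hmono : MonotoneOn G (Icc 0 (Real.pi / 2)) := by
    refine monotoneOn_of_deriv_nonneg (convex_Icc _ _) (fun x _ => (hGd x).continuousAt.continuousWithinAt)
      (fun x _ => (hGd x).differentiableAt.differentiableWithinAt) fun x hx => ?_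
    rw [interior_Icc] at hx
    rw [(hGd x).deriv, hQe]
    have hs : 0 ≤ Real.sin x := Real.sin_nonneg_of_nonneg_of_le_pi hx.1.le (by linarith [hx.2])
    have hi : 0 ≤ ∫ z, ‖gradient h (Real.cos x • z.1 - Real.sin x • z.2) - gradient h z.1‖ ^ 2 ∂γ2 := integral_nonneg fun z => sq_nonneg _
    have := mul_nonneg hs hi
    linarith
  have hG0 : 0 ≤ G 0 := by
    have : g 0 = ∫ x, h x ^ 2 ∂gam V := by
      simp only [hg, Real.cos_zero, Real.sin_zero, one_smul, zero_smul, add_zero]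
      have hp := measurePreserving_fst (μ := gam V) (ν := gam V)
      conv_rhs => rw [← hp.map_eq]
      rw [integral_map hp.measurable.aemeasurable (f := fun x => h x ^ 2) (hc.pow 2).aestronglyMeasurable]
      congr 1; ext z; ring
    simp only [hG, this, Real.cos_zero]; linarith
  have hG1 : G (Real.pi / 2) = 0 := by
    simp only [hG, hg, Real.cos_pi_div_two, Real.sin_pi_div_two, one_smul, zero_smul, zero_add, mul_zero, sub_zero]
    rw [hγ2, integral_prod_mul (μ := gam V) (ν := gam V) h h, h0, zero_mul]
  have hGz : ∀ θ ∈ Icc 0 (Real.pi / 2), G θ = 0 := fun θ hθ => by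
    have a1 := hmono ⟨le_rfl, by linarith⟩ hθ hθ.1
    have a2 := hmono hθ ⟨by linarith, le_rfl⟩ hθ.2
    linarith
  have hder : - Real.sin (Real.pi/4) * Q (Real.pi/4) + M * Real.sin (Real.pi/4) = 0 := by
    have e : G =ᶠ[nhds (Real.pi/4)] fun _ => 0 := by
      filter_upwards [Icc_mem_nhds (show 0 < Real.pi/4 by linarith) (show Real.pi/4 < Real.pi/2 by linarith)] with θ hθ using hGz θ hθ
    exact (hGd (Real.pi/4)).unique ((hasDerivAt_const (Real.pi/4) (0:ℝ)).congr_of_eventuallyEq e)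
  have hsp : 0 < Real.sin (Real.pi/4) := Real.sin_pos_of_pos_of_lt_pi (by linarith) (by linarith)
  have hz : ∫ z, ‖gradient h (Real.cos (Real.pi/4) • z.1 - Real.sin (Real.pi/4) • z.2) - gradient h z.1‖ ^ 2 ∂γ2 = 0 := by
    rw [hQe] at hder
    have : Real.sin (Real.pi/4) * ∫ z, ‖gradient h (Real.cos (Real.pi/4) • z.1 - Real.sin (Real.pi/4) • z.2) - gradient h z.1‖ ^ 2 ∂γ2 = 0 := by linarith
    exact (mul_eq_zero.1 this).resolve_left hsp.ne'
  have hae := (integral_eq_zero_iff_of_nonneg (fun z => sq_nonneg _) (j3 _)).1 hz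
  have hae2 := Measure.ae_ae_of_ae_prod hae
  obtain ⟨x, hx⟩ := hae2.exists
  refine ⟨gradient h x, affine_of_grad_const hh _ ?_⟩
  have hx2 := gam_ac'.ae_le hx
  set s := Real.sin (Real.pi/4)
  set c := Real.cos (Real.pi/4)
  have hq : Measure.QuasiMeasurePreserving (fun w : V => s⁻¹ • (c • x - w)) volume volume := by
    have q1 : Measure.QuasiMeasurePreserving (fun w : V => c • x - w) volume volume :=
      (Measure.measurePreserving_sub_left volume (c • x)).quasiMeasurePreserving
    have q2 : Measure.QuasiMeasurePreserving (fun w : V => s⁻¹ • w) volume volume := by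
      refine ⟨by fun_prop, ?_⟩
      rw [Measure.map_addHaar_smul volume (inv_ne_zero hsp.ne')]
      exact Measure.smul_absolutelyContinuous
    exact q2.comp q1
  have := hq.ae hx2
  filter_upwards [this] with w hw
  have e : c • x - s • (s⁻¹ • (c • x - w)) = w := by
    rw [smul_smul, mul_inv_cancel₀ hsp.ne', one_smul]; abel
  simp only [Pi.zero_apply] at hw
  rw [e] at hw
  have := pow_eq_zero_iff (two_ne_zero) |>.1 hw
  rwa [norm_eq_zero, sub_eq_zero] at this
end gauss4

section sphEq
variable {V : Type*} [NormedAddCommGroup V] [InnerProductSpace ℝ V] [FiniteDimensional ℝ V] [MeasurableSpace V] [BorelSpace V]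

theorem gauss_moment (m : ℕ) : ∫ ρ in Ioi (0:ℝ), ρ ^ m * (Real.exp (-(ρ^2/2)) * ρ^2) = (m+1) * ∫ ρ in Ioi (0:ℝ), ρ ^ m * Real.exp (-(ρ^2/2)) := by
  have key : ∀ q : ℕ, ∫ ρ in Ioi (0:ℝ), ρ ^ q * Real.exp (-(ρ^2/2)) = (1/2:ℝ)^(-((q:ℝ)+1)/2)*(1/2)*Real.Gamma (((q:ℝ)+1)/2) := by
    intro q
    rw [← integral_rpow_mul_exp_neg_mul_rpow (p := 2) (q := q) (b := 1/2) (by norm_num) (by have : (0:ℝ) ≤ q := by positivity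
                                                                                            linarith) (by norm_num)]
    refine setIntegral_congr_fun measurableSet_Ioi fun ρ hρ => ?_
    simp only [Real.rpow_natCast, Real.rpow_ofNat]
    congr 2; ring
  have e : ∀ ρ : ℝ, ρ ^ m * (Real.exp (-(ρ^2/2)) * ρ^2) = ρ ^ (m+2) * Real.exp (-(ρ^2/2)) := fun ρ => by ring
  simp only [e]
  rw [key, key]
  have h0 : (0:ℝ) < ((m:ℝ)+1)/2 := by positivity
  have e1 : (((m+2:ℕ):ℝ)+1)/2 = ((m:ℝ)+1)/2 + 1 := by push_cast; ring
  have e2 : -(((m+2:ℕ):ℝ)+1)/2 = -((m:ℝ)+1)/2 + (-1) := by push_cast; ring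
  rw [e1, e2, Real.Gamma_add_one h0.ne', Real.rpow_add (by norm_num), Real.rpow_neg_one]
  ring

theorem gauss_moment_pos (m : ℕ) : 0 < ∫ ρ in Ioi (0:ℝ), ρ ^ m * Real.exp (-(ρ^2/2)) := by
  have : ∫ ρ in Ioi (0:ℝ), ρ ^ m * Real.exp (-(ρ^2/2)) = (1/2:ℝ)^(-((m:ℝ)+1)/2)*(1/2)*Real.Gamma (((m:ℝ)+1)/2) := by
    rw [← integral_rpow_mul_exp_neg_mul_rpow (p := 2) (q := m) (b := 1/2) (by norm_num) (by have : (0:ℝ) ≤ m := by positivity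
                                                                                            linarith) (by norm_num)]
    refine setIntegral_congr_fun measurableSet_Ioi fun ρ hρ => ?_
    simp only [Real.rpow_natCast, Real.rpow_ofNat]
    congr 2; ring
  rw [this]
  have := Real.Gamma_pos_of_pos (show (0:ℝ) < ((m:ℝ)+1)/2 by positivity)
  positivity

theorem cone_lip {f : V → ℝ} {K : ℝ≥0} (hf : LipschitzWith K f) :
    ∃ M : ℝ≥0, LipschitzWith M (fun x : V => ‖x‖ * f (‖x‖⁻¹ • x)) := by
  set C := |f 0| + K with hC
  have hC0 : 0 ≤ C := by positivity
  have hb : ∀ x : V, |f (‖x‖⁻¹ • x)| ≤ C := fun x => by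
    have h1 := hf.dist_le_mul (‖x‖⁻¹ • x) 0
    rw [Real.dist_eq, dist_zero_right] at h1
    have h2 : ‖‖x‖⁻¹ • x‖ ≤ 1 := by
      by_cases hx : x = 0
      · simp [hx]
      · exact (unit_of_ne hx).le
    have h3 := abs_sub_abs_le_abs_sub (f (‖x‖⁻¹ • x)) (f 0)
    have := mul_le_mul_of_nonneg_left h2 K.coe_nonneg
    linarith
  refine ⟨(2 * K + C).toNNReal, LipschitzWith.of_dist_le_mul fun x y => ?_⟩
  rw [Real.coe_toNNReal _ (by positivity), Real.dist_eq, dist_eq_norm]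
  have e : ‖x‖ * f (‖x‖⁻¹ • x) - ‖y‖ * f (‖y‖⁻¹ • y) = ‖x‖ * (f (‖x‖⁻¹ • x) - f (‖y‖⁻¹ • y)) + (‖x‖ - ‖y‖) * f (‖y‖⁻¹ • y) := by ring
  rw [e]
  refine (abs_add_le _ _).trans ?_
  rw [abs_mul, abs_mul, abs_norm]
  have h1 := hf.dist_le_mul (‖x‖⁻¹ • x) (‖y‖⁻¹ • y)
  rw [Real.dist_eq, dist_eq_norm] at h1
  have h2 : ‖x‖ * ‖‖x‖⁻¹ • x - ‖y‖⁻¹ • y‖ ≤ 2 * ‖x - y‖ := by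
    by_cases hx : x = 0
    · simp [hx]
    by_cases hy : y = 0
    · have := unit_of_ne hx
      simp only [hy, norm_zero, inv_zero, smul_zero, sub_zero, this]; linarith [norm_nonneg x]
    have hx' : 0 < ‖x‖ := norm_pos_iff.2 hx
    have hy' : 0 < ‖y‖ := norm_pos_iff.2 hy
    have : ‖x‖ * ‖‖x‖⁻¹ • x - ‖y‖⁻¹ • y‖ = ‖(x - y) + (‖y‖ - ‖x‖) • (‖y‖⁻¹ • y)‖ := by
      rw [← abs_norm x, ← Real.norm_eq_abs, ← norm_smul, smul_sub, sub_smul, smul_smul, smul_smul, smul_smul, Real.norm_eq_abs, abs_norm, mul_inv_cancel₀ hx'.ne', mul_inv_cancel₀ hy'.ne', one_smul, one_smul]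
      simp only [smul_smul]; congr 1; abel
    rw [this]
    refine (norm_add_le _ _).trans ?_
    rw [norm_smul, unit_of_ne hy, mul_one, Real.norm_eq_abs]
    have := abs_norm_sub_norm_le y x
    rw [norm_sub_rev] at this
    linarith
  have h3 := abs_norm_sub_norm_le x y
  have h4 := mul_le_mul h3 (hb y) (abs_nonneg _) (norm_nonneg _)
  have h5 := mul_le_mul_of_nonneg_left h1 (norm_nonneg x)
  have h6 := mul_le_mul_of_nonneg_left h2 K.coe_nonneg
  nlinarith

theorem sgm_bdd_int {f : V → ℝ} (hf : Measurable f) {C : ℝ} (hC : ∀ θ : V, ‖θ‖ = 1 → |f θ| ≤ C) :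
    Integrable (fun θ : sphere (0:V) 1 => f θ) (sgm V) := by
  refine Integrable.of_bound (hf.comp measurable_subtype_coe).aestronglyMeasurable C (Eventually.of_forall fun θ => ?_)
  exact hC θ (by simpa using θ.2)

theorem sgm_cont_int {f : V → ℝ} (hf : Continuous f) : Integrable (fun θ : sphere (0:V) 1 => f θ) (sgm V) := by
  have : Continuous (fun θ : sphere (0:V) 1 => f θ) := hf.comp continuous_subtype_val
  exact this.integrable_of_hasCompactSupport (HasCompactSupport.of_compactSpace _)

theorem tang_le {f : V → ℝ} {K : ℝ≥0} (hf : LipschitzWith K f) {θ : V} (h : ‖θ‖ = 1) : |tang f θ| ≤ K ^ 2 := by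
  rw [abs_of_nonneg (tang_nonneg f h)]
  have := pow_le_pow_left₀ (norm_nonneg _) (grad_norm_le hf θ) 2
  unfold tang; nlinarith [sq_nonneg (⟪gradient f θ, θ⟫)]

theorem sphere_poincare_eq [Nontrivial V] {f : V → ℝ} {K : ℝ≥0} (hf : LipschitzWith K f)
    (hd : ∀ᵐ θ : sphere (0:V) 1 ∂sgm V, DifferentiableAt ℝ f θ)
    (h0 : ∫ θ : sphere (0:V) 1, f θ ∂sgm V = 0)
    (hT : ∫ θ : sphere (0:V) 1, tang f θ ∂sgm V ≤ ((Module.finrank ℝ V - 1 : ℕ):ℝ) * ∫ θ : sphere (0:V) 1, f θ ^ 2 ∂sgm V) :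
    ∃ a : V, ∀ θ : V, ‖θ‖ = 1 → f θ = ⟪a, θ⟫ := by
  obtain ⟨M, hM⟩ := cone_lip hf
  set m := Module.finrank ℝ V - 1 with hm
  have hfc := hf.continuous
  have hE0 : ∫ x, ‖x‖ * f (‖x‖⁻¹ • x) ∂gam V = 0 := by
    rw [gam_int]
    have := pol_prod (V := V) (fun ρ => Real.exp (-(ρ^2/2)) * ρ) f (by fun_prop) hfc.measurable
    rw [h0, mul_zero] at this
    have e : ∫ x : V, gp x * (‖x‖ * f (‖x‖⁻¹ • x)) = 0 := by
      rw [← this]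
      refine integral_congr_ae (Eventually.of_forall fun z => ?_)
      simp only [gp]; ring
    rw [e, mul_zero]
  have hE2 : ∫ x, (‖x‖ * f (‖x‖⁻¹ • x)) ^ 2 ∂gam V = gc V * (((m+1) * ∫ ρ in Ioi (0:ℝ), ρ ^ m * Real.exp (-(ρ^2/2))) * ∫ θ : sphere (0:V) 1, f θ ^ 2 ∂sgm V) := by
    rw [gam_int, ← gauss_moment]
    have := pol_prod (V := V) (fun ρ => Real.exp (-(ρ^2/2)) * ρ^2) (fun x => f x ^ 2) (by fun_prop) (by fun_prop)
    rw [← this]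
    congr 1
    refine integral_congr_ae (Eventually.of_forall fun z => ?_)
    simp only [gp]; ring
  have htm := tang_meas f
  have hEg : ∫ x, ‖gradient (fun x : V => ‖x‖ * f (‖x‖⁻¹ • x)) x‖ ^ 2 ∂gam V = gc V * ((∫ ρ in Ioi (0:ℝ), ρ ^ m * Real.exp (-(ρ^2/2))) * ∫ θ : sphere (0:V) 1, (f θ ^ 2 + tang f θ) ∂sgm V) := by
    rw [gam_int]
    have := pol_prod (V := V) (fun ρ => Real.exp (-(ρ^2/2))) (fun x => f x ^ 2 + tang f x) (by fun_prop) (by fun_prop)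
    rw [← this]
    congr 1
    refine integral_congr_ae ?_
    have hne : ∀ᵐ x : V, x ≠ 0 := by
      rw [ae_iff]; simp
    filter_upwards [pol_ae_ray hd, hne] with x hx hx0
    have hg := grad_homog (χ := fun ρ => ρ) hx0 (hasDerivAt_id _) hx
    rw [hg.gradient, grad_homog_sq (unit_of_ne hx0), div_self (norm_ne_zero_iff.2 hx0)]
    simp only [gp]; ring
  have iT := sgm_bdd_int htm (fun θ h => tang_le hf h)
  have iS := sgm_cont_int (V := V) (f := fun x => f x ^ 2) (by fun_prop)
  rw [integral_add iS iT] at hEg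
  have hI := gauss_moment_pos m
  set I := ∫ ρ in Ioi (0:ℝ), ρ ^ m * Real.exp (-(ρ^2/2))
  have hg := gc_pos (V := V)
  have hfin := gauss_poincare_eq hM hE0 (by
    rw [hE2, hEg]
    refine mul_le_mul_of_nonneg_left ?_ hg.le
    nlinarith [mul_le_mul_of_nonneg_left hT hI.le])
  obtain ⟨a, ha⟩ := hfin
  refine ⟨a, fun θ h => ?_⟩
  have := ha θ
  simpa [h] using this

theorem sgm_int_pos {f : V → ℝ} (hf : Continuous f) (h0 : ∀ x, 0 ≤ f x) (h2 : 0 < ∫ θ : sphere (0:V) 1, f θ ^ 2 ∂sgm V) :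
    0 < ∫ θ : sphere (0:V) 1, f θ ∂sgm V := by
  refine lt_of_le_of_ne (integral_nonneg fun θ => h0 θ) fun h => h2.ne' ?_
  have := (integral_eq_zero_iff_of_nonneg (fun θ => h0 _) (sgm_cont_int hf)).1 h.symm
  rw [integral_eq_zero_iff_of_nonneg (fun θ => sq_nonneg _) (sgm_cont_int (f := fun x => f x ^ 2) (by fun_prop))]
  filter_upwards [this] with θ hθ
  simp only [Pi.zero_apply] at hθ ⊢
  rw [hθ]; ring

theorem lemF [Nontrivial V] {k : ℕ} (hN : Module.finrank ℝ V = k + 2) {v w : V → ℝ} {K : ℝ≥0} (hv : LipschitzWith K v) (hw : LipschitzWith K w)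
    (hv0 : ∀ x, 0 ≤ v x) (hw0 : ∀ x, 0 ≤ w x) (hvw : ∀ x, v x * w x = 0)
    (hdv : ∀ᵐ θ : sphere (0:V) 1 ∂sgm V, DifferentiableAt ℝ v θ) (hdw : ∀ᵐ θ : sphere (0:V) 1 ∂sgm V, DifferentiableAt ℝ w θ)
    (hHv : 0 < ∫ θ : sphere (0:V) 1, v θ ^ 2 ∂sgm V) (hHw : 0 < ∫ θ : sphere (0:V) 1, w θ ^ 2 ∂sgm V)
    (hTv : ∫ θ : sphere (0:V) 1, tang v θ ∂sgm V ≤ (k+1) * ∫ θ : sphere (0:V) 1, v θ ^ 2 ∂sgm V)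
    (hTw : ∫ θ : sphere (0:V) 1, tang w θ ∂sgm V ≤ (k+1) * ∫ θ : sphere (0:V) 1, w θ ^ 2 ∂sgm V) :
    ∃ (e : V) (kp km : ℝ), ‖e‖ = 1 ∧ 0 < kp ∧ 0 < km ∧ ∀ θ : V, ‖θ‖ = 1 → v θ = kp * max ⟪θ, e⟫ 0 ∧ w θ = km * max (-⟪θ, e⟫) 0 := by
  have hs := sgm_int_pos hw.continuous hw0 hHw
  have ht := sgm_int_pos hv.continuous hv0 hHv
  set s := ∫ θ : sphere (0:V) 1, w θ ∂sgm V
  set t := ∫ θ : sphere (0:V) 1, v θ ∂sgm V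
  have hvc := hv.continuous
  have hwc := hw.continuous
  have hf : LipschitzWith (Real.toNNReal (s * K + t * K)) (fun x => s * v x - t * w x) := by
    refine LipschitzWith.of_dist_le_mul fun x y => ?_
    rw [Real.coe_toNNReal _ (by positivity), Real.dist_eq]
    have h1 := hv.dist_le_mul x y
    have h2 := hw.dist_le_mul x y
    rw [Real.dist_eq] at h1 h2
    have e : s * v x - t * w x - (s * v y - t * w y) = s * (v x - v y) - t * (w x - w y) := by ring
    rw [e]
    refine (abs_sub _ _).trans ?_
    rw [abs_mul, abs_mul, abs_of_pos hs, abs_of_pos ht]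
    nlinarith
  have iv := sgm_cont_int hvc
  have iw := sgm_cont_int hwc
  have iv2 := sgm_cont_int (f := fun x => v x ^ 2) (by fun_prop)
  have iw2 := sgm_cont_int (f := fun x => w x ^ 2) (by fun_prop)
  have iTv := sgm_bdd_int (tang_meas v) (fun θ h => tang_le hv h)
  have iTw := sgm_bdd_int (tang_meas w) (fun θ h => tang_le hw h)
  have h0 : ∫ θ : sphere (0:V) 1, (s * v θ - t * w θ) ∂sgm V = 0 := by
    rw [integral_sub (iv.const_mul s) (iw.const_mul t), integral_const_mul, integral_const_mul]
    exact sub_eq_zero.2 (mul_comm _ _)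
  have h2 : ∫ θ : sphere (0:V) 1, (s * v θ - t * w θ)^2 ∂sgm V = s^2 * (∫ θ : sphere (0:V) 1, v θ ^ 2 ∂sgm V) + t^2 * ∫ θ : sphere (0:V) 1, w θ ^ 2 ∂sgm V := by
    rw [← integral_const_mul, ← integral_const_mul, ← integral_add (iv2.const_mul _) (iw2.const_mul _)]
    refine integral_congr_ae (Eventually.of_forall fun z => ?_)
    have := hvw z
    simp only
    linear_combination (-2 * s * t) * this
  have hT : ∫ θ : sphere (0:V) 1, tang (fun x => s * v x - t * w x) θ ∂sgm V = s^2 * (∫ θ : sphere (0:V) 1, tang v θ ∂sgm V) + t^2 * ∫ θ : sphere (0:V) 1, tang w θ ∂sgm V := by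
    rw [← integral_const_mul, ← integral_const_mul, ← integral_add (iTv.const_mul _) (iTw.const_mul _)]
    refine integral_congr_ae ?_
    filter_upwards [hdv, hdw] with θ h1 h2
    have hg : gradient (fun x => s * v x - t * w x) (θ:V) = s • gradient v (θ:V) - t • gradient w (θ:V) := by
      refine HasGradientAt.gradient ?_
      have := (h1.hasFDerivAt.const_mul s).sub (h2.hasFDerivAt.const_mul t)
      rw [hasGradientAt_iff_hasFDerivAt]
      refine this.congr_fderiv ?_
      simp [gradient]
    simp only [tang]
    rw [hg]
    rcases mul_eq_zero.1 (hvw (θ:V)) with h | h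
    · rw [grad_zero_of_min hv0 h]
      simp [norm_smul, inner_smul_left, mul_pow]; ring
    · rw [grad_zero_of_min hw0 h]
      simp [norm_smul, inner_smul_left, mul_pow]; ring
  obtain ⟨a, ha⟩ := sphere_poincare_eq hf (by
    filter_upwards [hdv, hdw] with θ h1 h2 using (h1.const_mul s).sub (h2.const_mul t)) h0 (by
    rw [hT, h2, hN]
    have : ((k + 2 - 1 : ℕ) : ℝ) = k + 1 := by push_cast [show k + 2 - 1 = k + 1 from rfl]; ring
    rw [this]
    nlinarith [mul_le_mul_of_nonneg_left hTv (sq_nonneg s), mul_le_mul_of_nonneg_left hTw (sq_nonneg t)])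
  have hane : a ≠ 0 := by
    rintro rfl
    have : ∫ θ : sphere (0:V) 1, (s * v θ - t * w θ)^2 ∂sgm V = 0 := by
      rw [← integral_zero (sphere (0:V) 1) ℝ (μ := sgm V)]
      refine integral_congr_ae (Eventually.of_forall fun z => ?_)
      have := ha z (by simpa using z.2)
      simp only [this, inner_zero_left]; norm_num
    rw [h2] at this
    have := mul_pos (pow_pos hs 2) hHv
    have := mul_pos (pow_pos ht 2) hHw
    linarith
  have han : 0 < ‖a‖ := norm_pos_iff.2 hane
  refine ⟨‖a‖⁻¹ • a, ‖a‖ / s, ‖a‖ / t, unit_of_ne hane, by positivity, by positivity, fun θ hθ => ?_⟩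
  have e1 := ha θ hθ
  have e2 : ⟪θ, ‖a‖⁻¹ • a⟫ = ‖a‖⁻¹ * (s * v θ - t * w θ) := by
    rw [inner_smul_right, real_inner_comm, e1]
  rw [e2]
  rcases mul_eq_zero.1 (hvw θ) with h | h
  · have := hw0 θ
    rw [h, max_eq_right, max_eq_left]
    · constructor
      · ring
      · field_simp; ring
    · have : 0 ≤ ‖a‖⁻¹ * (t * w θ) := by positivity
      linarith
    · have : 0 ≤ ‖a‖⁻¹ * (t * w θ) := by positivity
      linarith
  · have := hv0 θ
    rw [h, max_eq_left, max_eq_right]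
    · constructor
      · field_simp; ring
      · ring
    · have : 0 ≤ ‖a‖⁻¹ * (s * v θ) := by positivity
      linarith
    · have : 0 ≤ ‖a‖⁻¹ * (s * v θ) := by positivity
      linarith
end sphEq

section weaksub
variable {V : Type*} [NormedAddCommGroup V] [InnerProductSpace ℝ V] [FiniteDimensional ℝ V] [MeasurableSpace V] [BorelSpace V]

theorem moll_fderiv {ξ : V → ℝ} {K : ℝ≥0} (hξ : LipschitzWith K ξ) {ρ : V → ℝ} (hρ : Continuous ρ) (hs : HasCompactSupport ρ) (x : V) :
    HasFDerivAt (fun x => ∫ t, ρ t * ξ (x - t)) (∫ t, ρ t • fderiv ℝ ξ (x - t)) x := by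
  have hρi : Integrable ρ := hρ.integrable_of_hasCompactSupport hs
  have hc := hξ.continuous
  refine (hasFDerivAt_integral_of_dominated_loc_of_lip (𝕜 := ℝ) (F := fun x t => ρ t * ξ (x - t)) (F' := fun t => ρ t • fderiv ℝ ξ (x - t)) (bound := fun t => |ρ t| * K) (s := univ) univ_mem ?_ ?_ ?_ ?_ ?_ ?_).2
  · exact Eventually.of_forall fun y => (by fun_prop : Continuous _).aestronglyMeasurable
  · have : Continuous (fun t => ρ t * ξ (x - t)) := by fun_prop
    exact this.integrable_of_hasCompactSupport hs.mul_right
  · have := measurable_fderiv ℝ ξ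
    have h2 : Measurable (fun t => fderiv ℝ ξ (x - t)) := this.comp (by fun_prop)
    exact (hρ.measurable.smul h2).aestronglyMeasurable
  · refine Eventually.of_forall fun t => ?_
    refine LipschitzWith.lipschitzOnWith ?_
    refine LipschitzWith.of_dist_le_mul fun y z => ?_
    have h1 := hξ.dist_le_mul (y - t) (z - t)
    rw [Real.dist_eq, dist_sub_right] at h1
    rw [Real.dist_eq, ← mul_sub, abs_mul, Real.coe_nnabs, abs_of_nonneg (by positivity : 0 ≤ |ρ t| * (K:ℝ)), mul_assoc]
    exact mul_le_mul_of_nonneg_left h1 (abs_nonneg _)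
  · exact hρi.abs.mul_const _
  · have h1 : ∀ᵐ t : V, DifferentiableAt ℝ ξ (x - t) :=
      (Measure.measurePreserving_sub_left volume x).quasiMeasurePreserving.ae hξ.ae_differentiableAt
    filter_upwards [h1] with t ht
    have h2 : HasFDerivAt (fun y => ξ (y - t)) (fderiv ℝ ξ (x - t)) x := by
      have := HasFDerivAt.comp (g := ξ) (f := fun y : V => y - t) x ht.hasFDerivAt ((hasFDerivAt_id x).sub_const t)
      exact this
    exact h2.const_mul (ρ t)

theorem weak_sub {u ξ : V → ℝ} {K L : ℝ≥0} (hu : LipschitzWith L u) (hξ : LipschitzWith K ξ) (h0 : ∀ x, 0 ≤ ξ x) {M R : ℝ} (hMR : M < R)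
    (hM : ∀ x, M < ‖x‖ → ξ x = 0)
    (H : ∀ φ : V → ℝ, ContDiff ℝ ((⊤:ℕ∞):WithTop ℕ∞) φ → HasCompactSupport φ → tsupport φ ⊆ ball 0 R → (∀ x, 0 ≤ φ x) → ∫ x, ⟪gradient u x, gradient φ x⟫ ≤ 0) :
    ∫ x, ⟪gradient u x, gradient ξ x⟫ ≤ 0 := by
  have hc := hξ.continuous
  set d := (R - M) / 2 with hd
  have hdp : 0 < d := by rw [hd]; linarith
  have hjp : ∀ j : ℕ, 0 < d / (j + 1) := fun j => by positivity
  set b : ℕ → ContDiffBump (0 : V) := fun j => ⟨d / (j+1) / 2, d / (j+1), by have := hjp j; linarith, by have := hjp j; linarith⟩ with hb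
  set ρ : ℕ → V → ℝ := fun j => (b j).normed volume with hρ
  have hρc : ∀ j, Continuous (ρ j) := fun j => (b j).continuous_normed
  have hρs : ∀ j, HasCompactSupport (ρ j) := fun j => (b j).hasCompactSupport_normed
  have hρ0 : ∀ j t, 0 ≤ ρ j t := fun j t => (b j).nonneg_normed t
  have hρi : ∀ j, ∫ t, ρ j t = 1 := fun j => (b j).integral_normed
  have hρz : ∀ j t, d ≤ ‖t‖ → ρ j t = 0 := fun j t ht => by
    have : t ∉ Function.support (ρ j) := by
      rw [hρ, (b j).support_normed_eq]
      simp only [hb, mem_ball_zero_iff, not_lt]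
      refine le_trans ?_ ht
      exact div_le_self hdp.le (by linarith [Nat.cast_nonneg (α := ℝ) j])
    simpa using this
  set φ : ℕ → V → ℝ := fun j x => ∫ t, ρ j t * ξ (x - t) with hφ
  have hφd : ∀ j x, HasFDerivAt (φ j) (∫ t, ρ j t • fderiv ℝ ξ (x - t)) x := fun j x => moll_fderiv hξ (hρc j) (hρs j) x
  have hφz : ∀ j x, M + d < ‖x‖ → φ j x = 0 := fun j x hx => by
    rw [hφ]
    simp only
    rw [← integral_zero V ℝ]
    refine integral_congr_ae (Eventually.of_forall fun t => ?_)
    simp only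
    by_cases ht : d ≤ ‖t‖
    · rw [hρz j t ht, zero_mul]
    · rw [hM _ _, mul_zero]
      have := norm_sub_norm_le x t
      linarith
  have hφt : ∀ j, tsupport (φ j) ⊆ closedBall 0 (M + d) := fun j => by
    refine closure_minimal (fun x hx => ?_) isClosed_closedBall
    by_contra hn
    rw [mem_closedBall_zero_iff, not_le] at hn
    exact hx (hφz j x hn)
  have hMdR : M + d < R := by rw [hd]; linarith
  have hneg : ∀ j, ∫ x, ⟪gradient u x, gradient (φ j) x⟫ ≤ 0 := fun j => by
    refine H _ ?_ ?_ ?_ ?_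
    · have := (hρs j).contDiff_convolution_left (n := ⊤) (ContinuousLinearMap.lsmul ℝ ℝ) ((b j).contDiff_normed (n := ⊤) (μ := volume)) (hc.locallyIntegrable (μ := volume))
      exact this
    · exact (isCompact_closedBall (0:V) (M+d)).of_isClosed_subset (isClosed_tsupport _) (hφt j)
    · exact (hφt j).trans (closedBall_subset_ball hMdR)
    · exact fun x => integral_nonneg fun t => mul_nonneg (hρ0 j t) (h0 _)
  have hloc : LocallyIntegrable (fderiv ℝ ξ) volume := by
    refine (locallyIntegrable_const (K:ℝ)).mono (measurable_fderiv ℝ ξ).aestronglyMeasurable (Eventually.of_forall fun x => ?_)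
    simp only [Real.norm_eq_abs]
    rw [abs_of_nonneg K.coe_nonneg]
    exact norm_fderiv_le_of_lipschitz ℝ hξ
  have hr0 : Tendsto (fun j => (b j).rOut) atTop (nhds 0) := by
    have := (tendsto_one_div_add_atTop_nhds_zero_nat (𝕜 := ℝ)).const_mul d
    simpa [hb, div_eq_mul_inv] using this
  have hae : ∀ᵐ x : V, Tendsto (fun j => gradient (φ j) x) atTop (nhds (gradient ξ x)) := by
    have := ContDiffBump.ae_convolution_tendsto_right_of_locallyIntegrable (μ := (volume : Measure V)) (φ := b) (K := 2) hr0 (Eventually.of_forall fun j => by simp only [hb]; linarith) hloc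
    filter_upwards [this] with x hx
    have h2 := ((InnerProductSpace.toDual ℝ V).symm.continuous.tendsto _).comp hx
    refine h2.congr fun j => ?_
    simp only [Function.comp, gradient, (hφd j x).fderiv]
    rfl
  have hφl : ∀ j x, ‖gradient (φ j) x‖ ≤ K := fun j x => by
    have : ‖gradient (φ j) x‖ = ‖fderiv ℝ (φ j) x‖ := by simp [gradient]
    rw [this, (hφd j x).fderiv]
    have hi : Integrable (fun t => ρ j t * (K:ℝ)) := ((hρc j).integrable_of_hasCompactSupport (hρs j)).mul_const _
    refine (norm_integral_le_of_norm_le hi (Eventually.of_forall fun t => ?_)).trans (le_of_eq ?_)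
    · rw [norm_smul, Real.norm_eq_abs, abs_of_nonneg (hρ0 j t)]
      exact mul_le_mul_of_nonneg_left (norm_fderiv_le_of_lipschitz ℝ hξ) (hρ0 j t)
    · rw [integral_mul_const, hρi, one_mul]
  have hlim : Tendsto (fun j => ∫ x, ⟪gradient u x, gradient (φ j) x⟫) atTop (nhds (∫ x, ⟪gradient u x, gradient ξ x⟫)) := by
    have hgu := grad_meas u
    refine tendsto_integral_of_dominated_convergence ((closedBall (0:V) (M+d)).indicator fun _ => (L:ℝ) * K) ?_ ?_ ?_ ?_
    · intro j
      exact (hgu.inner (grad_meas (φ j))).aestronglyMeasurable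
    · exact (integrable_indicator_iff measurableSet_closedBall).2 (integrableOn_const (isCompact_closedBall _ _).measure_lt_top.ne)
    · intro j
      refine Eventually.of_forall fun x => ?_
      by_cases hx : x ∈ closedBall (0:V) (M+d)
      · rw [indicator_of_mem hx]
        exact (norm_inner_le_norm _ _).trans (mul_le_mul (grad_norm_le hu x) (hφl j x) (norm_nonneg _) L.coe_nonneg)
      · rw [indicator_of_notMem hx, grad_supp fun h => hx (hφt j h)]; simp
    · filter_upwards [hae] with x hx
      exact (tendsto_const_nhds (x := gradient u x)).inner hx
  exact le_of_tendsto' hlim hneg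
end weaksub

section A3
theorem lap_zero {n : ℕ} {φ : E n → ℝ} {x : E n} (hx : x ∉ tsupport φ) : lap φ x = 0 := by
  unfold lap
  refine Finset.sum_eq_zero fun i _ => ?_
  have h1 : (fun y => fderiv ℝ φ y (EuclideanSpace.single i 1)) =ᶠ[nhds x] fun _ => 0 := by
    filter_upwards [(isClosed_tsupport φ).isOpen_compl.mem_nhds hx] with y hy
    have : fderiv ℝ φ y = 0 := by
      by_contra hne
      exact hy (support_fderiv_subset ℝ (f := φ) hne)
    simp [this]
  rw [h1.fderiv_eq]; simp

theorem green_smooth {n : ℕ} {u φ : E n → ℝ} {L : ℝ≥0} (hu : LipschitzWith L u) (hφ : ContDiff ℝ ((⊤:ℕ∞):WithTop ℕ∞) φ) (hs : HasCompactSupport φ) :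
    ∫ x, ⟪gradient u x, gradient φ x⟫ = - ∫ x, u x * lap φ x := by
  have hg : ∀ i : Fin n, ContDiff ℝ 1 (fun y => fderiv ℝ φ y (EuclideanSpace.single i 1)) := fun i => by
    have : ContDiff ℝ 1 (fderiv ℝ φ) := hφ.fderiv_right (m := 1) (by norm_cast)
    exact this.clm_apply contDiff_const
  have hgs : ∀ i : Fin n, HasCompactSupport (fun y => fderiv ℝ φ y (EuclideanSpace.single i 1)) := fun i => hs.fderiv_apply ℝ _
  have key : ∀ i : Fin n, ∫ x, fderiv ℝ u x (EuclideanSpace.single i 1) * fderiv ℝ φ x (EuclideanSpace.single i 1) = - ∫ x, u x * fderiv ℝ (fun y => fderiv ℝ φ y (EuclideanSpace.single i 1)) x (EuclideanSpace.single i 1) := fun i => by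
    obtain ⟨D, hD⟩ := (hg i).lipschitzWith_of_hasCompactSupport (hgs i) (by simp)
    have := LipschitzWith.integral_lineDeriv_mul_eq (μ := volume) hu hD (hgs i) (EuclideanSpace.single i 1)
    rw [← integral_neg]
    have e1 : ∫ x, fderiv ℝ u x (EuclideanSpace.single i 1) * fderiv ℝ φ x (EuclideanSpace.single i 1) = ∫ x, lineDeriv ℝ u x (EuclideanSpace.single i 1) * fderiv ℝ φ x (EuclideanSpace.single i 1) := by
      refine integral_congr_ae ?_
      filter_upwards [hu.ae_differentiableAt] with x hx
      rw [hx.lineDeriv_eq_fderiv]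
    rw [e1, this]
    refine integral_congr_ae (Eventually.of_forall fun x => ?_)
    simp only
    rw [(((hg i).differentiable (by simp)) x).lineDeriv_eq_fderiv, map_neg]
    ring
  have hmu := measurable_fderiv ℝ u
  have e2 : ∀ x, ⟪gradient u x, gradient φ x⟫ = ∑ i : Fin n, fderiv ℝ u x (EuclideanSpace.single i 1) * fderiv ℝ φ x (EuclideanSpace.single i 1) := fun x => by
    rw [PiLp.inner_apply]
    refine Finset.sum_congr rfl fun i _ => ?_
    have hh : ∀ f : E n → ℝ, fderiv ℝ f x (EuclideanSpace.single i 1) = (gradient f x) i := fun f => by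
      rw [← grad_inner, EuclideanSpace.inner_single_right, one_mul]; rfl
    rw [hh, hh]
    simp [mul_comm]
  simp only [e2, lap, Finset.mul_sum]
  rw [integral_finset_sum, integral_finset_sum, ← Finset.sum_neg_distrib]
  · exact Finset.sum_congr rfl fun i _ => key i
  · intro i _
    have h1 := (hg i).continuous_fderiv (by simp)
    have h2 := hu.continuous
    have : Continuous (fun x => u x * fderiv ℝ (fun y => fderiv ℝ φ y (EuclideanSpace.single i 1)) x (EuclideanSpace.single i 1)) := by fun_prop
    refine this.integrable_of_hasCompactSupport ?_
    exact ((hgs i).fderiv_apply ℝ _).mul_left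
  · intro i _
    have h1 : Integrable (fun y => fderiv ℝ φ y (EuclideanSpace.single i 1)) := (hg i).continuous.integrable_of_hasCompactSupport (hgs i)
    refine h1.bdd_mul (c := L * ‖(EuclideanSpace.single i 1 : E n)‖) (hmu.apply_continuousLinearMap _).aestronglyMeasurable ?_
    refine Eventually.of_forall fun x => ?_
    exact (ContinuousLinearMap.le_opNorm _ _).trans (mul_le_mul_of_nonneg_right (norm_fderiv_le_of_lipschitz ℝ hu) (norm_nonneg _))

theorem weak_sub_E {n : ℕ} {v u : E n → ℝ} {L : ℝ≥0} (hu : LipschitzWith L u) {R : ℝ} (hR : R ≤ 1) (hv : SubharmonicOn (B1 n) v) (huv : ∀ x ∈ ball 0 R, u x = v x)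
    {ξ : E n → ℝ} {K : ℝ≥0} (hξ : LipschitzWith K ξ) (h0 : ∀ x, 0 ≤ ξ x) {M : ℝ} (hMR : M < R) (hM : ∀ x, M < ‖x‖ → ξ x = 0) :
    ∫ x, ⟪gradient u x, gradient ξ x⟫ ≤ 0 := by
  refine weak_sub hu hξ h0 hMR hM fun φ hφ hs ht hp => ?_
  rw [green_smooth hu hφ hs, neg_nonpos]
  have := hv φ hφ hs (ht.trans (ball_subset_ball hR)) hp
  refine this.trans (le_of_eq ?_)
  have e : ∫ x, u x * lap φ x = ∫ x in B1 n, u x * lap φ x := by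
    symm
    refine setIntegral_eq_integral_of_forall_compl_eq_zero fun x hx => ?_
    rw [lap_zero fun h => hx (ball_subset_ball hR (ht h)), mul_zero]
  rw [e]
  refine integral_congr_ae (Eventually.of_forall fun x => ?_)
  simp only
  by_cases hx : x ∈ tsupport φ
  · rw [huv x (ht hx)]
  · rw [lap_zero hx, mul_zero, mul_zero]
end A3

section E1
variable {V : Type*} [NormedAddCommGroup V] [InnerProductSpace ℝ V] [FiniteDimensional ℝ V] [MeasurableSpace V] [BorelSpace V]

/-- spherical integral -/
def sav (f : V → ℝ) (ρ : ℝ) : ℝ := ∫ θ : sphere (0:V) 1, f (ρ • (θ:V)) ∂sgm V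

/-- radial derivative -/
def nuD (u : V → ℝ) (x : V) : ℝ := ⟪gradient u x, ‖x‖⁻¹ • x⟫

theorem nuD_meas (u : V → ℝ) : Measurable (nuD u) := by
  have := grad_meas u
  unfold nuD; fun_prop

theorem nuD_le {u : V → ℝ} {K : ℝ≥0} (hu : LipschitzWith K u) (x : V) : |nuD u x| ≤ K := by
  have h2 : ‖‖x‖⁻¹ • x‖ ≤ 1 := by
    by_cases hx : x = 0
    · simp [hx]
    · exact (unit_of_ne hx).le
  have := abs_real_inner_le_norm (gradient u x) (‖x‖⁻¹ • x)
  have h3 := grad_norm_le hu x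
  unfold nuD
  nlinarith [norm_nonneg (gradient u x), norm_nonneg (‖x‖⁻¹ • x)]

theorem sav_meas {f : V → ℝ} (hf : Measurable f) : Measurable (sav f) := by
  have : Measurable (fun p : ℝ × sphere (0:V) 1 => f (p.1 • (p.2 : V))) := hf.comp (by fun_prop)
  exact (this.stronglyMeasurable.integral_prod_right (ν := sgm V)).measurable

theorem sav_integrable {f : V → ℝ} (hf : Measurable f) {C : ℝ} (hC : ∀ x, |f x| ≤ C) (ρ : ℝ) :
    Integrable (fun θ : sphere (0:V) 1 => f (ρ • (θ:V))) (sgm V) :=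
  sgm_bdd_int (f := fun x => f (ρ • x)) (hf.comp (by fun_prop)) (fun θ _ => hC _)

theorem sav_bdd {f : V → ℝ} {C : ℝ} (hC : ∀ x, |f x| ≤ C) (ρ : ℝ) :
    |sav f ρ| ≤ C * (sgm V).real univ := by
  have := norm_integral_le_of_norm_le_const (μ := sgm V) (f := fun θ : sphere (0:V) 1 => f (ρ • (θ:V))) (C := C) (Eventually.of_forall fun θ => hC _)
  exact this

theorem sav_nonneg {f : V → ℝ} (h : ∀ x, 0 ≤ f x) (ρ : ℝ) : 0 ≤ sav f ρ := integral_nonneg fun θ => h _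

theorem sav_ae [Nontrivial V] {f g : V → ℝ} (h : ∀ᵐ x, f x = g x) : ∀ᵐ ρ ∂(volume.restrict (Ioi (0:ℝ))), sav f ρ = sav g ρ := by
  filter_upwards [pol_ae h] with ρ hρ
  exact integral_congr_ae hρ

theorem pol_int' [Nontrivial V] {k : ℕ} (hN : Module.finrank ℝ V = k + 2) {f : V → ℝ} (hf : Integrable f) :
    ∫ x, f x = ∫ ρ in Ioi (0:ℝ), ρ ^ (k+1) * sav f ρ := by
  rw [pol_int hf, hN]; rfl

theorem ii_bdd {f : ℝ → ℝ} (hf : Measurable f) {C : ℝ} (hC : ∀ x, |f x| ≤ C) (a b : ℝ) : IntervalIntegrable f volume a b := by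
  rw [intervalIntegrable_iff]
  haveI : IsFiniteMeasure (volume.restrict (uIoc a b)) := ⟨by simp [uIoc]⟩
  exact Integrable.of_bound hf.aestronglyMeasurable C (Eventually.of_forall hC)

theorem sav_swap {f : V → ℝ} (hf : Measurable f) {C : ℝ} (hC : ∀ x, |f x| ≤ C) {a b : ℝ} :
    ∫ ρ in a..b, sav f ρ = ∫ θ : sphere (0:V) 1, (∫ ρ in a..b, f (ρ • (θ:V))) ∂sgm V := by
  unfold sav
  refine (intervalIntegral_integral_swap ?_)
  haveI : IsFiniteMeasure (volume.restrict (uIoc a b)) := ⟨by simp [uIoc]⟩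
  refine Integrable.of_bound (C := C) ?_ (Eventually.of_forall fun p => hC _)
  have : Measurable (fun p : ℝ × sphere (0:V) 1 => f (p.1 • (p.2 : V))) := hf.comp (by fun_prop)
  exact this.aestronglyMeasurable

theorem pol_ae_swap [Nontrivial V] {P : V → Prop} (h : ∀ᵐ x, P x) :
    ∀ᵐ θ : sphere (0:V) 1 ∂sgm V, ∀ᵐ ρ ∂(volume.restrict (Ioi (0:ℝ))), P (ρ • (θ : V)) := by
  have h1 := (pol (V := V)).quasiMeasurePreserving.ae h
  have h3 := Measure.ae_ae_of_ae_prod h1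
  simp only [radM_ae] at h3
  exact h3

theorem pol_ae_rad [Nontrivial V] {Q : ℝ → Prop} (h : ∀ᵐ ρ, Q ρ) : ∀ᵐ x : V, Q ‖x‖ := by
  have h0 : volume {ρ | ¬ Q ρ} = 0 := h
  obtain ⟨t, ht, htm, ht0⟩ := exists_measurable_superset_of_null h0
  have hn : Measurable (fun x : V => ‖x‖) := measurable_norm
  have key : volume ((fun x : V => ‖x‖) ⁻¹' t) = 0 := by
    rw [← (pol (V := V)).map_eq, Measure.map_apply (pol (V := V)).measurable (hn htm)]
    have ha : ∀ᵐ ρ ∂(radM (Module.finrank ℝ V - 1)), ρ ∈ Ioi (0:ℝ) ∧ ρ ∉ t := (radM_ae _).2 (by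
      filter_upwards [ae_restrict_mem measurableSet_Ioi, ae_restrict_of_ae (compl_mem_ae_iff.2 ht0)] with ρ h1 h2 using ⟨h1, h2⟩)
    have h3 := (Measure.quasiMeasurePreserving_snd (μ := sgm V) (ν := radM (Module.finrank ℝ V - 1))).ae ha
    refine measure_mono_null ?_ (ae_iff.1 h3)
    rintro ⟨θ, ρ⟩ hp ⟨h1, h2⟩
    simp only [mem_preimage] at hp
    rw [(ray_norm θ h1).1] at hp
    exact h2 hp
  rw [ae_iff]
  exact measure_mono_null (fun x hx => ht hx) key

theorem lip_rad {g : ℝ → ℝ} {L : ℝ≥0} (hg : LipschitzWith L g) : LipschitzWith L (fun x : V => g ‖x‖) := by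
  have := hg.comp (lipschitzWith_one_norm (E := V))
  rw [mul_one] at this; exact this

theorem grad_mul_rad {u : V → ℝ} {g : ℝ → ℝ} {x : V} (hx : x ≠ 0) (hu : DifferentiableAt ℝ u x) (hg : DifferentiableAt ℝ g ‖x‖) :
    gradient (fun y => u y * g ‖y‖) x = g ‖x‖ • gradient u x + (u x * deriv g ‖x‖) • (‖x‖⁻¹ • x) := by
  refine HasGradientAt.gradient ?_
  rw [hasGradientAt_iff_hasFDerivAt]
  have h1 := hg.hasDerivAt.comp_hasFDerivAt x (norm_hasFDeriv hx)
  refine (hu.hasGradientAt.hasFDerivAt.mul h1).congr_fderiv ?_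
  ext v
  simp [inner_smul_left]
  ring

/-- weak subharmonicity -/
def WSub (R : ℝ) (u : V → ℝ) : Prop := ∀ (ξ : V → ℝ) (K : ℝ≥0), LipschitzWith K ξ → (∀ x, 0 ≤ ξ x) → ∀ M < R, (∀ x, M < ‖x‖ → ξ x = 0) → ∫ x, ⟪gradient u x, gradient ξ x⟫ ≤ 0

theorem weak_rad0 [Nontrivial V] {u : V → ℝ} {K : ℝ≥0} (hu : LipschitzWith K u) {C : ℝ} (hC : ∀ x, |u x| ≤ C) (h0 : ∀ x, 0 ≤ u x) {R : ℝ} (hW : WSub R u)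
    {g : ℝ → ℝ} {L : ℝ≥0} (hg : LipschitzWith L g) (hg0 : ∀ ρ, 0 ≤ g ρ) {G : ℝ} (hG : ∀ ρ, |g ρ| ≤ G) {M : ℝ} (hMR : M < R) (hM : ∀ ρ, M < ρ → g ρ = 0) :
    ∫ x : V, (g ‖x‖ * ‖gradient u x‖ ^ 2 + deriv g ‖x‖ * (u x * nuD u x)) ≤ 0 := by
  obtain ⟨K', hK'⟩ := lip_mul_bdd hu (lip_rad (V := V) hg) hC (fun x => hG ‖x‖)
  have := hW (fun x => u x * g ‖x‖) K' hK' (fun x => mul_nonneg (h0 x) (hg0 _)) M hMR (fun x hx => by simp only [hM _ hx, mul_zero])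
  refine (le_of_eq ?_).trans this
  refine integral_congr_ae ?_
  have hne : ∀ᵐ x : V, x ≠ 0 := by
    rw [ae_iff]; simp
  filter_upwards [hne, hu.ae_differentiableAt, pol_ae_rad (V := V) hg.ae_differentiableAt] with x h1 h2 h3
  rw [grad_mul_rad h1 h2 h3, inner_add_right, inner_smul_right, inner_smul_right, real_inner_self_eq_norm_sq, nuD]
  ring

theorem weak_rad [Nontrivial V] {k : ℕ} (hN : Module.finrank ℝ V = k + 2) {u : V → ℝ} {K : ℝ≥0} (hu : LipschitzWith K u) {C : ℝ} (hC : ∀ x, |u x| ≤ C) (h0 : ∀ x, 0 ≤ u x) {R : ℝ} (hW : WSub R u)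
    {g : ℝ → ℝ} {L : ℝ≥0} (hg : LipschitzWith L g) (hg0 : ∀ ρ, 0 ≤ g ρ) {G : ℝ} (hG : ∀ ρ, |g ρ| ≤ G) {M : ℝ} (hMR : M < R) (hM : ∀ ρ, M < ρ → g ρ = 0) :
    ∫ ρ in Ioi (0:ℝ), ρ ^ (k+1) * (g ρ * sav (fun x => ‖gradient u x‖ ^ 2) ρ + deriv g ρ * sav (fun x => u x * nuD u x) ρ) ≤ 0 := by
  have key := weak_rad0 hu hC h0 hW hg hg0 hG hMR hM
  have hgm := grad_meas u
  have hnm := nuD_meas u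
  have huc := hu.continuous
  have hgc := hg.continuous
  have hdm := measurable_deriv g
  have hb1 : ∀ x, |‖gradient u x‖ ^ 2| ≤ (K:ℝ) ^ 2 := fun x => by
    rw [abs_of_nonneg (sq_nonneg _)]; exact pow_le_pow_left₀ (norm_nonneg _) (grad_norm_le hu x) 2
  have hb2 : ∀ x, |u x * nuD u x| ≤ C * K := fun x => by
    rw [abs_mul]; exact mul_le_mul (hC x) (nuD_le hu x) (abs_nonneg _) ((abs_nonneg _).trans (hC x))
  have hm2 : Measurable (fun x => u x * nuD u x) := huc.measurable.mul hnm
  have hdb : ∀ ρ, |deriv g ρ| ≤ L := fun ρ => norm_deriv_le_of_lipschitz hg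
  have hdz : ∀ ρ, M < ρ → deriv g ρ = 0 := fun ρ hρ => by
    have : g =ᶠ[nhds ρ] fun _ => 0 := by
      filter_upwards [lt_mem_nhds hρ] with y hy using hM y hy
    rw [this.deriv_eq]; simp
  rw [pol_int' hN] at key
  · refine (le_of_eq ?_).trans key
    refine setIntegral_congr_fun measurableSet_Ioi fun ρ hρ => ?_
    congr 1
    have e : sav (fun x : V => g ‖x‖ * ‖gradient u x‖ ^ 2 + deriv g ‖x‖ * (u x * nuD u x)) ρ = ∫ θ : sphere (0:V) 1, (g ρ * ‖gradient u (ρ • (θ:V))‖ ^ 2 + deriv g ρ * (u (ρ • (θ:V)) * nuD u (ρ • (θ:V)))) ∂sgm V := by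
      refine integral_congr_ae (Eventually.of_forall fun θ => ?_)
      simp only [(ray_norm θ hρ).1]
    rw [e, integral_add, integral_const_mul, integral_const_mul]; rfl
    · exact (sav_integrable (by fun_prop) hb1 ρ).const_mul _
    · exact (sav_integrable hm2 hb2 ρ).const_mul _
  · refine bdd_ball_int (C := G * K^2 + L * (C*K)) (M := M) (by fun_prop) (fun x => ?_) (fun x hx => ?_)
    · refine (abs_add_le _ _).trans (add_le_add ?_ ?_)
      · rw [abs_mul]; exact mul_le_mul (hG _) (hb1 x) (abs_nonneg _) ((abs_nonneg _).trans (hG 0))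
      · rw [abs_mul]; exact mul_le_mul (hdb _) (hb2 x) (abs_nonneg _) L.coe_nonneg
    · rw [hM _ hx, hdz _ hx]; ring
end E1

section E2

theorem pow_inv_lip {ε : ℝ} (hε : 0 < ε) (k : ℕ) : (∃ L : ℝ≥0, LipschitzWith L (fun ρ : ℝ => ((max ρ ε)⁻¹)^k)) ∧ ∀ ρ : ℝ, |((max ρ ε)⁻¹)^k| ≤ (ε⁻¹)^k := by
  have hb : ∀ ρ : ℝ, |(max ρ ε)⁻¹| ≤ ε⁻¹ := fun ρ => by
    have h : ε ≤ max ρ ε := le_max_right _ _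
    rw [abs_of_nonneg (by have := hε.trans_le h; positivity)]
    exact inv_anti₀ hε h
  have h1 : LipschitzWith (ε⁻¹ * ε⁻¹).toNNReal (fun ρ : ℝ => (max ρ ε)⁻¹) := by
    refine LipschitzWith.of_dist_le_mul fun x y => ?_
    rw [Real.coe_toNNReal _ (by positivity), Real.dist_eq, Real.dist_eq]
    have hx : 0 < max x ε := hε.trans_le (le_max_right _ _)
    have hy : 0 < max y ε := hε.trans_le (le_max_right _ _)
    have e : (max x ε)⁻¹ - (max y ε)⁻¹ = (max x ε)⁻¹ * (max y ε)⁻¹ * (max y ε - max x ε) := by field_simp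
    rw [e, abs_mul, abs_mul]
    have h3 := abs_max_sub_max_le_abs y x ε
    rw [abs_sub_comm y x] at h3
    exact mul_le_mul (mul_le_mul (hb x) (hb y) (abs_nonneg _) (by positivity)) h3 (abs_nonneg _) (by positivity)
  induction k with
  | zero => exact ⟨⟨0, by simpa using LipschitzWith.const (1:ℝ)⟩, by simp⟩
  | succ k ih =>
    obtain ⟨⟨L, hL⟩, hB⟩ := ih
    constructor
    · simp only [pow_succ]
      exact lip_mul_bdd hL h1 hB hb
    · intro ρ
      rw [pow_succ, pow_succ, abs_mul]
      exact mul_le_mul (hB ρ) (hb ρ) (abs_nonneg _) (by positivity)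

theorem cut_lip {h : ℝ} (hh : 0 < h) (s : ℝ) : LipschitzWith (h⁻¹).toNNReal (fun ρ : ℝ => min 1 (max 0 ((s - ρ)/h))) := by
  have h1 : LipschitzWith (h⁻¹).toNNReal (fun ρ : ℝ => (s - ρ)/h) := by
    refine LipschitzWith.of_dist_le_mul fun x y => ?_
    rw [Real.coe_toNNReal _ (by positivity), Real.dist_eq, Real.dist_eq]
    have : (s - x)/h - (s-y)/h = h⁻¹ * (y - x) := by field_simp; ring
    rw [this, abs_mul, abs_of_pos (inv_pos.2 hh), abs_sub_comm]
  exact (h1.const_max 0).const_min 1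

theorem oneD_h {k : ℕ} {b κ : ℝ → ℝ} (hbm : Measurable b) (hκm : Measurable κ) {C R : ℝ} (hb0 : ∀ ρ, 0 ≤ b ρ) (hbC : ∀ ρ, |b ρ| ≤ C) (hκC : ∀ ρ, |κ ρ| ≤ C)
    (hw : ∀ (g : ℝ → ℝ) (L : ℝ≥0) (G M : ℝ), LipschitzWith L g → (∀ ρ, 0 ≤ g ρ) → (∀ ρ, |g ρ| ≤ G) → M < R → (∀ ρ, M < ρ → g ρ = 0) →
      ∫ ρ in Ioi (0:ℝ), ρ ^ (k+1) * (g ρ * b ρ + deriv g ρ * κ ρ) ≤ 0)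
    {ε r h : ℝ} (hε : 0 < ε) (hεr : ε < r) (hh : 0 < h) (hR : r + h < R) :
    ∫ ρ in ε..r, (ρ * b ρ - k * κ ρ) ≤ h⁻¹ * (∫ ρ in r..(r+h), ρ * κ ρ) + k * C * h := by
  obtain ⟨⟨L, hL⟩, hqB⟩ := pow_inv_lip hε k
  have hc := cut_lip hh (r+h)
  set c : ℝ → ℝ := fun ρ : ℝ => min 1 (max 0 ((r + h - ρ)/h)) with hcdef
  have hc0 : ∀ ρ, 0 ≤ c ρ := fun ρ => le_min zero_le_one (le_max_left _ _)
  have hc1 : ∀ ρ, c ρ ≤ 1 := fun ρ => min_le_left _ _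
  have hq0 : ∀ ρ : ℝ, 0 ≤ ((max ρ ε)⁻¹)^k := fun ρ => by
    have : 0 < max ρ ε := hε.trans_le (le_max_right _ _)
    positivity
  have hcone : ∀ ρ, ρ ≤ r → c ρ = 1 := fun ρ hρ => by
    refine min_eq_left (le_max_of_le_right ?_)
    rw [le_div_iff₀ hh]; linarith
  have hcz : ∀ ρ, r + h ≤ ρ → c ρ = 0 := fun ρ hρ => by
    have : (r + h - ρ)/h ≤ 0 := div_nonpos_of_nonpos_of_nonneg (by linarith) hh.le
    simp only [hcdef, max_eq_left this]; simp
  have hcm : ∀ ρ, r ≤ ρ → ρ ≤ r + h → c ρ = (r+h-ρ)/h := fun ρ h1 h2 => by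
    have : 0 ≤ (r + h - ρ)/h := div_nonneg (by linarith) hh.le
    simp only [hcdef, max_eq_right this]
    refine min_eq_right ?_
    rw [div_le_iff₀ hh]; linarith
  obtain ⟨Lg, hg⟩ := lip_mul_bdd hL hc hqB (fun ρ => by rw [abs_of_nonneg (hc0 ρ)]; exact hc1 ρ)
  set g : ℝ → ℝ := fun ρ => ((max ρ ε)⁻¹)^k * c ρ with hgdef
  have hgB : ∀ ρ, |g ρ| ≤ (ε⁻¹)^k := fun ρ => by
    rw [hgdef]; simp only; rw [abs_mul, abs_of_nonneg (hc0 ρ)]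
    nlinarith [hqB ρ, hc1 ρ, hc0 ρ, abs_nonneg (((max ρ ε)⁻¹)^k), pow_pos (inv_pos.2 hε) k]
  have hgz : ∀ ρ, r + h ≤ ρ → g ρ = 0 := fun ρ hρ => by simp only [hgdef, hcz ρ hρ, mul_zero]
  have key := hw g Lg _ (r+h) hg (fun ρ => mul_nonneg (hq0 ρ) (hc0 ρ)) hgB hR (fun ρ hρ => hgz ρ hρ.le)
  have hdm := measurable_deriv g
  have hgc := hg.continuous
  have hC0 : 0 ≤ C := (abs_nonneg _).trans (hbC 0)
  have hdb : ∀ ρ, |deriv g ρ| ≤ Lg := fun ρ => norm_deriv_le_of_lipschitz hg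
  -- derivatives
  have d1 : ∀ ρ, 0 < ρ → ρ < ε → deriv g ρ = 0 := fun ρ _ h1 => by
    have : g =ᶠ[nhds ρ] fun _ => (ε⁻¹)^k := by
      filter_upwards [gt_mem_nhds h1] with y hy
      simp only [hgdef, hcone y (hy.trans hεr).le, max_eq_right hy.le, mul_one]
    rw [this.deriv_eq]; simp
  have dp : ∀ ρ : ℝ, 0 < ρ → HasDerivAt (fun ρ : ℝ => (ρ⁻¹)^k) (-(k * (ρ⁻¹)^(k+1))) ρ := fun ρ hρ => by
    refine ((hasDerivAt_inv hρ.ne').pow k).congr_deriv ?_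
    rcases k with _ | k
    · simp
    · simp only [Nat.add_sub_cancel]
      push_cast
      have e : (ρ^2)⁻¹ = ρ⁻¹^2 := by rw [inv_pow]
      rw [e]; ring
  have d2 : ∀ ρ, ε < ρ → ρ < r → deriv g ρ = -(k * (ρ⁻¹)^(k+1)) := fun ρ h1 h2 => by
    have : g =ᶠ[nhds ρ] fun ρ => (ρ⁻¹)^k := by
      filter_upwards [gt_mem_nhds h2, lt_mem_nhds h1] with y hy hy2
      simp only [hgdef, hcone y hy.le, max_eq_left hy2.le, mul_one]
    rw [this.deriv_eq]; exact (dp ρ (hε.trans h1)).deriv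
  have d3 : ∀ ρ, r < ρ → ρ < r + h → deriv g ρ = -(k * (ρ⁻¹)^(k+1)) * ((r + h - ρ)/h) + (ρ⁻¹)^k * (-h⁻¹) := fun ρ h1 h2 => by
    have : g =ᶠ[nhds ρ] fun ρ => (ρ⁻¹)^k * ((r + h - ρ)/h) := by
      filter_upwards [gt_mem_nhds h2, lt_mem_nhds h1] with y hy hy2
      simp only [hgdef, hcm y hy2.le hy.le, max_eq_left (hεr.trans hy2).le]
    rw [this.deriv_eq]
    refine HasDerivAt.deriv ?_
    refine (dp ρ ((hε.trans hεr).trans h1)).mul ?_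
    refine (((hasDerivAt_id ρ).const_sub (r+h)).div_const h).congr_deriv ?_
    rw [neg_div, one_div]
  have d4 : ∀ ρ, r + h < ρ → deriv g ρ = 0 := fun ρ h1 => by
    have : g =ᶠ[nhds ρ] fun _ => 0 := by
      filter_upwards [lt_mem_nhds h1] with y hy
      exact hgz y hy.le
    rw [this.deriv_eq]; simp
  -- integrability
  set f : ℝ → ℝ := fun ρ => ρ ^ (k+1) * (g ρ * b ρ + deriv g ρ * κ ρ) with hf
  have hfm : Measurable f := by fun_prop
  have hrp : 0 < r := hε.trans hεr
  have hfi : IntegrableOn f (Ioi 0) := by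
    rw [← Ioc_union_Ioi_eq_Ioi (show (0:ℝ) ≤ r + h by linarith)]
    refine IntegrableOn.union ?_ ?_
    · refine Measure.integrableOn_of_bounded (M := (r+h)^(k+1) * ((ε⁻¹)^k * C + Lg * C)) (by simp) hfm.aestronglyMeasurable ?_
      filter_upwards [ae_restrict_mem measurableSet_Ioc] with ρ hρ
      rw [hf, Real.norm_eq_abs]; simp only
      rw [abs_mul, abs_of_nonneg (pow_nonneg hρ.1.le _)]
      refine mul_le_mul (pow_le_pow_left₀ hρ.1.le hρ.2 _) ?_ (abs_nonneg _) (by positivity)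
      refine (abs_add_le _ _).trans (add_le_add ?_ ?_)
      · rw [abs_mul]; exact mul_le_mul (hgB ρ) (hbC ρ) (abs_nonneg _) (by positivity)
      · rw [abs_mul]; exact mul_le_mul (hdb ρ) (hκC ρ) (abs_nonneg _) (by positivity)
    · refine (integrableOn_zero (μ := volume)).congr_fun (fun ρ hρ => ?_) measurableSet_Ioi
      simp only [hf, hgz ρ (le_of_lt hρ), d4 ρ hρ]; ring
  -- interval integrability
  have jj : ∀ a d : ℝ, IntervalIntegrable (fun ρ => ρ * b ρ) volume a d := fun a d => 
    (ii_bdd hbm hbC a d).continuousOn_mul continuousOn_id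
  have jκ : ∀ a d : ℝ, IntervalIntegrable (fun ρ => ρ * κ ρ) volume a d := fun a d => 
    (ii_bdd hκm hκC a d).continuousOn_mul continuousOn_id
  have j1 : IntervalIntegrable (fun ρ => ρ * b ρ - k * κ ρ) volume ε r := (jj _ _).sub ((ii_bdd hκm hκC _ _).const_mul _)
  have j2 : IntervalIntegrable (fun ρ => k * C + h⁻¹ * (ρ * κ ρ)) volume r (r+h) := intervalIntegrable_const.add ((jκ _ _).const_mul _)
  have i1 : Integrable ((Ioc ε r).indicator (fun ρ => ρ * b ρ - k * κ ρ)) (volume.restrict (Ioi 0)) :=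
    (((intervalIntegrable_iff_integrableOn_Ioc_of_le hεr.le).1 j1).integrable_indicator measurableSet_Ioc).mono_measure Measure.restrict_le_self
  have i2 : Integrable ((Ioc r (r+h)).indicator (fun ρ => k * C + h⁻¹ * (ρ * κ ρ))) (volume.restrict (Ioi 0)) :=
    (((intervalIntegrable_iff_integrableOn_Ioc_of_le (by linarith)).1 j2).integrable_indicator measurableSet_Ioc).mono_measure Measure.restrict_le_self
  have hle : ∫ ρ in Ioi (0:ℝ), ((Ioc ε r).indicator (fun ρ => ρ * b ρ - k * κ ρ) ρ - (Ioc r (r+h)).indicator (fun ρ => k * C + h⁻¹ * (ρ * κ ρ)) ρ) ≤ ∫ ρ in Ioi (0:ℝ), f ρ := by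
    refine integral_mono_ae (i1.sub i2) hfi ?_
    have hn : ∀ a : ℝ, ∀ᵐ ρ ∂(volume.restrict (Ioi (0:ℝ))), ρ ≠ a := fun a => ae_restrict_of_ae (by rw [ae_iff]; simp)
    filter_upwards [ae_restrict_mem measurableSet_Ioi, hn ε, hn r, hn (r+h)] with ρ h0 n1 n2 n3
    have h0' : (0:ℝ) < ρ := h0
    simp only [hf]
    rcases lt_or_gt_of_ne n1 with l1 | l1
    · rw [indicator_of_notMem (fun hx => absurd hx.1 (not_lt.2 l1.le)), indicator_of_notMem (fun hx => absurd hx.1 (not_lt.2 (l1.trans hεr).le)), d1 ρ h0 l1]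
      have : 0 ≤ g ρ := mul_nonneg (hq0 ρ) (hc0 ρ)
      have := hb0 ρ
      rw [zero_mul, add_zero, sub_zero]; positivity
    rcases lt_or_gt_of_ne n2 with l2 | l2
    · rw [indicator_of_mem (show ρ ∈ Ioc ε r from ⟨l1, l2.le⟩), indicator_of_notMem (fun hx => absurd hx.1 (not_lt.2 l2.le)), d2 ρ l1 l2]
      have : g ρ = (ρ⁻¹)^k := by simp only [hgdef, hcone ρ l2.le, max_eq_left (le_of_lt l1), mul_one]
      rw [this]
      refine le_of_eq ?_
      have e1 : ρ ^ (k+1) * (ρ⁻¹)^(k+1) = 1 := by rw [← mul_pow, mul_inv_cancel₀ h0'.ne', one_pow]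
      have e2 : ρ ^ (k+1) * (ρ⁻¹)^k = ρ := by rw [pow_succ, mul_right_comm, ← mul_pow, mul_inv_cancel₀ h0'.ne', one_pow, one_mul]
      linear_combination (-(b ρ)) * e2 + (k * κ ρ) * e1
    rcases lt_or_gt_of_ne n3 with l3 | l3
    · rw [indicator_of_notMem (fun hx => absurd hx.2 (not_le.2 l2)), indicator_of_mem (show ρ ∈ Ioc r (r+h) from ⟨l2, l3.le⟩), d3 ρ l2 l3]
      have e1 : ρ ^ (k+1) * (ρ⁻¹)^(k+1) = 1 := by rw [← mul_pow, mul_inv_cancel₀ h0'.ne', one_pow]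
      have e2 : ρ ^ (k+1) * (ρ⁻¹)^k = ρ := by rw [pow_succ, mul_right_comm, ← mul_pow, mul_inv_cancel₀ h0'.ne', one_pow, one_mul]
      have e3 : ρ ^ (k+1) * (g ρ * b ρ + (-(k * (ρ⁻¹)^(k+1)) * ((r + h - ρ)/h) + (ρ⁻¹)^k * (-h⁻¹)) * κ ρ) = ρ^(k+1) * (g ρ * b ρ) - k * (((r+h-ρ)/h) * κ ρ) - h⁻¹ * (ρ * κ ρ) := by
        linear_combination (- k * ((r+h-ρ)/h) * κ ρ) * e1 - (h⁻¹ * κ ρ) * e2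
      rw [e3]
      have p1 : 0 ≤ ρ^(k+1) * (g ρ * b ρ) := mul_nonneg (pow_nonneg h0'.le _) (mul_nonneg (mul_nonneg (hq0 ρ) (hc0 ρ)) (hb0 ρ))
      have p2 : ((r+h-ρ)/h) * κ ρ ≤ C := by
        have q1 : 0 ≤ (r+h-ρ)/h := div_nonneg (by linarith) hh.le
        have q2 : (r+h-ρ)/h ≤ 1 := by rw [div_le_iff₀ hh]; linarith
        have q3 := (abs_le.1 (hκC ρ)).2
        nlinarith
      have p3 := mul_le_mul_of_nonneg_left p2 (Nat.cast_nonneg (α := ℝ) k)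
      linarith
    · rw [indicator_of_notMem (fun hx => absurd hx.2 (not_le.2 l2)), indicator_of_notMem (fun hx => absurd hx.2 (not_le.2 l3)), d4 ρ l3, hgz ρ l3.le]
      simp
  have e0 := integral_sub i1 i2
  rw [e0, setIntegral_indicator measurableSet_Ioc, setIntegral_indicator measurableSet_Ioc] at hle
  have s1 : Ioi (0:ℝ) ∩ Ioc ε r = Ioc ε r := inter_eq_right.2 fun x hx => hε.trans hx.1
  have s2 : Ioi (0:ℝ) ∩ Ioc r (r+h) = Ioc r (r+h) := inter_eq_right.2 fun x hx => hrp.trans hx.1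
  rw [s1, s2, ← intervalIntegral.integral_of_le hεr.le, ← intervalIntegral.integral_of_le (by linarith), intervalIntegral.integral_add intervalIntegrable_const ((jκ _ _).const_mul _), intervalIntegral.integral_const_mul h⁻¹, intervalIntegral.integral_const] at hle
  simp only [smul_eq_mul] at hle
  linarith

theorem oneD {k : ℕ} {b κ : ℝ → ℝ} (hbm : Measurable b) (hκm : Measurable κ) {C R : ℝ} (hb0 : ∀ ρ, 0 ≤ b ρ) (hbC : ∀ ρ, |b ρ| ≤ C) (hκC : ∀ ρ, |κ ρ| ≤ C)
    (hw : ∀ (g : ℝ → ℝ) (L : ℝ≥0) (G M : ℝ), LipschitzWith L g → (∀ ρ, 0 ≤ g ρ) → (∀ ρ, |g ρ| ≤ G) → M < R → (∀ ρ, M < ρ → g ρ = 0) →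
      ∫ ρ in Ioi (0:ℝ), ρ ^ (k+1) * (g ρ * b ρ + deriv g ρ * κ ρ) ≤ 0) :
    ∀ᵐ r : ℝ, r ∈ Ioo 0 R → ∫ ρ in (0:ℝ)..r, ρ * b ρ ≤ k * (∫ ρ in (0:ℝ)..r, κ ρ) + r * κ r := by
  have jj : ∀ a d : ℝ, IntervalIntegrable (fun ρ => ρ * b ρ) volume a d := fun a d => 
    (ii_bdd hbm hbC a d).continuousOn_mul continuousOn_id
  have jκ : ∀ a d : ℝ, IntervalIntegrable (fun ρ => ρ * κ ρ) volume a d := fun a d => 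
    (ii_bdd hκm hκC a d).continuousOn_mul continuousOn_id
  have jk : ∀ a d : ℝ, IntervalIntegrable (fun ρ => k * κ ρ) volume a d := fun a d => (ii_bdd hκm hκC _ _).const_mul _
  have j1 : ∀ a d : ℝ, IntervalIntegrable (fun ρ => ρ * b ρ - k * κ ρ) volume a d := fun a d => (jj _ _).sub (jk _ _)
  have hloc : LocallyIntegrable (fun ρ => ρ * κ ρ) := by
    rw [locallyIntegrable_iff]
    intro K hK
    obtain ⟨a, d, h⟩ : ∃ a d, K ⊆ Icc a d := by
      obtain ⟨a, ha⟩ := hK.bddBelow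
      obtain ⟨d, hd⟩ := hK.bddAbove
      exact ⟨a, d, fun x hx => ⟨ha hx, hd hx⟩⟩
    by_cases had : a ≤ d
    · exact ((intervalIntegrable_iff_integrableOn_Icc_of_le had).1 (jκ a d)).mono_set h
    · rw [Icc_eq_empty had] at h
      rw [subset_empty_iff.1 h]; exact integrableOn_empty
  filter_upwards [LocallyIntegrable.ae_hasDerivAt_integral hloc] with r hr hrR
  have hd := hr r
  have step : ∀ ε, 0 < ε → ε < r → ∫ ρ in ε..r, (ρ * b ρ - k * κ ρ) ≤ r * κ r := by
    intro ε hε hεr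
    have ht := hd.tendsto_slope_zero_right
    have ht2 : Tendsto (fun h : ℝ => h⁻¹ * (∫ ρ in r..(r+h), ρ * κ ρ) + k * C * h) (nhdsWithin 0 (Ioi 0)) (nhds (r * κ r + k * C * 0)) := by
      refine Tendsto.add ?_ ?_
      · refine ht.congr fun h => ?_
        rw [smul_eq_mul, intervalIntegral.integral_interval_sub_left (jκ _ _) (jκ _ _)]
      · exact (tendsto_id.mono_left nhdsWithin_le_nhds).const_mul _
    rw [mul_zero, add_zero] at ht2
    refine ge_of_tendsto ht2 ?_
    have : ∀ᶠ h in nhdsWithin (0:ℝ) (Ioi 0), h < R - r := nhdsWithin_le_nhds (gt_mem_nhds (by linarith [hrR.2]))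
    filter_upwards [this, self_mem_nhdsWithin] with h h1 h2
    exact oneD_h hbm hκm hb0 hbC hκC hw hε hεr h2 (by linarith)
  have fin : ∫ ρ in (0:ℝ)..r, (ρ * b ρ - k * κ ρ) ≤ r * κ r := by
    have hc : Continuous (fun ε : ℝ => ∫ ρ in ε..r, (ρ * b ρ - k * κ ρ)) := by
      have := (intervalIntegral.continuous_primitive (fun a b => j1 a b) r).neg
      refine this.congr fun x => ?_
      simp only [Pi.neg_apply]
      rw [intervalIntegral.integral_symm x r, neg_neg]
    have ht : Tendsto (fun ε : ℝ => ∫ ρ in ε..r, (ρ * b ρ - k * κ ρ)) (nhdsWithin 0 (Ioi 0)) (nhds (∫ ρ in (0:ℝ)..r, (ρ * b ρ - k * κ ρ))) := (hc.tendsto 0).mono_left nhdsWithin_le_nhds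
    refine le_of_tendsto ht ?_
    have : ∀ᶠ h in nhdsWithin (0:ℝ) (Ioi 0), h < r := nhdsWithin_le_nhds (gt_mem_nhds hrR.1)
    filter_upwards [this, self_mem_nhdsWithin] with h h1 h2
    exact step h h2 h1
  rw [intervalIntegral.integral_sub (jj _ _) (jk _ _), intervalIntegral.integral_const_mul] at fin
  linarith
end E2

section E3
variable {V : Type*} [NormedAddCommGroup V] [InnerProductSpace ℝ V] [FiniteDimensional ℝ V] [MeasurableSpace V] [BorelSpace V]

theorem ray_deriv {u : V → ℝ} {θ : sphere (0:V) 1} {ρ : ℝ} (hρ : 0 < ρ) (hu : DifferentiableAt ℝ u (ρ • (θ:V))) :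
    HasDerivAt (fun s : ℝ => u (s • (θ:V))) (nuD u (ρ • (θ:V))) ρ := by
  have h1 : HasDerivAt (fun s : ℝ => s • (θ:V)) ((1:ℝ) • (θ:V)) ρ := (hasDerivAt_id ρ).smul_const _
  have h2 := hu.hasFDerivAt.comp_hasDerivAt ρ h1
  refine h2.congr_deriv ?_
  unfold nuD
  rw [(ray_norm θ hρ).2, grad_inner, one_smul]

theorem ray_lip {u : V → ℝ} {K : ℝ≥0} (hu : LipschitzWith K u) (θ : sphere (0:V) 1) : LipschitzWith K (fun s : ℝ => u (s • (θ:V))) := by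
  refine LipschitzWith.of_dist_le_mul fun x y => ?_
  refine (hu.dist_le_mul _ _).trans ?_
  refine mul_le_mul_of_nonneg_left (le_of_eq ?_) K.2
  have h : ‖(θ : V)‖ = 1 := by simpa using θ.2
  rw [dist_eq_norm, ← sub_smul, norm_smul, h, mul_one, dist_eq_norm]

theorem sav_sq_ftc [Nontrivial V] {u : V → ℝ} {K : ℝ≥0} (hu : LipschitzWith K u) {C : ℝ} (hC : ∀ x, |u x| ≤ C) {a b : ℝ} (ha : 0 ≤ a) (hab : a ≤ b) :
    2 * ∫ ρ in a..b, sav (fun x => u x * nuD u x) ρ = sav (fun x => u x ^ 2) b - sav (fun x => u x ^ 2) a := by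
  have hm2 : Measurable (fun x => u x * nuD u x) := hu.continuous.measurable.mul (nuD_meas u)
  have hb2 : ∀ x, |u x * nuD u x| ≤ C * K := fun x => by
    rw [abs_mul]; exact mul_le_mul (hC x) (nuD_le hu x) (abs_nonneg _) ((abs_nonneg _).trans (hC x))
  have hb3 : ∀ x, |u x ^ 2| ≤ C ^ 2 := fun x => by
    rw [abs_pow]; exact pow_le_pow_left₀ (abs_nonneg _) (hC x) 2
  have hm3 : Measurable (fun x => u x ^ 2) := hu.continuous.measurable.pow_const 2
  rw [sav_swap hm2 hb2, ← integral_const_mul]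
  unfold sav
  rw [← integral_sub (sav_integrable hm3 hb3 b) (sav_integrable hm3 hb3 a)]
  refine integral_congr_ae ?_
  filter_upwards [pol_ae_swap hu.ae_differentiableAt] with θ hθ
  obtain ⟨M, hM⟩ := lip_mul_bdd (ray_lip hu θ) (ray_lip hu θ) (fun s => hC _) (fun s => hC _)
  have := (hM.lipschitzOnWith (s := uIcc a b)).absolutelyContinuousOnInterval.integral_deriv_eq_sub
  simp only [← pow_two] at this
  rw [← this, ← intervalIntegral.integral_const_mul]
  refine intervalIntegral.integral_congr_ae ?_
  rw [ae_restrict_iff' measurableSet_Ioi] at hθ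
  filter_upwards [hθ] with ρ h1 h2
  rw [uIoc_of_le hab] at h2
  have hρ : 0 < ρ := ha.trans_lt h2.1
  have h3 := (ray_deriv hρ (h1 hρ)).fun_pow 2
  rw [HasDerivAt.deriv h3]
  simp only [Nat.cast_ofNat, Nat.add_one_sub_one, pow_one]; ring

theorem A_pol [Nontrivial V] {k : ℕ} (hN : Module.finrank ℝ V = k + 2) {G : V → ℝ} (hG : Measurable G) {C : ℝ} (hC : ∀ x, |G x| ≤ C) {r : ℝ} (hr : 0 ≤ r) :
    IntegrableOn (fun x => G x / ‖x‖ ^ k) (ball (0:V) r) ∧ ∫ x in ball (0:V) r, G x / ‖x‖ ^ k = ∫ ρ in (0:ℝ)..r, ρ * sav G ρ := by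
  have hC0 : 0 ≤ C := (abs_nonneg _).trans (hC 0)
  have hr1 : Integrable (fun x : V => (fun ρ : ℝ => (Iio r).indicator (fun ρ => C / ρ ^ k) ρ) ‖x‖) := by
    rw [integrable_fun_norm_addHaar (volume : Measure V) (f := fun ρ : ℝ => (Iio r).indicator (fun ρ => C / ρ ^ k) ρ), hN]
    have : IntegrableOn ((Ioc 0 r).indicator (fun ρ : ℝ => C * ρ)) (Ioi 0) := by
      refine Integrable.integrableOn ?_
      rw [integrable_indicator_iff measurableSet_Ioc]
      exact (continuous_const.mul continuous_id).integrableOn_Ioc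
    refine Integrable.mono' this ?_ ?_
    · refine Measurable.aestronglyMeasurable ?_
      have hq : Measurable (fun ρ : ℝ => C / ρ ^ k) := by fun_prop
      exact (measurable_id.pow_const (k + 2 - 1)).smul (hq.indicator measurableSet_Iio)
    · filter_upwards [ae_restrict_mem measurableSet_Ioi] with ρ hρ
      have hρ' : (0:ℝ) < ρ := hρ
      by_cases h : ρ < r
      · rw [indicator_of_mem (show ρ ∈ Iio r from h), indicator_of_mem (show ρ ∈ Ioc 0 r from ⟨hρ, h.le⟩), smul_eq_mul, Real.norm_of_nonneg (by positivity)]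
        refine le_of_eq ?_
        rw [show k + 2 - 1 = k + 1 from rfl, pow_succ]; field_simp
      · rw [indicator_of_notMem (show ρ ∉ Iio r from h)]
        simp only [smul_zero, norm_zero]
        refine indicator_nonneg (fun x hx => ?_) _
        exact mul_nonneg hC0 hx.1.le
  have hm : Measurable (fun x => G x / ‖x‖ ^ k) := by fun_prop
  have hi : Integrable ((ball (0:V) r).indicator (fun x => G x / ‖x‖ ^ k)) := by
    refine hr1.mono' (hm.indicator measurableSet_ball).aestronglyMeasurable (Eventually.of_forall fun x => ?_)
    by_cases h : ‖x‖ < r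
    · rw [indicator_of_mem (show x ∈ ball (0:V) r by simpa using h)]
      simp only
      rw [indicator_of_mem (show ‖x‖ ∈ Iio r from h), norm_div, Real.norm_eq_abs, norm_pow, norm_norm]
      exact div_le_div_of_nonneg_right (hC x) (by positivity)
    · rw [indicator_of_notMem (show x ∉ ball (0:V) r by simpa using h)]
      simp only
      rw [indicator_of_notMem (show ‖x‖ ∉ Iio r from h), norm_zero]
  refine ⟨(integrable_indicator_iff measurableSet_ball).1 hi, ?_⟩
  rw [← integral_indicator measurableSet_ball, pol_int' hN hi, intervalIntegral.integral_of_le hr, ← integral_indicator measurableSet_Ioc, ← integral_indicator measurableSet_Ioi]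
  have hn : ∀ᵐ ρ : ℝ, ρ ≠ r := by rw [ae_iff]; simp
  refine integral_congr_ae ?_
  filter_upwards [hn] with ρ hn
  by_cases h0 : 0 < ρ
  · rw [indicator_of_mem (show ρ ∈ Ioi (0:ℝ) from h0)]
    by_cases h : ρ < r
    · rw [indicator_of_mem (show ρ ∈ Ioc 0 r from ⟨h0, h.le⟩)]
      have : sav ((ball (0:V) r).indicator (fun x => G x / ‖x‖ ^ k)) ρ = sav G ρ / ρ ^ k := by
        unfold sav
        rw [← integral_div]
        refine integral_congr_ae (Eventually.of_forall fun θ => ?_)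
        simp only
        rw [indicator_of_mem (show ρ • (θ:V) ∈ ball (0:V) r by simpa [(ray_norm θ h0).1] using h), (ray_norm θ h0).1]
      rw [this, pow_succ]; field_simp
    · rw [indicator_of_notMem (show ρ ∉ Ioc 0 r from fun hh => h (lt_of_le_of_ne hh.2 hn))]
      have : sav ((ball (0:V) r).indicator (fun x => G x / ‖x‖ ^ k)) ρ = 0 := by
        unfold sav
        refine (integral_congr_ae (Eventually.of_forall fun θ => ?_)).trans (integral_zero _ _)
        rw [indicator_of_notMem (show ρ • (θ:V) ∉ ball (0:V) r by rw [mem_ball_zero_iff, (ray_norm θ h0).1]; exact h)]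
      rw [this, mul_zero]
  · rw [indicator_of_notMem (show ρ ∉ Ioi (0:ℝ) from h0), indicator_of_notMem (show ρ ∉ Ioc 0 r from fun hh => h0 hh.1)]

/-- the radial form of the ACF integral -/
def Aint (u : V → ℝ) (r : ℝ) : ℝ := ∫ ρ in (0:ℝ)..r, ρ * sav (fun x => ‖gradient u x‖ ^ 2) ρ

theorem gsq_bdd {u : V → ℝ} {K : ℝ≥0} (hu : LipschitzWith K u) (x : V) : |‖gradient u x‖ ^ 2| ≤ (K:ℝ) ^ 2 := by
  rw [abs_of_nonneg (sq_nonneg _)]; exact pow_le_pow_left₀ (norm_nonneg _) (grad_norm_le hu x) 2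

theorem A_ineq [Nontrivial V] {k : ℕ} (hN : Module.finrank ℝ V = k + 2) {u : V → ℝ} {K : ℝ≥0} (hu : LipschitzWith K u) {C : ℝ} (hC : ∀ x, |u x| ≤ C) (h0 : ∀ x, 0 ≤ u x) {R : ℝ} (hW : WSub R u) :
    ∀ᵐ r : ℝ, r ∈ Ioo 0 R → Aint u r ≤ r * sav (fun x => u x * nuD u x) r + k / 2 * sav (fun x => u x ^ 2) r := by
  have hm2 : Measurable (fun x => u x * nuD u x) := hu.continuous.measurable.mul (nuD_meas u)
  have hb2 : ∀ x, |u x * nuD u x| ≤ C * K := fun x => by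
    rw [abs_mul]; exact mul_le_mul (hC x) (nuD_le hu x) (abs_nonneg _) ((abs_nonneg _).trans (hC x))
  have hm1 : Measurable (fun x => ‖gradient u x‖ ^ 2) := (grad_meas u).norm.pow_const 2
  have key := oneD (k := k) (b := sav (fun x => ‖gradient u x‖ ^ 2)) (κ := sav (fun x => u x * nuD u x)) (R := R)
    (C := max ((K:ℝ)^2 * (sgm V).real univ) (C * K * (sgm V).real univ)) (sav_meas hm1) (sav_meas hm2) (sav_nonneg fun x => sq_nonneg _)
    (fun ρ => (sav_bdd (gsq_bdd hu) ρ).trans (le_max_left _ _)) (fun ρ => (sav_bdd hb2 ρ).trans (le_max_right _ _))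
    (fun g L G M hg hg0 hG hMR hM => weak_rad hN hu hC h0 hW hg hg0 hG hMR hM)
  filter_upwards [key] with r h hr
  have h1 := h hr
  have h2 := sav_sq_ftc hu hC le_rfl hr.1.le
  have h3 : 0 ≤ sav (fun x => u x ^ 2) (0:ℝ) := sav_nonneg (fun x => sq_nonneg _) _
  unfold Aint
  have : (k:ℝ) * ∫ ρ in (0:ℝ)..r, sav (fun x => u x * nuD u x) ρ ≤ k / 2 * sav (fun x => u x ^ 2) r := by
    have hk : (0:ℝ) ≤ k := Nat.cast_nonneg k
    nlinarith
  linarith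

end E3

section E4
variable {V : Type*} [NormedAddCommGroup V] [InnerProductSpace ℝ V] [FiniteDimensional ℝ V] [MeasurableSpace V] [BorelSpace V]

theorem grad_scale {u : V → ℝ} (r : ℝ) (y : V) : gradient (fun y => u (r • y)) y = r • gradient u (r • y) := by
  refine ext_inner_right ℝ fun v => ?_
  rw [grad_inner, real_inner_smul_left, grad_inner]
  have := fderiv_comp_smul (𝕜 := ℝ) (f := u) (x := y) r
  rw [this]; simp

theorem tang_scale {u : V → ℝ} {r : ℝ} (hr : 0 < r) (θ : sphere (0:V) 1) :
    tang (fun y => u (r • y)) (θ:V) = r^2 * (‖gradient u (r • (θ:V))‖^2 - nuD u (r • (θ:V))^2) := by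
  unfold tang nuD
  rw [grad_scale, (ray_norm θ hr).2, norm_smul, real_inner_smul_left, mul_pow, Real.norm_eq_abs, sq_abs]; ring

theorem scale_lip {u : V → ℝ} {K : ℝ≥0} (hu : LipschitzWith K u) {r : ℝ} (hr : 0 < r) : LipschitzWith (K * r.toNNReal) (fun y => u (r • y)) := by
  refine LipschitzWith.of_dist_le_mul fun x y => ?_
  refine (hu.dist_le_mul _ _).trans (le_of_eq ?_)
  rw [dist_eq_norm, ← smul_sub, norm_smul, dist_eq_norm, NNReal.coe_mul, Real.coe_toNNReal _ hr.le, Real.norm_of_nonneg hr.le, mul_assoc]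

/-- the spherical defect -/
def Sdef (u : V → ℝ) (s r : ℝ) : ℝ := sav (fun x => (r * nuD u x - s * u x)^2) r

theorem Sdef_nonneg (u : V → ℝ) (s r : ℝ) : 0 ≤ Sdef u s r := sav_nonneg (fun x => sq_nonneg _) _

theorem Sdef_eq {u : V → ℝ} {K : ℝ≥0} (hu : LipschitzWith K u) {C : ℝ} (hC : ∀ x, |u x| ≤ C) (s r : ℝ) :
    Sdef u s r = r^2 * sav (fun x => nuD u x ^ 2) r - 2 * s * r * sav (fun x => u x * nuD u x) r + s^2 * sav (fun x => u x ^2) r := by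
  have hm2 : Measurable (fun x => u x * nuD u x) := hu.continuous.measurable.mul (nuD_meas u)
  have hb2 : ∀ x, |u x * nuD u x| ≤ C * K := fun x => by
    rw [abs_mul]; exact mul_le_mul (hC x) (nuD_le hu x) (abs_nonneg _) ((abs_nonneg _).trans (hC x))
  have hb3 : ∀ x, |u x ^ 2| ≤ C ^ 2 := fun x => by
    rw [abs_pow]; exact pow_le_pow_left₀ (abs_nonneg _) (hC x) 2
  have hm3 : Measurable (fun x => u x ^ 2) := hu.continuous.measurable.pow_const 2
  have hb4 : ∀ x, |nuD u x ^ 2| ≤ (K:ℝ) ^ 2 := fun x => by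
    rw [abs_pow]; exact pow_le_pow_left₀ (abs_nonneg _) (nuD_le hu x) 2
  have hm4 : Measurable (fun x => nuD u x ^ 2) := (nuD_meas u).pow_const 2
  have i2 := (sav_integrable hm2 hb2 r).const_mul (2 * s * r)
  have i3 := (sav_integrable hm3 hb3 r).const_mul (s^2)
  have i4 := (sav_integrable hm4 hb4 r).const_mul (r^2)
  have e1 := integral_sub i4 i2
  have e2 := integral_add (i4.sub i2) i3
  simp only [Pi.sub_apply] at e2
  rw [e1, integral_const_mul, integral_const_mul, integral_const_mul] at e2
  unfold Sdef sav
  rw [← e2]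
  refine integral_congr_ae (Eventually.of_forall fun θ => ?_)
  simp only; ring

theorem T_eq {u : V → ℝ} {K : ℝ≥0} (hu : LipschitzWith K u) {r : ℝ} (hr : 0 < r) :
    ∫ θ : sphere (0:V) 1, tang (fun y => u (r • y)) θ ∂sgm V = r^2 * sav (fun x => ‖gradient u x‖^2) r - r^2 * sav (fun x => nuD u x ^ 2) r := by
  have hb4 : ∀ x, |nuD u x ^ 2| ≤ (K:ℝ) ^ 2 := fun x => by
    rw [abs_pow]; exact pow_le_pow_left₀ (abs_nonneg _) (nuD_le hu x) 2
  have hm4 : Measurable (fun x => nuD u x ^ 2) := (nuD_meas u).pow_const 2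
  have hm1 : Measurable (fun x => ‖gradient u x‖ ^ 2) := (grad_meas u).norm.pow_const 2
  have e1 := integral_sub (sav_integrable hm1 (gsq_bdd hu) r) (sav_integrable hm4 hb4 r)
  unfold sav
  rw [← mul_sub, ← e1, ← integral_const_mul]
  exact integral_congr_ae (Eventually.of_forall fun θ => tang_scale hr θ)

theorem core1 {k : ℕ} {u : V → ℝ} {K : ℝ≥0} (hu : LipschitzWith K u) {C : ℝ} (hC : ∀ x, |u x| ≤ C) {r A : ℝ} (hr : 0 < r) (hA : 0 < A)
    (hAi : A ≤ r * sav (fun x => u x * nuD u x) r + k / 2 * sav (fun x => u x ^ 2) r) :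
    0 < sav (fun x => u x ^ 2) r ∧ ∃ α, 0 ≤ α ∧ ∫ θ : sphere (0:V) 1, tang (fun y => u (r • y)) θ ∂sgm V = α * (α + k) * sav (fun x => u x ^ 2) r ∧
      2 * α * A + Sdef u α r ≤ r^2 * sav (fun x => ‖gradient u x‖^2) r := by
  have hT0 : 0 ≤ ∫ θ : sphere (0:V) 1, tang (fun y => u (r • y)) θ ∂sgm V := integral_nonneg fun θ => tang_nonneg _ (by simpa using θ.2)
  have hT := T_eq hu hr
  have hS := Sdef_eq hu hC
  have hH0 : 0 ≤ sav (fun x => u x ^ 2) r := sav_nonneg (fun x => sq_nonneg _) _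
  set H := sav (fun x => u x ^ 2) r
  set T := ∫ θ : sphere (0:V) 1, tang (fun y => u (r • y)) θ ∂sgm V
  set κ := sav (fun x => u x * nuD u x) r
  set q := sav (fun x => nuD u x ^ 2) r
  have hk : (0:ℝ) ≤ k := Nat.cast_nonneg k
  have hH : 0 < H := by
    rcases hH0.lt_or_eq with h | h
    · exact h
    exfalso
    rw [← h] at hAi
    have hκ : 0 < r * κ := by linarith
    have h1 := Sdef_nonneg u ((r^2 * q + 1)/(r*κ)) r
    rw [hS, show sav (fun x => u x ^ 2) r = 0 from h.symm] at h1
    have h2 : 2 * ((r^2 * q + 1)/(r*κ)) * r * κ = 2 * (r^2*q+1) := by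
      have := hκ.ne'
      rw [mul_assoc, mul_assoc, div_mul_cancel₀ _ this]
    rw [h2] at h1
    have h3 : 0 ≤ q := sav_nonneg (fun x => sq_nonneg _) _
    nlinarith [sq_nonneg r, mul_nonneg (sq_nonneg r) h3]
  refine ⟨hH, ?_⟩
  set D := Real.sqrt ((k:ℝ)^2 + 4 * (T/H)) with hD
  have hTH : 0 ≤ T / H := div_nonneg hT0 hH.le
  have hDs : D^2 = (k:ℝ)^2 + 4 * (T/H) := Real.sq_sqrt (by positivity)
  have hDk : (k:ℝ) ≤ D := by
    refine Real.le_sqrt_of_sq_le ?_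
    linarith
  refine ⟨(D - k)/2, by linarith, ?_, ?_⟩
  · have : (D - k)/2 * ((D-k)/2 + k) = T/H := by linear_combination hDs/4
    rw [this, div_mul_cancel₀ _ hH.ne']
  · have h1 : (D - k)/2 * ((D-k)/2 + k) * H = T := by
      have : (D - k)/2 * ((D-k)/2 + k) = T/H := by linear_combination hDs/4
      rw [this, div_mul_cancel₀ _ hH.ne']
    have hα : 0 ≤ (D-k)/2 := by linarith
    set α := (D-k)/2
    rw [hS]
    have h2 := mul_le_mul_of_nonneg_left hAi hα
    nlinarith

theorem poly_one {α : ℝ} (h2 : α ≤ 2) (hpoly : ∀ t, 0 < t → 0 ≤ α * t^2 - 2 * t + (2 - α)) : α = 1 := by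
  rcases lt_trichotomy α 1 with h | h | h
  · have := hpoly (1 + (1-α)) (by linarith)
    have e : α * (1 + (1-α))^2 - 2 * (1 + (1-α)) + (2 - α) = (1-α)^2 * (α - 2) := by ring
    rw [e] at this
    have h3 : 0 < (1-α)^2 := by have : 1 - α ≠ 0 := by linarith
                                positivity
    nlinarith
  · exact h
  · have := hpoly (1 - (α-1)/2) (by linarith)
    have e : α * (1 - (α-1)/2)^2 - 2 * (1 - (α-1)/2) + (2 - α) = ((α-1)/2)^2 * (α - 4) := by ring
    rw [e] at this
    have h3 : 0 < ((α-1)/2)^2 := by have : (α-1)/2 ≠ 0 := by linarith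
                                    positivity
    nlinarith

theorem core2 [Nontrivial V] {k : ℕ} (hN : Module.finrank ℝ V = k + 2) {u w : V → ℝ} {K : ℝ≥0} (hu : LipschitzWith K u) (hw : LipschitzWith K w) {C : ℝ} (hCu : ∀ x, |u x| ≤ C) (hCw : ∀ x, |w x| ≤ C)
    (hu0 : ∀ x, 0 ≤ u x) (hw0 : ∀ x, 0 ≤ w x) (huw : ∀ x, u x * w x = 0) {r A B : ℝ} (hr : 0 < r) (hA : 0 < A) (hB : 0 < B)
    (hdu : ∀ᵐ θ : sphere (0:V) 1 ∂sgm V, DifferentiableAt ℝ u (r • (θ:V))) (hdw : ∀ᵐ θ : sphere (0:V) 1 ∂sgm V, DifferentiableAt ℝ w (r • (θ:V)))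
    (hAi : A ≤ r * sav (fun x => u x * nuD u x) r + k / 2 * sav (fun x => u x ^ 2) r)
    (hBi : B ≤ r * sav (fun x => w x * nuD w x) r + k / 2 * sav (fun x => w x ^ 2) r) :
    4 * A * B ≤ r^2 * sav (fun x => ‖gradient u x‖^2) r * B + A * (r^2 * sav (fun x => ‖gradient w x‖^2) r) ∧
    (4 * A * B = r^2 * sav (fun x => ‖gradient u x‖^2) r * B + A * (r^2 * sav (fun x => ‖gradient w x‖^2) r) →
      Sdef u 1 r = 0 ∧ Sdef w 1 r = 0 ∧ 
      ∃ (e : V) (kp km : ℝ), ‖e‖ = 1 ∧ 0 < kp ∧ 0 < km ∧ ∀ θ : V, ‖θ‖ = 1 → u (r • θ) = kp * max ⟪θ, e⟫ 0 ∧ w (r • θ) = km * max (-⟪θ, e⟫) 0) := by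
  obtain ⟨hHu, α, hα, hTu, h1⟩ := core1 (k := k) hu hCu hr hA hAi
  obtain ⟨hHw, β, hβ, hTw, h2⟩ := core1 (k := k) hw hCw hr hB hBi
  have hd : ∀ f : V → ℝ, (∀ᵐ θ : sphere (0:V) 1 ∂sgm V, DifferentiableAt ℝ f (r • (θ:V))) → ∀ᵐ θ : sphere (0:V) 1 ∂sgm V, DifferentiableAt ℝ (fun y => f (r • y)) (θ:V) := fun f h => by
    filter_upwards [h] with θ hθ
    exact hθ.comp (θ:V) (f := fun y : V => r • y) (by fun_prop)
  have hS : ∀ t, 0 < t → 4 ≤ (1+t)*α + (1+1/t)*β := fun t ht =>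
    lemS hN (scale_lip hu hr) (scale_lip hw hr) (fun x => hu0 _) (fun x => hw0 _) (fun x => huw _) (hd u hdu) (hd w hdw) hHu hHw hα hβ ht hTu.le hTw.le
  have hs := hS 1 one_pos
  have hS1 := Sdef_nonneg u α r
  have hS2 := Sdef_nonneg w β r
  have g1 := mul_le_mul_of_nonneg_right h1 hB.le
  have g2 := mul_le_mul_of_nonneg_left h2 hA.le
  have hAB : 0 < A * B := mul_pos hA hB
  have g3 : 0 ≤ (α + β - 2) * (A * B) := mul_nonneg (by linarith) hAB.le
  have g4 : 0 ≤ Sdef u α r * B := mul_nonneg hS1 hB.le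
  have g5 : 0 ≤ A * Sdef w β r := mul_nonneg hA.le hS2
  constructor
  · nlinarith
  intro he
  have z4 : Sdef u α r * B = 0 := by nlinarith
  have z5 : A * Sdef w β r = 0 := by nlinarith
  have z3 : (α + β - 2) * (A * B) = 0 := by nlinarith
  have hab : β = 2 - α := by
    rcases mul_eq_zero.1 z3 with h | h
    · linarith
    · exact absurd h hAB.ne'
  have hpoly : ∀ t, 0 < t → 0 ≤ α * t^2 - 2 * t + (2 - α) := fun t ht => by
    have := hS t ht
    rw [hab] at this
    have h3 := mul_le_mul_of_nonneg_left this ht.le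
    have h4 : t * ((1+t)*α + (1+1/t)*(2-α)) = t * (1+t) * α + (t + 1) * (2-α) := by field_simp
    rw [h4] at h3
    nlinarith
  have ha1 : α = 1 := poly_one (by linarith) hpoly
  have hb1 : β = 1 := by linarith
  rw [ha1] at hTu z4
  rw [hb1] at hTw z5
  refine ⟨(mul_eq_zero.1 z4).resolve_right hB.ne', (mul_eq_zero.1 z5).resolve_left hA.ne', ?_⟩
  refine lemF hN (scale_lip hu hr) (scale_lip hw hr) (fun x => hu0 _) (fun x => hw0 _) (fun x => huw _) (hd u hdu) (hd w hdw) hHu hHw ?_ ?_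
  · rw [hTu]; refine le_of_eq ?_; rw [one_mul, add_comm]; rfl
  · rw [hTw]; refine le_of_eq ?_; rw [one_mul, add_comm]; rfl
end E4

section E5
variable {V : Type*} [NormedAddCommGroup V] [InnerProductSpace ℝ V] [FiniteDimensional ℝ V] [MeasurableSpace V] [BorelSpace V]

theorem Aint_ii {u : V → ℝ} {K : ℝ≥0} (hu : LipschitzWith K u) (a d : ℝ) : IntervalIntegrable (fun ρ => ρ * sav (fun x => ‖gradient u x‖ ^ 2) ρ) volume a d := by
  have hm1 : Measurable (fun x => ‖gradient u x‖ ^ 2) := (grad_meas u).norm.pow_const 2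
  exact (ii_bdd (sav_meas hm1) (sav_bdd (gsq_bdd hu)) a d).continuousOn_mul continuousOn_id

theorem Aint_deriv {u : V → ℝ} {K : ℝ≥0} (hu : LipschitzWith K u) {R : ℝ} (hR : 0 ≤ R) :
    ∀ᵐ r : ℝ, r ∈ Ioo 0 R → HasDerivAt (Aint u) (r * sav (fun x => ‖gradient u x‖ ^ 2) r) r := by
  filter_upwards [(Aint_ii hu 0 R).ae_hasDerivAt_integral] with r h hr
  rw [uIcc_of_le hR] at h
  exact h ⟨hr.1.le, hr.2.le⟩ 0 ⟨le_rfl, hR⟩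

theorem Aint_ac {u : V → ℝ} {K : ℝ≥0} (hu : LipschitzWith K u) {a b : ℝ} (ha : 0 ≤ a) (hab : a ≤ b) : AbsolutelyContinuousOnInterval (Aint u) a b := by
  have := (Aint_ii hu 0 b).absolutelyContinuousOnInterval_intervalIntegral (c := 0) (by simp)
  refine this.mono ?_
  rw [uIcc_of_le hab, uIcc_of_le (ha.trans hab)]
  exact Icc_subset_Icc_left ha

theorem Aint_mono {u : V → ℝ} {K : ℝ≥0} (hu : LipschitzWith K u) {a b : ℝ} (ha : 0 ≤ a) (hab : a ≤ b) : Aint u a ≤ Aint u b := by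
  unfold Aint
  rw [← intervalIntegral.integral_add_adjacent_intervals (Aint_ii hu 0 a) (Aint_ii hu a b)]
  have : 0 ≤ ∫ ρ in a..b, ρ * sav (fun x => ‖gradient u x‖ ^ 2) ρ := intervalIntegral.integral_nonneg hab fun x hx => mul_nonneg (ha.trans hx.1) (sav_nonneg (fun x => sq_nonneg _) _)
  linarith

theorem Aint_nonneg (u : V → ℝ) {a : ℝ} (ha : 0 ≤ a) : 0 ≤ Aint u a := 
  intervalIntegral.integral_nonneg ha fun x hx => mul_nonneg hx.1 (sav_nonneg (fun x => sq_nonneg _) _)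

theorem phi_eq [Nontrivial V] {k : ℕ} (hN : Module.finrank ℝ V = k + 2) {u w : V → ℝ} {K : ℝ≥0} (hu : LipschitzWith K u) (hw : LipschitzWith K w) {C : ℝ} (hCu : ∀ x, |u x| ≤ C) (hCw : ∀ x, |w x| ≤ C)
    (hu0 : ∀ x, 0 ≤ u x) (hw0 : ∀ x, 0 ≤ w x) (huw : ∀ x, u x * w x = 0) {R r₁ r₂ : ℝ} (hWu : WSub R u) (hWw : WSub R w) (h1 : 0 < r₁) (h12 : r₁ < r₂) (h2R : r₂ < R)
    (hA : 0 < Aint u r₁) (hB : 0 < Aint w r₁) (heq : Aint u r₁ * Aint w r₁ * (r₁^4)⁻¹ = Aint u r₂ * Aint w r₂ * (r₂^4)⁻¹) :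
    ∀ᵐ r : ℝ, r ∈ Ioo r₁ r₂ → Sdef u 1 r = 0 ∧ Sdef w 1 r = 0 ∧ 
      ∃ (e : V) (kp km : ℝ), ‖e‖ = 1 ∧ 0 < kp ∧ 0 < km ∧ ∀ θ : V, ‖θ‖ = 1 → u (r • θ) = kp * max ⟪θ, e⟫ 0 ∧ w (r • θ) = km * max (-⟪θ, e⟫) 0 := by
  have hR : 0 < R := h1.trans (h12.trans h2R)
  set Φ : ℝ → ℝ := fun r => Aint u r * Aint w r * (r^4)⁻¹ with hΦ
  have hac : AbsolutelyContinuousOnInterval Φ r₁ r₂ := by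
    refine ((Aint_ac hu h1.le h12.le).fun_mul (Aint_ac hw h1.le h12.le)).fun_mul ?_
    refine ContDiffOn.absolutelyContinuousOnInterval ?_
    rw [uIcc_of_le h12.le]
    refine ContDiffOn.inv (by fun_prop) fun x hx => ?_
    have : 0 < x := h1.trans_le hx.1
    positivity
  have hdu := pol_ae hu.ae_differentiableAt
  have hdw := pol_ae hw.ae_differentiableAt
  rw [ae_restrict_iff' measurableSet_Ioi] at hdu hdw
  have main : ∀ᵐ r : ℝ, r ∈ Ioo r₁ r₂ → 0 ≤ deriv Φ r ∧ (deriv Φ r = 0 → Sdef u 1 r = 0 ∧ Sdef w 1 r = 0 ∧ 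
      ∃ (e : V) (kp km : ℝ), ‖e‖ = 1 ∧ 0 < kp ∧ 0 < km ∧ ∀ θ : V, ‖θ‖ = 1 → u (r • θ) = kp * max ⟪θ, e⟫ 0 ∧ w (r • θ) = km * max (-⟪θ, e⟫) 0) := by
    filter_upwards [hdu, hdw, Aint_deriv hu hR.le, Aint_deriv hw hR.le, A_ineq hN hu hCu hu0 hWu, A_ineq hN hw hCw hw0 hWw] with r d1 d2 d3 d4 d5 d6 hr
    have hr0 : 0 < r := h1.trans hr.1
    have hrR : r ∈ Ioo 0 R := ⟨hr0, hr.2.trans h2R⟩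
    have hA' : 0 < Aint u r := hA.trans_le (Aint_mono hu h1.le hr.1.le)
    have hB' : 0 < Aint w r := hB.trans_le (Aint_mono hw h1.le hr.1.le)
    obtain ⟨c1, c2⟩ := core2 hN hu hw hCu hCw hu0 hw0 huw hr0 hA' hB' (d1 hr0) (d2 hr0) (d5 hrR) (d6 hrR)
    have hd := ((d3 hrR).fun_mul (d4 hrR)).fun_mul (((hasDerivAt_id r).fun_pow 4).fun_inv (by simpa using hr0.ne'))
    have hd' : deriv Φ r = (r^5)⁻¹ * (r^2 * sav (fun x => ‖gradient u x‖^2) r * Aint w r + Aint u r * (r^2 * sav (fun x => ‖gradient w x‖^2) r) - 4 * Aint u r * Aint w r) := by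
      refine hd.deriv.trans ?_
      simp only [id]
      field_simp
      push_cast
      ring
    have hp : 0 < (r^5)⁻¹ := by positivity
    rw [hd']
    refine ⟨mul_nonneg hp.le (by linarith), fun h => c2 ?_⟩
    have := (mul_eq_zero.1 h).resolve_left hp.ne'
    linarith
  have hI := hac.integral_deriv_eq_sub
  rw [show Φ r₂ - Φ r₁ = 0 from sub_eq_zero.2 heq.symm] at hI
  have hn : ∀ᵐ r : ℝ, r ≠ r₂ := by rw [ae_iff]; simp
  have hz := (intervalIntegral.integral_eq_zero_iff_of_le_of_nonneg_ae h12.le ?_ hac.intervalIntegrable_deriv).1 hI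
  · rw [EventuallyEq, ae_restrict_iff' measurableSet_Ioc] at hz
    filter_upwards [hz, main] with r z m hr
    exact (m hr).2 (z ⟨hr.1, hr.2.le⟩)
  · rw [EventuallyLE, ae_restrict_iff' measurableSet_Ioc]
    filter_upwards [main, hn] with r m n hr
    exact (m ⟨hr.1, lt_of_le_of_ne hr.2 n⟩).1
end E5

section G1
variable {V : Type*} [NormedAddCommGroup V] [InnerProductSpace ℝ V] [FiniteDimensional ℝ V] [MeasurableSpace V] [BorelSpace V]

theorem homog_ae [Nontrivial V] {k : ℕ} (hN : Module.finrank ℝ V = k + 2) {u : V → ℝ} {K : ℝ≥0} (hu : LipschitzWith K u) {C : ℝ} (hC : ∀ x, |u x| ≤ C)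
    {r₁ r₂ : ℝ} (h1 : 0 < r₁) (h12 : r₁ < r₂) (hS : ∀ᵐ r : ℝ, r ∈ Ioo r₁ r₂ → Sdef u 1 r = 0) :
    ∀ᵐ x : V, ‖x‖ ∈ Ioo r₁ r₂ → ‖x‖ * nuD u x = u x := by
  have hC0 : 0 ≤ C := (abs_nonneg _).trans (hC 0)
  have hms : MeasurableSet {x : V | ‖x‖ ∈ Ioo r₁ r₂} := measurable_norm measurableSet_Ioo
  set f : V → ℝ := {x : V | ‖x‖ ∈ Ioo r₁ r₂}.indicator (fun x => (‖x‖ * nuD u x - u x)^2) with hf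
  have hm0 : Measurable (fun x => (‖x‖ * nuD u x - u x)^2) := ((measurable_norm.mul (nuD_meas u)).sub hu.continuous.measurable).pow_const 2
  have hm : Measurable f := hm0.indicator hms
  have hf0 : ∀ x, 0 ≤ f x := fun x => indicator_nonneg (fun x _ => sq_nonneg _) x
  have hi : Integrable f := by
    refine bdd_ball_int (C := (r₂ * K + C)^2) (M := r₂) hm (fun x => ?_) (fun x hx => indicator_of_notMem (fun h => absurd h.2 (not_lt.2 hx.le)) _)
    rw [abs_of_nonneg (hf0 x)]
    by_cases h : ‖x‖ ∈ Ioo r₁ r₂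
    · rw [hf, indicator_of_mem (show x ∈ {x : V | ‖x‖ ∈ Ioo r₁ r₂} from h)]
      refine sq_le_sq' ?_ ?_ <;>
      · have a1 := abs_le.1 (nuD_le hu x)
        have a2 := abs_le.1 (hC x)
        have a3 := h.2
        have a4 := norm_nonneg x
        have a5 := K.2
        have a6 : |‖x‖ * nuD u x| ≤ r₂ * K := by
          rw [abs_mul, abs_norm]
          exact mul_le_mul a3.le (nuD_le hu x) (abs_nonneg _) (by linarith)
        have a7 := abs_le.1 a6
        linarith
    · rw [hf, indicator_of_notMem (show x ∉ {x : V | ‖x‖ ∈ Ioo r₁ r₂} from h)]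
      positivity
  have hintg : ∫ x, f x = 0 := by
    rw [pol_int' hN hi]
    refine (integral_congr_ae (g := fun _ => (0:ℝ)) ?_).trans (integral_zero _ _)
    filter_upwards [ae_restrict_mem measurableSet_Ioi, ae_restrict_of_ae hS] with ρ hρ h
    have hz : sav f ρ = 0 := by
      by_cases hm : ρ ∈ Ioo r₁ r₂
      · rw [← h hm]
        unfold Sdef sav
        refine integral_congr_ae (Eventually.of_forall fun θ => ?_)
        simp only
        rw [hf, indicator_of_mem (show ρ • (θ:V) ∈ {x : V | ‖x‖ ∈ Ioo r₁ r₂} by rw [mem_setOf_eq, (ray_norm θ hρ).1]; exact hm), (ray_norm θ hρ).1, one_mul]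
      · unfold sav
        refine (integral_congr_ae (Eventually.of_forall fun θ => ?_)).trans (integral_zero _ _)
        rw [hf]
        exact indicator_of_notMem (show ρ • (θ:V) ∉ {x : V | ‖x‖ ∈ Ioo r₁ r₂} by rw [mem_setOf_eq, (ray_norm θ hρ).1]; exact hm) _
    rw [hz, mul_zero]
  have := (integral_eq_zero_iff_of_nonneg hf0 hi).1 hintg
  filter_upwards [this] with x hx hr
  rw [hf, indicator_of_mem (show x ∈ {x : V | ‖x‖ ∈ Ioo r₁ r₂} from hr)] at hx
  have := pow_eq_zero_iff (two_ne_zero) |>.1 hx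
  linarith

theorem homog [Nontrivial V] {k : ℕ} (hN : Module.finrank ℝ V = k + 2) {u : V → ℝ} {K : ℝ≥0} (hu : LipschitzWith K u) {C : ℝ} (hC : ∀ x, |u x| ≤ C)
    {r₁ r₂ : ℝ} (h1 : 0 < r₁) (h12 : r₁ < r₂) (hS : ∀ᵐ r : ℝ, r ∈ Ioo r₁ r₂ → Sdef u 1 r = 0) {r₀ : ℝ} (h0 : r₀ ∈ Ioo r₁ r₂) :
    ∀ x : V, ‖x‖ ∈ Ioo r₁ r₂ → u x = ‖x‖ / r₀ * u (r₀ • (‖x‖⁻¹ • x)) := by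
  have hr0 : 0 < r₀ := h1.trans h0.1
  have hae : ∀ᵐ θ : sphere (0:V) 1 ∂sgm V, ∀ ρ ∈ Icc r₁ r₂, u (ρ • (θ:V)) * ρ⁻¹ = u (r₀ • (θ:V)) * r₀⁻¹ := by
    have hP : ∀ᵐ x : V, DifferentiableAt ℝ u x ∧ (‖x‖ ∈ Ioo r₁ r₂ → ‖x‖ * nuD u x = u x) := by
      filter_upwards [hu.ae_differentiableAt, homog_ae hN hu hC h1 h12 hS] with x a b using ⟨a, b⟩
    filter_upwards [pol_ae_swap hP] with θ hθ
    rw [ae_restrict_iff' measurableSet_Ioi] at hθ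
    have hac : AbsolutelyContinuousOnInterval (fun ρ : ℝ => u (ρ • (θ:V)) * ρ⁻¹) r₁ r₂ := by
      refine ((ray_lip hu θ).lipschitzOnWith (s := uIcc r₁ r₂)).absolutelyContinuousOnInterval.fun_mul ?_
      refine ContDiffOn.absolutelyContinuousOnInterval ?_
      rw [uIcc_of_le h12.le]
      refine ContDiffOn.inv (by fun_prop) fun x hx => ?_
      exact (h1.trans_le hx.1).ne'
    have hn : ∀ a : ℝ, ∀ᵐ r : ℝ, r ≠ a := fun a => by rw [ae_iff]; simp
    obtain ⟨c, hc⟩ := hac.const_of_ae_hasDerivAt_zero (by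
      filter_upwards [hθ, hn r₁, hn r₂] with ρ hρ n1 n2 hm
      rw [uIcc_of_le h12.le] at hm
      have hm' : ρ ∈ Ioo r₁ r₂ := ⟨lt_of_le_of_ne hm.1 n1.symm, lt_of_le_of_ne hm.2 n2⟩
      have hp : 0 < ρ := h1.trans hm'.1
      obtain ⟨a, b⟩ := hρ hp
      rw [(ray_norm θ hp).1] at b
      have hd := (ray_deriv hp a).fun_mul (hasDerivAt_inv hp.ne')
      refine hd.congr_deriv ?_
      rw [← b hm']
      field_simp; ring)
    rw [uIcc_of_le h12.le] at hc
    intro ρ hρ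
    rw [hc ρ hρ, hc r₀ ⟨h0.1.le, h0.2.le⟩]
  have hray := pol_ae_ray (P := fun θ : V => ∀ ρ ∈ Icc r₁ r₂, u (ρ • (θ:V)) * ρ⁻¹ = u (r₀ • (θ:V)) * r₀⁻¹) hae
  have hopen : IsOpen {x : V | ‖x‖ ∈ Ioo r₁ r₂} := isOpen_Ioo.preimage continuous_norm
  have key : EqOn u (fun x => ‖x‖ / r₀ * u (r₀ • (‖x‖⁻¹ • x))) {x : V | ‖x‖ ∈ Ioo r₁ r₂} := by
    refine Measure.eqOn_open_of_ae_eq (μ := volume) ?_ hopen hu.continuous.continuousOn ?_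
    · rw [EventuallyEq, ae_restrict_iff' hopen.measurableSet]
      filter_upwards [hray] with x hx hm
      have hp : 0 < ‖x‖ := h1.trans hm.1
      have := hx ‖x‖ ⟨hm.1.le, hm.2.le⟩
      rw [smul_smul, mul_inv_cancel₀ hp.ne', one_smul] at this
      field_simp at this ⊢
      simpa [one_div] using this
    · refine ContinuousOn.mul (by fun_prop) (hu.continuous.comp_continuousOn ?_)
      refine ContinuousOn.const_smul (ContinuousOn.smul (ContinuousOn.inv₀ (by fun_prop) fun x hx => ?_) continuousOn_id) _
      exact (h1.trans hx.1).ne'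
  exact fun x hx => key hx
end G1

section G2
variable {V : Type*} [NormedAddCommGroup V] [InnerProductSpace ℝ V] [FiniteDimensional ℝ V] [MeasurableSpace V] [BorelSpace V]

theorem int_dir_zero {f : V → ℝ} {K : ℝ≥0} (hf : LipschitzWith K f) (hs : HasCompactSupport f) (e : V) : ∫ x, ⟪gradient f x, e⟫ = 0 := by
  have h := LipschitzWith.integral_lineDeriv_mul_eq (μ := (volume : Measure V)) (f := fun _ : V => (1:ℝ)) (C := 0) (LipschitzWith.const 1) hf hs (-e)
  simp only [neg_neg, mul_one] at h
  have h2 : ∫ x, ⟪gradient f x, e⟫ = ∫ x, lineDeriv ℝ f x e := by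
    refine integral_congr_ae ?_
    filter_upwards [hf.ae_differentiableAt] with x hx
    rw [grad_inner, hx.lineDeriv_eq_fderiv]
  rw [h2, ← h]
  refine (integral_congr_ae (Eventually.of_forall fun x => ?_)).trans (integral_zero _ _)
  simp [lineDeriv]

theorem grad_combo {u w : V → ℝ} {x : V} (hu : DifferentiableAt ℝ u x) (hw : DifferentiableAt ℝ w x) (a b : ℝ) :
    gradient (fun y => a * u y - b * w y) x = a • gradient u x - b • gradient w x := by
  refine ext_inner_right ℝ fun v => ?_
  rw [grad_inner, inner_sub_left, real_inner_smul_left, real_inner_smul_left, grad_inner, grad_inner, fderiv_fun_sub (hu.const_mul a) (hw.const_mul b), fderiv_const_mul hu, fderiv_const_mul hw]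
  rfl

theorem grad_lin (e x : V) : gradient (fun y : V => ⟪y, e⟫) x = e := by
  refine ext_inner_right ℝ fun v => ?_
  rw [grad_inner, fderiv_inner_apply ℝ differentiableAt_fun_id (differentiableAt_const e)]
  simp [real_inner_comm]

theorem lin_lip (e : V) : LipschitzWith ‖e‖₊ (fun y : V => ⟪y, e⟫) := by
  refine LipschitzWith.of_dist_le_mul fun x y => ?_
  rw [Real.dist_eq, ← inner_sub_left, mul_comm, dist_eq_norm]
  exact abs_real_inner_le_norm _ _

theorem extend_inside [Nontrivial V] {u w : V → ℝ} {K : ℝ≥0} (hu : LipschitzWith K u) (hw : LipschitzWith K w) {C : ℝ} (hCu : ∀ x, |u x| ≤ C) (hCw : ∀ x, |w x| ≤ C)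
    (hu0 : ∀ x, 0 ≤ u x) (hw0 : ∀ x, 0 ≤ w x) (huw : ∀ x, u x * w x = 0) {R r₁ r₂ : ℝ} (hWu : WSub R u) (hWw : WSub R w) (h1 : 0 < r₁) (h12 : r₁ < r₂) (h2R : r₂ < R)
    {e : V} (he : ‖e‖ = 1) {kp km : ℝ} (hkp : 0 < kp) (hkm : 0 < km)
    (hann : ∀ x : V, ‖x‖ ∈ Ioo r₁ r₂ → u x = kp * max ⟪x, e⟫ 0 ∧ w x = km * max (-⟪x, e⟫) 0) :
    ∀ x : V, ‖x‖ < r₂ → u x = kp * max ⟪x, e⟫ 0 ∧ w x = km * max (-⟪x, e⟫) 0 := by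
  set h := (r₂ - r₁)/3 with hh
  have hhp : 0 < h := by rw [hh]; linarith
  have hr2 : r₁ + 3 * h = r₂ := by rw [hh]; ring
  have hg := cut_lip hhp (r₁ + 2 * h)
  set g : ℝ → ℝ := fun ρ : ℝ => min 1 (max 0 ((r₁ + 2 * h - ρ)/h)) with hgdef
  have hg0 : ∀ ρ, 0 ≤ g ρ := fun ρ => le_min zero_le_one (le_max_left _ _)
  have hg1 : ∀ ρ, g ρ ≤ 1 := fun ρ => min_le_left _ _
  have hgB : ∀ ρ, |g ρ| ≤ 1 := fun ρ => by rw [abs_of_nonneg (hg0 ρ)]; exact hg1 ρ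
  have hgone : ∀ ρ, ρ ≤ r₁ + h → g ρ = 1 := fun ρ hρ => by
    refine min_eq_left (le_max_of_le_right ?_)
    rw [le_div_iff₀ hhp]; linarith
  have hgz : ∀ ρ, r₁ + 2 * h ≤ ρ → g ρ = 0 := fun ρ hρ => by
    have : (r₁ + 2 * h - ρ)/h ≤ 0 := div_nonpos_of_nonpos_of_nonneg (by linarith) hhp.le
    simp only [hgdef, max_eq_left this]; simp
  have hd1 : ∀ ρ, ρ < r₁ + h → deriv g ρ = 0 := fun ρ hρ => by
    have : g =ᶠ[nhds ρ] fun _ => 1 := by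
      filter_upwards [gt_mem_nhds hρ] with y hy using hgone y hy.le
    rw [this.deriv_eq]; simp
  have hd2 : ∀ ρ, r₁ + 2 * h < ρ → deriv g ρ = 0 := fun ρ hρ => by
    have : g =ᶠ[nhds ρ] fun _ => 0 := by
      filter_upwards [lt_mem_nhds hρ] with y hy using hgz y hy.le
    rw [this.deriv_eq]; simp
  have hdb : ∀ ρ, |deriv g ρ| ≤ (h⁻¹).toNNReal := fun ρ => norm_deriv_le_of_lipschitz hg
  have hdm := measurable_deriv g
  have hgm := hg.continuous.measurable
  -- the combined function
  set W : V → ℝ := fun y => kp⁻¹ * u y - km⁻¹ * w y with hWdef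
  obtain ⟨L, hL⟩ : ∃ L, LipschitzWith L W := by
    have a := (lip_mul_bdd (LipschitzWith.const kp⁻¹ (α := V)) hu (A := |kp⁻¹|) (fun _ => le_rfl) hCu)
    have b := (lip_mul_bdd (LipschitzWith.const km⁻¹ (α := V)) hw (A := |km⁻¹|) (fun _ => le_rfl) hCw)
    obtain ⟨M1, a⟩ := a
    obtain ⟨M2, b⟩ := b
    exact ⟨_, a.sub b⟩
  have hWB : ∀ x, |W x| ≤ kp⁻¹ * C + km⁻¹ * C := fun x => by
    have h3 : |kp⁻¹ * u x| ≤ kp⁻¹ * C := by rw [abs_mul, abs_of_pos (inv_pos.2 hkp)]; exact mul_le_mul_of_nonneg_left (hCu x) (inv_pos.2 hkp).le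
    have h4 : |km⁻¹ * w x| ≤ km⁻¹ * C := by rw [abs_mul, abs_of_pos (inv_pos.2 hkm)]; exact mul_le_mul_of_nonneg_left (hCw x) (inv_pos.2 hkm).le
    exact (abs_sub _ _).trans (add_le_add h3 h4)
  have hWann : ∀ x : V, ‖x‖ ∈ Ioo r₁ r₂ → W x = ⟪x, e⟫ := fun x hx => by
    obtain ⟨a, b⟩ := hann x hx
    simp only [hWdef, a, b]
    rw [inv_mul_cancel_left₀ hkp.ne', inv_mul_cancel_left₀ hkm.ne']
    rcases le_total ⟪x, e⟫ 0 with hl | hl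
    · rw [max_eq_right hl, max_eq_left (by linarith)]; ring
    · rw [max_eq_left hl, max_eq_right (by linarith)]; ring
  have hopen : IsOpen {x : V | ‖x‖ ∈ Ioo r₁ r₂} := isOpen_Ioo.preimage continuous_norm
  have hWgrad : ∀ x : V, ‖x‖ ∈ Ioo r₁ r₂ → gradient W x = e := fun x hx => by
    have : W =ᶠ[nhds x] fun y => ⟪y, e⟫ := by
      filter_upwards [hopen.mem_nhds hx] with y hy using hWann y hy
    rw [this.gradient_eq, grad_lin]
  -- first inequality
  have sgu : ∀ x, u x = 0 ∨ w x = 0 := fun x => mul_eq_zero.1 (huw x)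
  set F1 : V → ℝ := fun x => g ‖x‖ * ‖gradient W x‖^2 with hF1
  set F2 : V → ℝ := fun x => g ‖x‖ * ⟪gradient W x, e⟫ with hF2
  set F3 : V → ℝ := fun x => g ‖x‖ with hF3
  set J : V → ℝ := fun x => deriv g ‖x‖ * (⟪x, e⟫ * ⟪e, ‖x‖⁻¹ • x⟫) with hJ
  have hWm := grad_meas W
  have hnu : ∀ x : V, ‖‖x‖⁻¹ • x‖ ≤ 1 := fun x => by
    by_cases hx : x = 0
    · simp [hx]
    · exact (unit_of_ne hx).le
  have hGW : ∀ x, ‖gradient W x‖ ≤ L := fun x => grad_norm_le hL x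
  have iF1 : Integrable F1 := by
    refine bdd_ball_int (C := (L:ℝ)^2) (M := r₁ + 2*h) (by fun_prop) (fun x => ?_) (fun x hx => by simp only [hF1, hgz _ hx.le, zero_mul])
    rw [hF1]; simp only
    rw [abs_mul, abs_of_nonneg (sq_nonneg ‖gradient W x‖)]
    have := pow_le_pow_left₀ (norm_nonneg _) (hGW x) 2
    nlinarith [hgB ‖x‖, sq_nonneg ‖gradient W x‖]
  have iF2 : Integrable F2 := by
    refine bdd_ball_int (C := (L:ℝ)) (M := r₁ + 2*h) (by fun_prop) (fun x => ?_) (fun x hx => by simp only [hF2, hgz _ hx.le, zero_mul])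
    rw [hF2]; simp only
    rw [abs_mul]
    have h3 := abs_real_inner_le_norm (gradient W x) e
    rw [he, mul_one] at h3
    nlinarith [hgB ‖x‖, abs_nonneg (g ‖x‖), abs_nonneg ⟪gradient W x, e⟫, hGW x]
  have iF3 : Integrable F3 := 
    bdd_ball_int (C := 1) (M := r₁ + 2*h) (by fun_prop) (fun x => hgB _) (fun x hx => by simp only [hF3, hgz _ hx.le])
  have iJ : Integrable J := by
    refine bdd_ball_int (C := (h⁻¹).toNNReal * (r₂ * 1)) (M := r₁ + 2*h) (by fun_prop) (fun x => ?_) (fun x hx => by simp only [hJ, hd2 _ hx, zero_mul])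
    rw [hJ]; simp only
    by_cases hx : ‖x‖ ≤ r₂
    · rw [abs_mul, abs_mul]
      have h3 := abs_real_inner_le_norm x e
      have h4 := abs_real_inner_le_norm e (‖x‖⁻¹ • x)
      rw [he, mul_one] at h3
      rw [he, one_mul] at h4
      exact mul_le_mul (hdb _) (mul_le_mul (h3.trans hx) (h4.trans (hnu x)) (abs_nonneg _) (by linarith)) (by positivity) (NNReal.coe_nonneg _)
    · rw [hd2 _ (by linarith [not_le.1 hx]), zero_mul, abs_zero]
      have : 0 < r₂ := h1.trans h12
      positivity
  have hJeq : ∀ x, deriv g ‖x‖ * (W x * nuD W x) = J x := fun x => by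
    by_cases hx : ‖x‖ ∈ Ioo r₁ r₂
    · simp only [hJ, hWann x hx, nuD, hWgrad x hx]
    · have : deriv g ‖x‖ = 0 := by
        by_cases h3 : ‖x‖ < r₁ + h
        · exact hd1 _ h3
        · refine hd2 _ ?_
          by_contra h4
          exact hx ⟨by linarith, by linarith⟩
      simp only [hJ, this, zero_mul]
  have hJeq2 : ∀ x, W x * deriv g ‖x‖ * ⟪‖x‖⁻¹ • x, e⟫ = J x := fun x => by
    by_cases hx : ‖x‖ ∈ Ioo r₁ r₂
    · simp only [hJ, hWann x hx]; rw [real_inner_comm (‖x‖⁻¹ • x) e]; ring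
    · have : deriv g ‖x‖ = 0 := by
        by_cases h3 : ‖x‖ < r₁ + h
        · exact hd1 _ h3
        · refine hd2 _ ?_
          by_contra h4
          exact hx ⟨by linarith, by linarith⟩
      simp only [hJ, this, zero_mul, mul_zero]
  have hne : ∀ᵐ x : V, x ≠ 0 := by
    rw [ae_iff]; simp
  have I1 : (∫ x, F1 x) + ∫ x, J x ≤ 0 := by
    have a := weak_rad0 hu hCu hu0 hWu hg hg0 hgB (show r₁ + 2 * h < R by linarith) (fun ρ hρ => hgz ρ hρ.le)
    have b := weak_rad0 hw hCw hw0 hWw hg hg0 hgB (show r₁ + 2 * h < R by linarith) (fun ρ hρ => hgz ρ hρ.le)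
    have int : ∀ (f : V → ℝ), LipschitzWith K f → (∀ x, |f x| ≤ C) → Integrable (fun x : V => (g ‖x‖ * ‖gradient f x‖ ^ 2 + deriv g ‖x‖ * (f x * nuD f x))) := by
      intro f hf hC
      have hfm := grad_meas f
      have hnm := nuD_meas f
      have hfc := hf.continuous.measurable
      refine bdd_ball_int (C := 1 * (K:ℝ)^2 + (h⁻¹).toNNReal * (C * K)) (M := r₁ + 2*h) (by fun_prop) (fun x => ?_) (fun x hx => by simp only [hgz _ hx.le, hd2 _ hx, zero_mul, add_zero])
      refine (abs_add_le _ _).trans (add_le_add ?_ ?_)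
      · rw [abs_mul]; exact mul_le_mul (hgB _) (gsq_bdd hf x) (abs_nonneg _) zero_le_one
      · rw [abs_mul, abs_mul]
        exact mul_le_mul (hdb _) (mul_le_mul (hC x) (nuD_le hf x) (abs_nonneg _) ((abs_nonneg _).trans (hC x))) (by positivity) (NNReal.coe_nonneg _)
    have iu := int u hu hCu
    have iw := int w hw hCw
    have e1 := integral_add (iu.const_mul (kp⁻¹^2)) (iw.const_mul (km⁻¹^2))
    rw [integral_const_mul, integral_const_mul] at e1
    have e2 := integral_add iF1 iJ
    have e3 : ∫ x, (F1 x + J x) = ∫ x : V, (kp⁻¹^2 * (g ‖x‖ * ‖gradient u x‖ ^ 2 + deriv g ‖x‖ * (u x * nuD u x)) + km⁻¹^2 * (g ‖x‖ * ‖gradient w x‖ ^ 2 + deriv g ‖x‖ * (w x * nuD w x))) := by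
      refine integral_congr_ae ?_
      filter_upwards [hu.ae_differentiableAt, hw.ae_differentiableAt] with x du dw
      rw [← hJeq x]
      have hgr := grad_combo du dw kp⁻¹ km⁻¹
      simp only [hF1, nuD]
      rw [show gradient W x = _ from hgr]
      rcases sgu x with z | z
      · rw [grad_zero_of_min hu0 z]
        simp only [hWdef, z, smul_zero, zero_sub, inner_neg_left, norm_neg, norm_smul, real_inner_smul_left, mul_pow, inner_zero_left, norm_zero, Real.norm_eq_abs, sq_abs]
        ring
      · rw [grad_zero_of_min hw0 z]
        simp only [hWdef, z, smul_zero, sub_zero, norm_smul, real_inner_smul_left, mul_pow, inner_zero_left, norm_zero, Real.norm_eq_abs, sq_abs]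
        ring
    rw [← e2, e3, e1]
    have p1 := mul_nonneg (sq_nonneg kp⁻¹) (neg_nonneg.2 a)
    have p2 := mul_nonneg (sq_nonneg km⁻¹) (neg_nonneg.2 b)
    linarith
  have hcs : ∀ f : V → ℝ, (∀ x, r₁ + 2 * h ≤ ‖x‖ → f x = 0) → HasCompactSupport f := fun f hf => by
    refine HasCompactSupport.of_support_subset_isCompact (isCompact_closedBall (0:V) (r₁ + 2*h)) fun x hx => ?_
    rw [mem_closedBall_zero_iff]
    by_contra h3
    exact hx (hf x (not_le.1 h3).le)
  have I2 : (∫ x, F2 x) + ∫ x, J x = 0 := by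
    obtain ⟨M, hM⟩ := lip_mul_bdd hL (lip_rad (V := V) hg) hWB (fun x => hgB ‖x‖)
    rw [← int_dir_zero hM (hcs _ fun x hx => by simp only [hgz _ hx, mul_zero]) e, ← integral_add iF2 iJ]
    refine integral_congr_ae ?_
    filter_upwards [hne, hL.ae_differentiableAt, pol_ae_rad (V := V) hg.ae_differentiableAt] with x a b c
    rw [grad_mul_rad a b c, inner_add_left, real_inner_smul_left, real_inner_smul_left, hJeq2]
  have I3 : (∫ x, F3 x) + ∫ x, J x = 0 := by
    have hcl : LipschitzWith ‖e‖₊ (fun y : V => max (-r₂) (min ⟪y, e⟫ r₂)) := ((lin_lip e).min_const r₂).const_max (-r₂)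
    have hclB : ∀ y : V, |max (-r₂) (min ⟪y, e⟫ r₂)| ≤ r₂ := fun y => by
      rw [abs_le]; exact ⟨le_max_left _ _, max_le (by linarith) (min_le_right _ _)⟩
    obtain ⟨M, hM⟩ := lip_mul_bdd hcl (lip_rad (V := V) hg) hclB (fun x => hgB ‖x‖)
    have hM' : LipschitzWith M (fun x : V => ⟪x, e⟫ * g ‖x‖) := by
      convert hM using 1
      funext x
      by_cases hx : r₁ + 2 * h ≤ ‖x‖
      · simp only [hgz _ hx, mul_zero]
      · have h3 := abs_le.1 (abs_real_inner_le_norm x e)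
        rw [he, mul_one] at h3
        rw [min_eq_left (by linarith), max_eq_right (by linarith)]
    rw [← int_dir_zero hM' (hcs _ fun x hx => by simp only [hgz _ hx, mul_zero]) e, ← integral_add iF3 iJ]
    refine integral_congr_ae ?_
    filter_upwards [hne, (lin_lip e).ae_differentiableAt, pol_ae_rad (V := V) hg.ae_differentiableAt] with x a b c
    rw [grad_mul_rad a b c, inner_add_left, real_inner_smul_left, real_inner_smul_left, grad_lin, real_inner_self_eq_norm_sq, he]
    simp only [hJ, hF3]; rw [real_inner_comm (‖x‖⁻¹ • x) e]; ring
  have I4 : ∫ x, g ‖x‖ * ‖gradient W x - e‖^2 = (∫ x, F1 x) - 2 * (∫ x, F2 x) + ∫ x, F3 x := by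
    have a := integral_sub iF1 (iF2.const_mul 2)
    have b := integral_add (iF1.sub (iF2.const_mul 2)) iF3
    simp only [Pi.sub_apply] at b
    rw [a, integral_const_mul] at b
    rw [← b]
    refine integral_congr_ae (Eventually.of_forall fun x => ?_)
    simp only [hF1, hF2, hF3]
    rw [norm_sub_sq_real, he]; ring
  have iF4 : Integrable (fun x => g ‖x‖ * ‖gradient W x - e‖^2) := by
    refine ((iF1.sub (iF2.const_mul 2)).add iF3).congr (Eventually.of_forall fun x => ?_)
    simp only [hF1, hF2, hF3, Pi.add_apply, Pi.sub_apply]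
    rw [norm_sub_sq_real, he]; ring
  have h40 : ∀ x, 0 ≤ g ‖x‖ * ‖gradient W x - e‖^2 := fun x => mul_nonneg (hg0 _) (sq_nonneg _)
  have I5 : ∫ x, g ‖x‖ * ‖gradient W x - e‖^2 = 0 := le_antisymm (by rw [I4]; linarith) (integral_nonneg h40)
  have hz := (integral_eq_zero_iff_of_nonneg h40 iF4).1 I5
  have hLl := hL.sub (lin_lip e)
  have hconst := const_of_grad_zero (R := r₁ + h) hLl (by
    filter_upwards [hz, hL.ae_differentiableAt] with x hx hd hb
    rw [mem_ball_zero_iff] at hb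
    have h3 := grad_combo hd (show DifferentiableAt ℝ (fun y : V => ⟪y, e⟫) x from differentiableAt_fun_id.inner ℝ (differentiableAt_const e)) 1 1
    simp only [one_mul, one_smul, grad_lin] at h3
    rw [h3]
    simp only [Pi.zero_apply, hgone _ hb.le, one_mul] at hx
    exact norm_eq_zero.1 (pow_eq_zero_iff two_ne_zero |>.1 hx))
  have hWl : ∀ x : V, ‖x‖ < r₁ + h → W x = ⟪x, e⟫ := by
    have h3 : ‖(r₁ + h/2) • e‖ = r₁ + h/2 := by rw [norm_smul, he, mul_one, Real.norm_of_nonneg (by linarith)]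
    have h4 := hconst ((r₁ + h/2) • e) (by rw [mem_ball_zero_iff, h3]; linarith)
    rw [hWann _ (by rw [h3]; exact ⟨by linarith, by linarith⟩), sub_self] at h4
    intro x hx
    have h5 := hconst x (by rwa [mem_ball_zero_iff])
    rw [← h4] at h5
    linarith
  intro x hx
  by_cases hx1 : r₁ < ‖x‖
  · exact hann x ⟨hx1, hx⟩
  have h3 := hWl x (by linarith)
  simp only [hWdef] at h3
  have hpi := inv_pos.2 hkp
  have hmi := inv_pos.2 hkm
  rcases sgu x with z | z
  · rw [z, mul_zero, zero_sub] at h3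
    have : 0 ≤ km⁻¹ * w x := mul_nonneg hmi.le (hw0 x)
    rw [max_eq_right (by linarith), max_eq_left (by linarith), z, mul_zero]
    refine ⟨rfl, ?_⟩
    rw [← h3, neg_neg, mul_inv_cancel_left₀ hkm.ne']
  · rw [z, mul_zero, sub_zero] at h3
    have : 0 ≤ kp⁻¹ * u x := mul_nonneg hpi.le (hu0 x)
    rw [max_eq_left (by linarith), max_eq_right (by linarith), z, mul_zero]
    refine ⟨?_, rfl⟩
    rw [← h3, mul_inv_cancel_left₀ hkp.ne']
end G2

section H
theorem glob_ext {n : ℕ} {v : E n → ℝ} (hc : ContinuousOn v (B1 n))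
    (hl : ∀ x ∈ B1 n, ∃ (K : ℝ≥0) (ε : ℝ), 0 < ε ∧ ball x ε ⊆ B1 n ∧ LipschitzOnWith K v (ball x ε))
    (h0 : ∀ x ∈ B1 n, 0 ≤ v x) {R R' : ℝ} (hRR : R < R') (hR1 : R' < 1) :
    ∃ (u : E n → ℝ) (K : ℝ≥0) (C : ℝ), LipschitzWith K u ∧ (∀ x, |u x| ≤ C) ∧ (∀ x, 0 ≤ u x) ∧ (∀ x ∈ ball (0 : E n) R, u x = v x) ∧
      (∀ x, ∃ t, (x ∈ B1 n → u x = v x * t) ∧ (x ∉ B1 n → u x = 0)) := by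
  have hsub : closedBall (0 : E n) R' ⊆ B1 n := fun x hx => by
    rw [mem_closedBall_zero_iff] at hx
    rw [B1, mem_ball_zero_iff]; linarith
  have hcomp := isCompact_closedBall (0 : E n) R'
  have hll : LocallyLipschitzOn (closedBall (0 : E n) R') v := fun x hx => by
    obtain ⟨K, ε, hε, -, hK⟩ := hl x (hsub hx)
    exact ⟨K, ball x ε, mem_nhdsWithin_of_mem_nhds (ball_mem_nhds x hε), hK⟩
  obtain ⟨K, hK⟩ := hll.exists_lipschitzOnWith_of_compact hcomp
  obtain ⟨g, hg, hgv⟩ := hK.extend_real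
  obtain ⟨C, hC⟩ := hcomp.exists_bound_of_continuousOn (hc.mono hsub)
  set g' : E n → ℝ := fun x => max 0 (min (g x) |C|) with hg'
  have hgl : LipschitzWith K g' := (hg.min_const _).const_max 0
  have hg0 : ∀ x, 0 ≤ g' x := fun x => le_max_left _ _
  have hgB : ∀ x, |g' x| ≤ |C| := fun x => by
    rw [abs_of_nonneg (hg0 x)]; exact max_le (abs_nonneg _) (min_le_right _ _)
  have hgv' : ∀ x ∈ closedBall (0 : E n) R', g' x = v x := fun x hx => by
    have a := hC x hx
    have b := h0 x (hsub hx)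
    rw [Real.norm_of_nonneg b] at a
    simp only [hg', ← hgv hx]
    rw [min_eq_left (a.trans (le_abs_self C)), max_eq_right b]
  have hh : 0 < R' - R := by linarith
  have hcl := cut_lip hh R'
  set c : ℝ → ℝ := fun ρ : ℝ => min 1 (max 0 ((R' - ρ)/(R' - R))) with hcd
  have c0 : ∀ ρ, 0 ≤ c ρ := fun ρ => le_min zero_le_one (le_max_left _ _)
  have c1 : ∀ ρ, |c ρ| ≤ 1 := fun ρ => by rw [abs_of_nonneg (c0 ρ)]; exact min_le_left _ _
  have cone : ∀ ρ, ρ ≤ R → c ρ = 1 := fun ρ hρ => by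
    refine min_eq_left (le_max_of_le_right ?_)
    rw [le_div_iff₀ hh]; linarith
  have cz : ∀ ρ, R' ≤ ρ → c ρ = 0 := fun ρ hρ => by
    have : (R' - ρ)/(R' - R) ≤ 0 := div_nonpos_of_nonpos_of_nonneg (by linarith) hh.le
    simp only [hcd, max_eq_left this]; simp
  obtain ⟨M, hM⟩ := lip_mul_bdd hgl (lip_rad (V := E n) hcl) hgB (fun x => c1 ‖x‖)
  refine ⟨_, M, |C| * 1, hM, fun x => ?_, fun x => mul_nonneg (hg0 x) (c0 _), fun x hx => ?_, fun x => ?_⟩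
  · rw [abs_mul]; exact mul_le_mul (hgB x) (c1 _) (abs_nonneg _) (abs_nonneg _)
  · rw [mem_ball_zero_iff] at hx
    simp only [cone _ hx.le, mul_one]
    exact hgv' x (by rw [mem_closedBall_zero_iff]; linarith)
  · refine ⟨c ‖x‖, fun hx => ?_, fun hx => ?_⟩
    · by_cases h : ‖x‖ ≤ R'
      · simp only [hgv' x (by rwa [mem_closedBall_zero_iff])]
      · simp only [cz _ (not_le.1 h).le, mul_zero]
    · have : R' ≤ ‖x‖ := by
        by_contra h
        exact hx (hsub (by rw [mem_closedBall_zero_iff]; exact (not_le.1 h).le))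
      simp only [cz _ this, mul_zero]

theorem grad_int_eq {n : ℕ} {v u : E (n+2) → ℝ} {K : ℝ≥0} (hu : LipschitzWith K u) {R r : ℝ} (hr : 0 ≤ r) (hrR : r ≤ R) (huv : ∀ x ∈ ball (0 : E (n+2)) R, u x = v x) :
    ∫ x in ball (0 : E (n+2)) r, ‖gradient v x‖ ^ 2 / ‖x‖ ^ (n + 2 - 2) = Aint u r := by
  rw [show n + 2 - 2 = n from rfl, Aint, ← (A_pol (k := n) (by simp) (((grad_meas u).norm).pow_const 2) (gsq_bdd hu) hr).2]
  refine setIntegral_congr_fun measurableSet_ball fun x hx => ?_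
  have : v =ᶠ[nhds x] u := by
    filter_upwards [isOpen_ball.mem_nhds (ball_subset_ball hrR hx)] with y hy using (huv y hy).symm
  simp only [this.gradient_eq]

theorem zero_case {n : ℕ} {u : E (n+2) → ℝ} {K : ℝ≥0} (hu : LipschitzWith K u) {r : ℝ} (hr : 0 ≤ r) (hA : Aint u r = 0) :
    ∀ x ∈ ball (0 : E (n+2)) r, u x = u 0 := by
  refine const_of_grad_zero hu ?_
  obtain ⟨a, b⟩ := A_pol (V := E (n+2)) (k := n) (by simp) (((grad_meas u).norm).pow_const 2) (gsq_bdd hu) hr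
  have b' := b.trans hA
  rw [setIntegral_eq_zero_iff_of_nonneg_ae (Eventually.of_forall fun x => by positivity) a] at b'
  have hne : ∀ᵐ x : E (n+2), x ≠ 0 := by
    rw [ae_iff]; simp
  have b2 := (ae_restrict_iff' measurableSet_ball).1 b'
  filter_upwards [b2, hne] with x hx hx0 hb
  have := hx hb
  simp only [Pi.zero_apply] at this
  have hp : ‖x‖ ^ n ≠ 0 := pow_ne_zero _ (norm_ne_zero_iff.2 hx0)
  rw [div_eq_zero_iff, or_iff_left hp] at this
  exact norm_eq_zero.1 (pow_eq_zero_iff two_ne_zero |>.1 this)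

theorem ACF_main (n : ℕ) (up um : E (n + 2) → ℝ)
    (hupc : ContinuousOn up (B1 (n + 2))) (humc : ContinuousOn um (B1 (n + 2)))
    (huplip : ∀ x ∈ B1 (n + 2), ∃ (K : ℝ≥0) (ε : ℝ), 0 < ε ∧ ball x ε ⊆ B1 (n + 2) ∧
      LipschitzOnWith K up (ball x ε))
    (humlip : ∀ x ∈ B1 (n + 2), ∃ (K : ℝ≥0) (ε : ℝ), 0 < ε ∧ ball x ε ⊆ B1 (n + 2) ∧
      LipschitzOnWith K um (ball x ε))
    (hup0 : ∀ x ∈ B1 (n + 2), 0 ≤ up x) (hum0 : ∀ x ∈ B1 (n + 2), 0 ≤ um x)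
    (hprod : ∀ x ∈ B1 (n + 2), up x * um x = 0)
    (hsubp : SubharmonicOn (B1 (n + 2)) up) (hsubm : SubharmonicOn (B1 (n + 2)) um)
    (r₁ r₂ : ℝ) (hr₁ : 0 < r₁) (hr₁₂ : r₁ < r₂) (hr₂ : r₂ < 1)
    (heq : ACF (n + 2) up um r₁ = ACF (n + 2) up um r₂) :
    ((∀ x ∈ ball (0 : E (n + 2)) r₂, up x = 0) ∨
      (∀ x ∈ ball (0 : E (n + 2)) r₂, um x = 0)) ∨
    ∃ (e : E (n + 2)) (kp km : ℝ), ‖e‖ = 1 ∧ 0 < kp ∧ 0 < km ∧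
      ∀ x ∈ ball (0 : E (n + 2)) r₂,
        up x = kp * max ⟪x, e⟫ 0 ∧ um x = km * max (-⟪x, e⟫) 0 := by
  obtain ⟨R, h2R, hR1⟩ := exists_between hr₂
  obtain ⟨R', hRR', hR'1⟩ := exists_between hR1
  have hN : Module.finrank ℝ (E (n+2)) = n + 2 := by simp
  have hr2p : 0 < r₂ := hr₁.trans hr₁₂
  obtain ⟨u, K1, C1, hu, hCu, hu0, huv, hut⟩ := glob_ext hupc huplip hup0 hRR' hR'1
  obtain ⟨w, K2, C2, hw, hCw, hw0, hwv, hwt⟩ := glob_ext humc humlip hum0 hRR' hR'1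
  have huw : ∀ x, u x * w x = 0 := fun x => by
    obtain ⟨t, h1, h2⟩ := hut x
    obtain ⟨s, h3, h4⟩ := hwt x
    by_cases hx : x ∈ B1 (n+2)
    · rw [h1 hx, h3 hx]; linear_combination (t * s) * hprod x hx
    · rw [h2 hx, zero_mul]
  have hWu : WSub R u := fun ξ K hξ hp M hM hz => weak_sub_E hu hR1.le hsubp huv hξ hp hM hz
  have hWw : WSub R w := fun ξ K hξ hp M hM hz => weak_sub_E hw hR1.le hsubm hwv hξ hp hM hz
  have hb : ∀ x ∈ ball (0 : E (n+2)) r₂, up x = u x ∧ um x = w x := fun x hx =>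
    ⟨(huv x (ball_subset_ball h2R.le hx)).symm, (hwv x (ball_subset_ball h2R.le hx)).symm⟩
  have hpb : ∀ x ∈ ball (0 : E (n+2)) r₂, up x * um x = 0 := fun x hx => hprod x (ball_subset_ball hr₂.le hx)
  have e1 : Aint u r₁ * Aint w r₁ * (r₁^4)⁻¹ = Aint u r₂ * Aint w r₂ * (r₂^4)⁻¹ := by
    rw [ACF, ACF, grad_int_eq hu hr₁.le (by linarith) huv, grad_int_eq hw hr₁.le (by linarith) hwv,
      grad_int_eq hu hr2p.le h2R.le huv, grad_int_eq hw hr2p.le h2R.le hwv, one_div, one_div] at heq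
    linear_combination heq
  by_cases hz : Aint u r₂ * Aint w r₂ = 0
  · left
    rcases mul_eq_zero.1 hz with h | h
    · have hc := zero_case hu hr2p.le h
      by_cases h0 : u 0 = 0
      · exact Or.inl fun x hx => by rw [(hb x hx).1, hc x hx, h0]
      · refine Or.inr fun x hx => ?_
        have h3 := hpb x hx
        rw [(hb x hx).1, hc x hx] at h3
        exact (mul_eq_zero.1 h3).resolve_left h0
    · have hc := zero_case hw hr2p.le h
      by_cases h0 : w 0 = 0
      · exact Or.inr fun x hx => by rw [(hb x hx).2, hc x hx, h0]
      · refine Or.inl fun x hx => ?_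
        have h3 := hpb x hx
        rw [(hb x hx).2, hc x hx] at h3
        exact (mul_eq_zero.1 h3).resolve_right h0
  right
  have hz1 : Aint u r₁ * Aint w r₁ ≠ 0 := fun h => by
    rw [h, zero_mul] at e1
    have := (mul_eq_zero.1 e1.symm).resolve_left hz
    exact (inv_ne_zero (pow_ne_zero 4 hr2p.ne')) this
  have hA : 0 < Aint u r₁ := lt_of_le_of_ne (Aint_nonneg u hr₁.le) (left_ne_zero_of_mul hz1).symm
  have hB : 0 < Aint w r₁ := lt_of_le_of_ne (Aint_nonneg w hr₁.le) (right_ne_zero_of_mul hz1).symm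
  have hu' := hu.weaken (le_max_left K1 K2)
  have hw' := hw.weaken (le_max_right K1 K2)
  have hCu' : ∀ x, |u x| ≤ max C1 C2 := fun x => (hCu x).trans (le_max_left _ _)
  have hCw' : ∀ x, |w x| ≤ max C1 C2 := fun x => (hCw x).trans (le_max_right _ _)
  have hphi := phi_eq hN hu' hw' hCu' hCw' hu0 hw0 huw hWu hWw hr₁ hr₁₂ h2R hA hB e1
  obtain ⟨r₀, hr0, hS⟩ : ∃ r₀ ∈ Ioo r₁ r₂, ∃ (e : E (n+2)) (kp km : ℝ), ‖e‖ = 1 ∧ 0 < kp ∧ 0 < km ∧ ∀ θ : E (n+2), ‖θ‖ = 1 → u (r₀ • θ) = kp * max ⟪θ, e⟫ 0 ∧ w (r₀ • θ) = km * max (-⟪θ, e⟫) 0 := by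
    by_contra hcon
    push Not at hcon
    have h3 : ∀ᵐ r : ℝ, r ∉ Ioo r₁ r₂ := by
      filter_upwards [hphi] with r hr hm
      obtain ⟨-, -, e, kp, km, a, b, c, d⟩ := hr hm
      obtain ⟨θ, t1, t2⟩ := hcon r hm e kp km a b c
      exact t2 (d θ t1).1 (d θ t1).2
    have h4 : volume (Ioo r₁ r₂) = 0 := measure_eq_zero_iff_ae_notMem.2 h3
    rw [Real.volume_Ioo, ENNReal.ofReal_eq_zero] at h4
    linarith
  obtain ⟨e, kp, km, he, hkp, hkm, hf⟩ := hS
  have hr0p : 0 < r₀ := hr₁.trans hr0.1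
  have hmu := homog hN hu hCu hr₁ hr₁₂ (hphi.mono fun r hr hm => (hr hm).1) hr0
  have hmw := homog hN hw hCw hr₁ hr₁₂ (hphi.mono fun r hr hm => (hr hm).2.1) hr0
  have hann : ∀ x : E (n+2), ‖x‖ ∈ Ioo r₁ r₂ → u x = kp / r₀ * max ⟪x, e⟫ 0 ∧ w x = km / r₀ * max (-⟪x, e⟫) 0 := fun x hx => by
    have hxp : 0 < ‖x‖ := hr₁.trans hx.1
    have h3 := hf (‖x‖⁻¹ • x) (by rw [norm_smul, norm_inv, norm_norm, inv_mul_cancel₀ hxp.ne'])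
    rw [hmu x hx, hmw x hx, h3.1, h3.2, real_inner_smul_left]
    have m1 : max (‖x‖⁻¹ * ⟪x, e⟫) 0 = ‖x‖⁻¹ * max ⟪x, e⟫ 0 := by
      rw [mul_max_of_nonneg _ _ (inv_pos.2 hxp).le, mul_zero]
    have m2 : max (-(‖x‖⁻¹ * ⟪x, e⟫)) 0 = ‖x‖⁻¹ * max (-⟪x, e⟫) 0 := by
      rw [mul_max_of_nonneg _ _ (inv_pos.2 hxp).le, mul_zero, mul_neg]
    rw [m1, m2]
    constructor <;> field_simp
  have hfin := extend_inside hu' hw' hCu' hCw' hu0 hw0 huw hWu hWw hr₁ hr₁₂ h2R he (div_pos hkp hr0p) (div_pos hkm hr0p) hann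
  refine ⟨e, kp / r₀, km / r₀, he, div_pos hkp hr0p, div_pos hkm hr0p, fun x hx => ?_⟩
  rw [(hb x hx).1, (hb x hx).2]
  exact hfin x (by rwa [mem_ball_zero_iff] at hx)
end H

/-- **Equality case in the ACF monotonicity formula.** Under the ACF hypotheses, if
`Φ(r₁) = Φ(r₂)` for some `0 < r₁ < r₂ < 1`, then either `u₊ ≡ 0` or `u₋ ≡ 0` in `B_{r₂}`,
or `u₊ = k₊(x·e)⁺` and `u₋ = k₋(x·e)⁻` in `B_{r₂}` for a unit vector `e` and `k₊, k₋ > 0`. -/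
theorem ACF_equality_case (n : ℕ) (up um : E (n + 2) → ℝ)
    (hupc : ContinuousOn up (B1 (n + 2))) (humc : ContinuousOn um (B1 (n + 2)))
    (huplip : ∀ x ∈ B1 (n + 2), ∃ (K : ℝ≥0) (ε : ℝ), 0 < ε ∧ ball x ε ⊆ B1 (n + 2) ∧
      LipschitzOnWith K up (ball x ε))
    (humlip : ∀ x ∈ B1 (n + 2), ∃ (K : ℝ≥0) (ε : ℝ), 0 < ε ∧ ball x ε ⊆ B1 (n + 2) ∧
      LipschitzOnWith K um (ball x ε))
    (hup0 : ∀ x ∈ B1 (n + 2), 0 ≤ up x) (hum0 : ∀ x ∈ B1 (n + 2), 0 ≤ um x)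
    (hprod : ∀ x ∈ B1 (n + 2), up x * um x = 0)
    (hsubp : SubharmonicOn (B1 (n + 2)) up) (hsubm : SubharmonicOn (B1 (n + 2)) um)
    (r₁ r₂ : ℝ) (hr₁ : 0 < r₁) (hr₁₂ : r₁ < r₂) (hr₂ : r₂ < 1)
    (heq : ACF (n + 2) up um r₁ = ACF (n + 2) up um r₂) :
    ((∀ x ∈ ball (0 : E (n + 2)) r₂, up x = 0) ∨
      (∀ x ∈ ball (0 : E (n + 2)) r₂, um x = 0)) ∨
    ∃ (e : E (n + 2)) (kp km : ℝ), ‖e‖ = 1 ∧ 0 < kp ∧ 0 < km ∧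
      ∀ x ∈ ball (0 : E (n + 2)) r₂,
        up x = kp * max ⟪x, e⟫ 0 ∧ um x = km * max (-⟪x, e⟫) 0 := by
  exact ACF_main n up um hupc humc huplip humlip hup0 hum0 hprod hsubp hsubm r₁ r₂ hr₁ hr₁₂ hr₂ heq
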